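/- For every integer r ≥ 2 there exists a constant C = C(r) > 0 such that every graph G on n vertices with r | n and minimum degree δ(G) ≥ (1 − 1/r)·n contains at least (n/C)^{(r−1)n/r} distinct K_r-factors. -/

import Mathlib

open Finset

/-- `F` is a `K_r`-factor of `G`: a collection of pairwise vertex-disjoint `r`-cliques of `G`
covering every vertex. -/
def IsKrFactor {V : Type*} [Fintype V] [DecidableEq V] (G : SimpleGraph V) (r : ℕ)
    (F : Finset (Finset V)) : Prop :=
  (∀ K ∈ F, G.IsNClique r K) ∧ (F : Set (Finset V)).PairwiseDisjoint id ∧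
    F.biUnion id = Finset.univ

namespace CliqueFactor
open scoped Classical

section Reach
variable {κ : Type*}

/-- The relation `R` with all steps touching `U` removed. -/
def Avoid (R : κ → κ → Prop) (U : κ) (i j : κ) : Prop := R i j ∧ i ≠ U ∧ j ≠ U

theorem eq_of_reach_avoid_self {R : κ → κ → Prop} {U a : κ}
    (h : Relation.ReflTransGen (Avoid R U) U a) : U = a := by
  rcases Relation.ReflTransGen.cases_head h with h | ⟨c, h, _⟩
  · exact h
  · exact absurd rfl h.2.1

theorem reach_avoid_of_not_reach {R : κ → κ → Prop} {U W a i : κ}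
    (hW : ¬ Relation.ReflTransGen (Avoid R U) W a)
    (h : Relation.ReflTransGen (Avoid R U) i a) :
    Relation.ReflTransGen (Avoid R W) i a := by
  induction h using Relation.ReflTransGen.head_induction_on with
  | refl => exact .refl
  | @head i j hij hj ih =>
    refine .head ⟨hij.1, ?_, ?_⟩ ih
    · rintro rfl; exact hW (.head hij hj)
    · rintro rfl; exact hW hj

theorem reach_avoid_or {R : κ → κ → Prop} {U a i : κ} (hU : U ≠ a)
    (h : Relation.ReflTransGen R i a) :
    Relation.ReflTransGen (Avoid R U) i a ∨
      ∃ j, R U j ∧ Relation.ReflTransGen (Avoid R U) j a := by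
  induction h using Relation.ReflTransGen.head_induction_on with
  | refl => exact .inl .refl
  | @head i j hij hj ih =>
    rcases ih with ih | ih
    · by_cases hi : i = U
      · subst hi; exact .inr ⟨j, hij, ih⟩
      · by_cases hjU : j = U
        · subst hjU; exact absurd (eq_of_reach_avoid_self ih) hU
        · exact .inl (.head ⟨hij, hi, hjU⟩ ih)
    · exact .inr ih

theorem exists_terminal_set (R : κ → κ → Prop) (A : Finset κ) {a i₀ : κ} (ha : a ∈ A)
    (hi₀ : i₀ ∈ A) (hne : i₀ ≠ a) (hA : ∀ i ∈ A, Relation.ReflTransGen R i a) :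
    ∃ U ∈ A, ∃ T ⊆ A, T.Nonempty ∧ U ∉ T ∧ a ∉ T ∧
      (∀ W ∈ T, ∀ i ∈ A, i ≠ W → Relation.ReflTransGen (Avoid R W) i a) ∧
      (∀ W ∈ T, ∀ X ∈ A, X ∉ T → X ≠ U → ¬ R W X) := by
  let T : κ → Finset κ := fun U =>
    A.filter fun i => i ≠ U ∧ ¬ Relation.ReflTransGen (Avoid R U) i a
  have hTa : (T a).Nonempty := by
    refine ⟨i₀, mem_filter.2 ⟨hi₀, hne, fun h => ?_⟩⟩
    rcases Relation.ReflTransGen.cases_tail h with h | ⟨c, _, h⟩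
    · exact hne h.symm
    · exact h.2.2 rfl
  obtain ⟨U, hU, hmin⟩ := Finset.exists_min_image (A.filter fun U => (T U).Nonempty)
    (fun U => #(T U)) ⟨a, mem_filter.2 ⟨ha, hTa⟩⟩
  rw [mem_filter] at hU
  refine ⟨U, hU.1, T U, filter_subset _ _, hU.2, by simp [T], ?_, ?_, ?_⟩
  · intro h
    exact (mem_filter.1 h).2.2 .refl
  · intro W hW i hi hiW
    by_contra hcon
    have hW' := mem_filter.1 hW
    have hTW : i ∈ T W := mem_filter.2 ⟨hi, hiW, hcon⟩
    have h1 := hmin W (mem_filter.2 ⟨hW'.1, ⟨i, hTW⟩⟩)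
    have h2 : T W ⊂ T U := by
      refine (ssubset_iff_of_subset ?_).2 ⟨W, hW, by simp [T]⟩
      intro j hj
      have hj' := mem_filter.1 hj
      refine mem_filter.2 ⟨hj'.1, ?_, fun h => hj'.2.2 (reach_avoid_of_not_reach hW'.2.2 h)⟩
      rintro rfl
      by_cases hja : j = a
      · subst hja; exact hj'.2.2 .refl
      rcases reach_avoid_or hja (hA j hj'.1) with h | ⟨l, hl, h⟩
      · exact hja (eq_of_reach_avoid_self h)
      · refine hj'.2.2 (.head ⟨hl, hj'.2.1, ?_⟩ (reach_avoid_of_not_reach hW'.2.2 h))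
        rintro rfl
        exact hW'.2.2 h
    exact absurd (card_lt_card h2) (not_lt.2 h1)
  · intro W hW X hX hXT hXU hR
    have hW' := mem_filter.1 hW
    have : Relation.ReflTransGen (Avoid R U) X a := by
      by_contra h
      exact hXT (mem_filter.2 ⟨hX, hXU, h⟩)
    exact hW'.2.2 (.head ⟨hR, hW'.2.1, hXU⟩ this)

theorem exists_rank (R : κ → κ → Prop) (a : κ) : ∃ ρ : κ → ℕ,
    ∀ i, Relation.ReflTransGen R i a → (ρ i = 0 → i = a) ∧
      ∀ e, ρ i = e + 1 → ∃ j, R i j ∧ Relation.ReflTransGen R j a ∧ ρ j = e := by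
  let P : ℕ → κ → Prop := fun n => Nat.rec (fun i => i = a) (fun _ p i => ∃ j, R i j ∧ p j) n
  have hP0 : ∀ i, P 0 i ↔ i = a := fun i => Iff.rfl
  have hPs : ∀ n i, P (n + 1) i ↔ ∃ j, R i j ∧ P n j := fun n i => Iff.rfl
  have hex : ∀ i, Relation.ReflTransGen R i a → ∃ n, P n i := by
    intro i h
    induction h using Relation.ReflTransGen.head_induction_on with
    | refl => exact ⟨0, rfl⟩
    | head hij _ ih =>
      obtain ⟨n, hn⟩ := ih
      exact ⟨n + 1, _, hij, hn⟩
  have hre : ∀ n i, P n i → Relation.ReflTransGen R i a := by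
    intro n
    induction n with
    | zero => intro i h; rw [hP0] at h; rw [h]
    | succ n ih => rintro i ⟨j, hij, hj⟩; exact .head hij (ih j hj)
  refine ⟨fun i => sInf {n | P n i}, fun i hi => ⟨fun h => ?_, fun e h => ?_⟩⟩
  · have := Nat.sInf_mem (s := {n | P n i}) (hex i hi)
    simp only at h
    rw [h] at this
    exact this
  · have h1 := Nat.sInf_mem (s := {n | P n i}) (hex i hi)
    simp only at h
    rw [h] at h1
    obtain ⟨j, hij, hj⟩ := h1
    refine ⟨j, hij, hre _ _ hj, le_antisymm (Nat.sInf_le hj) ?_⟩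
    have h2 : P (sInf {n | P n j}) j := Nat.sInf_mem (s := {n | P n j}) ⟨e, hj⟩
    have h3 : sInf {n | P n i} ≤ sInf {n | P n j} + 1 := Nat.sInf_le ⟨j, hij, h2⟩
    change e ≤ sInf {n | P n j}
    omega

end Reach

section Equitable
variable {V κ : Type*}

/-- `g` properly colours `S` with colours from `B`, each colour being used exactly `s` times. -/
def IsEquitable (H : SimpleGraph V) (S : Finset V) (B : Finset κ) (s : ℕ) (g : V → κ) : Prop :=
  (∀ v ∈ S, g v ∈ B) ∧ (∀ v ∈ S, ∀ w ∈ S, H.Adj v w → g v ≠ g w) ∧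
    ∀ c ∈ B, #{v ∈ S | g v = c} = s

/-- `g` properly colours `S` with colours from `B`, each colour being used `s` times, except that
one vertex has been transferred from the class `a` to the class `b`. -/
def IsNearEquitable (H : SimpleGraph V) (S : Finset V) (B : Finset κ) (s : ℕ) (a b : κ)
    (g : V → κ) : Prop :=
  a ∈ B ∧ b ∈ B ∧ (∀ v ∈ S, g v ∈ B) ∧ (∀ v ∈ S, ∀ w ∈ S, H.Adj v w → g v ≠ g w) ∧
    ∀ c ∈ B, #{v ∈ S | g v = c} + (if c = a then 1 else 0) = s + (if c = b then 1 else 0)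

theorem card_class_update {S : Finset V} {y : V} (hy : y ∈ S) (g : V → κ) (j c : κ) :
    #{v ∈ S | Function.update g y j v = c} + (if c = g y then 1 else 0) =
      #{v ∈ S | g v = c} + (if c = j then 1 else 0) := by
  obtain ⟨T, hT, rfl⟩ : ∃ T, y ∉ T ∧ insert y T = S := ⟨S.erase y, by simp, insert_erase hy⟩
  have h1 : T.filter (fun v => Function.update g y j v = c) = T.filter (fun v => g v = c) := by
    refine filter_congr fun v hv => ?_
    rw [Function.update_of_ne (by rintro rfl; exact hT hv)]
  rw [filter_insert, filter_insert, h1, Function.update_self]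
  have h2 : y ∉ T.filter (fun v => g v = c) := fun h => hT (mem_filter.1 h).1
  by_cases e1 : c = g y <;> by_cases e2 : c = j <;>
    simp [e1, e2, eq_comm] <;> subst_vars <;>
    simp_all [card_insert_of_notMem, eq_comm]

theorem proper_update {H : SimpleGraph V} {S : Finset V} {y : V} {g : V → κ} {j : κ}
    (hg : ∀ v ∈ S, ∀ w ∈ S, H.Adj v w → g v ≠ g w) (hj : ∀ w ∈ S, w ≠ y → g w = j → ¬ H.Adj y w) :
    ∀ v ∈ S, ∀ w ∈ S, H.Adj v w → Function.update g y j v ≠ Function.update g y j w := by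
  intro v hv w hw hvw
  by_cases h1 : v = y
  · subst h1
    rw [Function.update_self, Function.update_of_ne hvw.ne']
    exact fun h => hj w hw hvw.ne' h.symm hvw
  · by_cases h2 : w = y
    · subst h2
      rw [Function.update_self, Function.update_of_ne h1]
      exact fun h => hj v hv h1 h hvw.symm
    · rw [Function.update_of_ne h1, Function.update_of_ne h2]
      exact hg v hv w hw hvw

theorem exists_equitable_of_rank {H : SimpleGraph V} {S : Finset V} {B C : Finset κ} {s : ℕ}
    {a : κ} (ρ : κ → ℕ) (hC : C ⊆ B) (d : ℕ) : ∀ (b : κ) (g : V → κ),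
    IsNearEquitable H S B s a b g → b ∈ C → ρ b = d →
    (∀ i ∈ C, ρ i ≤ d → (ρ i = 0 → i = a) ∧ ∀ e, ρ i = e + 1 → ∃ j ∈ C, ρ j = e ∧
      ∃ y ∈ S, g y = i ∧ ∀ w ∈ S, g w = j → ¬ H.Adj y w) →
    ∃ g', IsEquitable H S B s g' := by
  induction d with
  | zero =>
    intro b g hg hb hbd hρ
    obtain rfl := (hρ b hb hbd.le).1 hbd
    exact ⟨g, hg.2.2.1, hg.2.2.2.1, fun c hc => by have := hg.2.2.2.2 c hc; omega⟩
  | succ d ih =>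
    intro b g hg hb hbd hρ
    obtain ⟨j, hj, hjd, y, hy, hyb, hyj⟩ := (hρ b hb hbd.le).2 d hbd
    have hjb : j ≠ b := by rintro rfl; omega
    refine ih j (Function.update g y j) ⟨hg.1, hC hj, ?_, ?_, ?_⟩ hj hjd ?_
    · intro v hv
      by_cases h : v = y
      · subst h; simpa using hC hj
      · rw [Function.update_of_ne h]; exact hg.2.2.1 v hv
    · exact proper_update hg.2.2.2.1 fun w hw _ h => hyj w hw h
    · intro c hc
      have h1 := card_class_update hy g j c
      have h2 := hg.2.2.2.2 c hc
      rw [hyb] at h1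
      omega
    · intro i hi hid
      obtain ⟨h0, h1⟩ := hρ i hi (by omega)
      refine ⟨h0, fun e he => ?_⟩
      obtain ⟨j', hj', hje, y', hy', hyi, hyj'⟩ := h1 e he
      refine ⟨j', hj', hje, y', hy', ?_, ?_⟩
      · rw [Function.update_of_ne]
        · exact hyi
        · rintro rfl
          rw [hyb] at hyi
          subst hyi
          omega
      · intro w hw hwj
        by_cases h : w = y
        · subst h
          rw [Function.update_self] at hwj
          subst hwj
          omega
        · rw [Function.update_of_ne h] at hwj
          exact hyj' w hw hwj

theorem IsEquitable.merge {H : SimpleGraph V} {S₁ S₂ S : Finset V} {B₁ B₂ B : Finset κ} {s : ℕ}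
    {g₁ g₂ g : V → κ} (h₁ : IsEquitable H S₁ B₁ s g₁) (h₂ : IsEquitable H S₂ B₂ s g₂)
    (hS : Disjoint S₁ S₂) (hB : Disjoint B₁ B₂) (hSu : S = S₁ ∪ S₂) (hBu : B = B₁ ∪ B₂)
    (e1 : ∀ v ∈ S₁, g v = g₁ v) (e2 : ∀ v ∈ S₂, g v = g₂ v) : IsEquitable H S B s g := by
  subst hSu hBu
  have key : ∀ v ∈ S₁, ∀ w ∈ S₂, g₁ v ≠ g₂ w := fun v hv w hw h =>
    disjoint_left.1 hB (h₁.1 v hv) (h ▸ h₂.1 w hw)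
  refine ⟨?_, ?_, ?_⟩
  · intro v hv
    rcases mem_union.1 hv with hv | hv
    · rw [e1 v hv]; exact mem_union_left _ (h₁.1 v hv)
    · rw [e2 v hv]; exact mem_union_right _ (h₂.1 v hv)
  · intro v hv w hw hvw
    rcases mem_union.1 hv with hv | hv <;> rcases mem_union.1 hw with hw | hw
    · rw [e1 v hv, e1 w hw]; exact h₁.2.1 v hv w hw hvw
    · rw [e1 v hv, e2 w hw]; exact key v hv w hw
    · rw [e2 v hv, e1 w hw]; exact (key w hw v hv).symm
    · rw [e2 v hv, e2 w hw]; exact h₂.2.1 v hv w hw hvw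
  · intro c hc
    rw [filter_union, filter_congr (fun v hv => by rw [e1 v hv]),
      filter_congr (s := S₂) (fun v hv => by rw [e2 v hv]),
      card_union_of_disjoint (disjoint_filter_filter hS)]
    rcases mem_union.1 hc with hc | hc
    · rw [h₁.2.2 c hc]
      simp only [Nat.add_eq_left, card_eq_zero, filter_eq_empty_iff]
      exact fun v hv h => disjoint_left.1 hB hc (h ▸ h₂.1 v hv)
    · rw [h₂.2.2 c hc]
      simp only [Nat.add_eq_right, card_eq_zero, filter_eq_empty_iff]
      exact fun v hv h => disjoint_left.1 hB (h₁.1 v hv) (h ▸ hc)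

theorem reach_mono {R R' : κ → κ → Prop} {i a : κ} (h : Relation.ReflTransGen R i a)
    (hR : ∀ i j, R i j → Relation.ReflTransGen R j a → R' i j) :
    Relation.ReflTransGen R' i a := by
  induction h using Relation.ReflTransGen.head_induction_on with
  | refl => exact .refl
  | head hij hj ih => exact .head (hR _ _ hij hj) ih

/-- Some vertex of colour `i` can be recoloured with `j`. -/
def Movable (H : SimpleGraph V) (S : Finset V) (B : Finset κ) (g : V → κ) (i j : κ) : Prop :=
  i ∈ B ∧ j ∈ B ∧ i ≠ j ∧ ∃ y ∈ S, g y = i ∧ ∀ w ∈ S, g w = j → ¬ H.Adj y w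

/-- The colours from which `a` can be reached by successive recolourings. -/
noncomputable def accessible (H : SimpleGraph V) (S : Finset V) (B : Finset κ) (a : κ)
    (g : V → κ) : Finset κ :=
  B.filter fun i => Relation.ReflTransGen (Movable H S B g) i a

theorem exists_equitable_of_reach {H : SimpleGraph V} {S : Finset V} {B : Finset κ} {s : ℕ}
    {a b : κ} {g : V → κ} (R : κ → κ → Prop) (hg : IsNearEquitable H S B s a b g)
    (hb : Relation.ReflTransGen R b a)
    (hR : ∀ i j, R i j → Relation.ReflTransGen R j a → j ≠ b →
      j ∈ B ∧ ∃ y ∈ S, g y = i ∧ ∀ w ∈ S, g w = j → ¬ H.Adj y w) :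
    ∃ g', IsEquitable H S B s g' := by
  obtain ⟨ρ, hρ⟩ := exists_rank R a
  refine exists_equitable_of_rank (C := B.filter fun i => Relation.ReflTransGen R i a) ρ
    (filter_subset _ _) (ρ b) b g hg (mem_filter.2 ⟨hg.2.1, hb⟩) rfl ?_
  intro i hi hid
  have hi' := (mem_filter.1 hi).2
  refine ⟨(hρ i hi').1, fun e he => ?_⟩
  obtain ⟨j, hij, hj, hje⟩ := (hρ i hi').2 e he
  have hjb : j ≠ b := by rintro rfl; omega
  obtain ⟨h1, h2⟩ := hR i j hij hj hjb
  exact ⟨j, mem_filter.2 ⟨h1, hj⟩, hje, h2⟩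

/-- The Hajnal–Szemerédi statement for `q` colours. -/
def HasEquitableColorings (V κ : Type*) (q : ℕ) : Prop :=
  ∀ (H : SimpleGraph V) (S : Finset V) (B : Finset κ) (s : ℕ), #B = q → #S = s * q →
    (∀ v ∈ S, #{w ∈ S | H.Adj v w} < q) → ∃ g, IsEquitable H S B s g

theorem IsNearEquitable.card_filter_mem {H : SimpleGraph V} {S : Finset V} {B : Finset κ} {s : ℕ}
    {a b : κ} {g : V → κ} (hg : IsNearEquitable H S B s a b g) {D : Finset κ} (hD : D ⊆ B) :
    #{v ∈ S | g v ∈ D} + (if a ∈ D then 1 else 0) = s * #D + (if b ∈ D then 1 else 0) := by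
  have h1 : #{v ∈ S | g v ∈ D} = ∑ c ∈ D, #{v ∈ S | g v = c} := by
    rw [card_eq_sum_card_fiberwise (s := S.filter fun v => g v ∈ D) (f := g) (t := D)
      (fun v hv => (mem_filter.1 hv).2)]
    refine sum_congr rfl fun c hc => congrArg _ ?_
    rw [filter_filter]
    refine filter_congr fun v _ => ⟨fun h => h.2, fun h => ⟨h ▸ hc, h⟩⟩
  have h2 : ∑ c ∈ D, (#{v ∈ S | g v = c} + (if c = a then 1 else 0)) =
      ∑ c ∈ D, (s + (if c = b then 1 else 0)) :=
    sum_congr rfl fun c hc => hg.2.2.2.2 c (hD hc)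
  simp only [sum_add_distrib, sum_ite_eq', sum_const, smul_eq_mul] at h2
  rw [h1, h2, mul_comm]

theorem sum_card_adj_comm (H : SimpleGraph V) (X Y : Finset V) :
    ∑ x ∈ X, #{y ∈ Y | H.Adj x y} = ∑ y ∈ Y, #{x ∈ X | H.Adj y x} := by
  have := sum_card_bipartiteAbove_eq_sum_card_bipartiteBelow (s := X) (t := Y) H.Adj
  simp only [bipartiteAbove, bipartiteBelow] at this
  rw [this]
  exact sum_congr rfl fun y _ => congrArg _ (filter_congr fun x _ => H.adj_comm x y)

theorem exists_equitable_of_solo_move {H : SimpleGraph V} {S : Finset V} {B : Finset κ} {s : ℕ}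
    {a b : κ} {g : V → κ} (hg : IsNearEquitable H S B s a b g)
    (hT : HasEquitableColorings V κ #(B \ accessible H S B a g))
    (hdB : ∀ y ∈ S, g y ∉ accessible H S B a g →
      #{w ∈ S.filter (fun v => g v ∉ accessible H S B a g) | H.Adj y w} <
        #(B \ accessible H S B a g))
    (hb : b ∉ accessible H S B a g) {y z : V} {X : κ} (hy : y ∈ S)
    (hyA : g y ∉ accessible H S B a g) (hz : z ∈ S) (hzA : g z ∈ accessible H S B a g)
    (hX : X ∈ accessible H S B a g) (hXz : X ≠ g z)
    (hreach : Relation.ReflTransGen (Avoid (Movable H S B g) (g z)) X a)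
    (hsolo : ∀ w ∈ S, g w = g z → H.Adj y w → w = z)
    (hmove : ∀ w ∈ S, g w = X → ¬ H.Adj z w) :
    ∃ g', IsEquitable H S B s g' := by
  set A := accessible H S B a g with hA
  have hAB : A ⊆ B := filter_subset _ _
  have haA : a ∈ A := mem_filter.2 ⟨hg.1, .refl⟩
  have hzy : z ≠ y := by rintro rfl; exact hyA hzA
  set S₁ := insert y (S.filter fun v => g v ∈ A) with hS₁
  have hS₁S : S₁ ⊆ S := insert_subset hy (filter_subset _ _)
  have hyS₁ : y ∈ S₁ := mem_insert_self _ _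
  have hzS₁ : z ∈ S₁ := mem_insert_of_mem (mem_filter.2 ⟨hz, hzA⟩)
  set g₁ := Function.update (Function.update g z X) y (g z) with hg₁
  have g₁y : g₁ y = g z := Function.update_self ..
  have g₁z : g₁ z = X := by rw [hg₁, Function.update_of_ne hzy, Function.update_self]
  have g₁o : ∀ v, v ≠ y → v ≠ z → g₁ v = g v := fun v h1 h2 => by
    rw [hg₁, Function.update_of_ne h1, Function.update_of_ne h2]
  have hne : IsNearEquitable H S₁ A s a X g₁ := by
    refine ⟨haA, hX, ?_, ?_, ?_⟩
    · intro v hv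
      by_cases h1 : v = y
      · rw [h1, g₁y]; exact hzA
      by_cases h2 : v = z
      · rw [h2, g₁z]; exact hX
      rw [g₁o v h1 h2]
      exact (mem_filter.1 ((mem_insert.1 hv).resolve_left h1)).2
    · refine proper_update ?_ ?_
      · intro v hv w hw
        exact proper_update hg.2.2.2.1 (fun w hw _ h => hmove w hw h) v (hS₁S hv) w (hS₁S hw)
      · intro w hw hwy h hadj
        by_cases h2 : w = z
        · subst h2; rw [Function.update_self] at h; exact hXz h
        · rw [Function.update_of_ne h2] at h
          exact h2 (hsolo w (hS₁S hw) h hadj)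
    · intro c hc
      have h1 := card_class_update hyS₁ (Function.update g z X) (g z) c
      have h2 := card_class_update hzS₁ g X c
      have h3 := hg.2.2.2.2 c (hAB hc)
      have h4 : S₁.filter (fun v => g v = c) = S.filter (fun v => g v = c) := by
        refine Subset.antisymm (filter_subset_filter _ hS₁S) fun v hv => ?_
        obtain ⟨hvS, rfl⟩ := mem_filter.1 hv
        exact mem_filter.2 ⟨mem_insert_of_mem (mem_filter.2 ⟨hvS, hc⟩), rfl⟩
      rw [Function.update_of_ne (Ne.symm hzy),
        if_neg (show c ≠ g y from fun h => hyA (h ▸ hc))] at h1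
      rw [if_neg (show c ≠ b from fun h => hb (h ▸ hc))] at h3
      rw [h4] at h2
      rw [hg₁]
      omega
  have hmemA : ∀ j ∈ B, Relation.ReflTransGen (Avoid (Movable H S B g) (g z)) j a → j ∈ A :=
    fun j hj h => mem_filter.2 ⟨hj, reach_mono h fun _ _ h _ => h.1⟩
  obtain ⟨g₄, hg₄⟩ := exists_equitable_of_reach _ hne hreach <| by
    intro i j hij hj hjX
    obtain ⟨hiB, hjB, _, y', hy', hyi, hyj⟩ := hij.1
    refine ⟨hmemA j hjB hj, ?_⟩
    have hiA := hmemA i hiB (.head hij hj)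
    have h1 : y' ≠ y := by rintro rfl; rw [hyi] at hyA; exact hyA hiA
    have h2 : y' ≠ z := by rintro rfl; exact hij.2.1 hyi.symm
    refine ⟨y', mem_insert_of_mem (mem_filter.2 ⟨hy', hyi ▸ hiA⟩), by rw [g₁o y' h1 h2, hyi], ?_⟩
    intro w hw hwj
    by_cases h3 : w = y
    · rw [h3, g₁y] at hwj; exact absurd hwj.symm hij.2.2
    by_cases h4 : w = z
    · rw [h4, g₁z] at hwj; exact absurd hwj.symm hjX
    rw [g₁o w h3 h4] at hwj
    exact hyj w (hS₁S hw) hwj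
  set Bv := S.filter (fun v => g v ∉ A) with hBv
  have hyBv : y ∈ Bv := mem_filter.2 ⟨hy, hyA⟩
  have hcard : #Bv = s * #(B \ A) + 1 := by
    have h1 := hg.card_filter_mem (sdiff_subset (s := B) (t := A))
    rw [if_neg (by simp [haA]), if_pos (mem_sdiff.2 ⟨hg.2.1, hb⟩)] at h1
    rw [← h1, hBv]
    refine congrArg _ (filter_congr fun v hv => ?_)
    simp [hg.2.2.1 v hv]
  obtain ⟨g₅, hg₅⟩ := hT H (Bv.erase y) (B \ A) s rfl (by rw [card_erase_of_mem hyBv]; omega) <| by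
    intro v hv
    have hv' := mem_filter.1 (mem_of_mem_erase hv)
    exact (card_le_card (filter_subset_filter _ (erase_subset _ _))).trans_lt (hdB v hv'.1 hv'.2)
  have hdisj : Disjoint S₁ (Bv.erase y) := by
    rw [disjoint_left]
    intro v hv hv'
    rcases mem_insert.1 hv with h | h
    · exact (mem_erase.1 hv').1 h
    · exact (mem_filter.1 (mem_erase.1 hv').2).2 (mem_filter.1 h).2
  refine ⟨fun v => if v ∈ S₁ then g₄ v else g₅ v, hg₄.merge hg₅ hdisj disjoint_sdiff ?_
    (union_sdiff_of_subset hAB).symm (fun v hv => if_pos hv)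
    fun v hv => if_neg (disjoint_right.1 hdisj hv)⟩
  ext v
  simp only [hS₁, hBv, mem_union, mem_insert, mem_filter, mem_erase]
  constructor
  · intro hv
    by_cases h1 : v = y
    · exact .inl (.inl h1)
    · by_cases h2 : g v ∈ A
      · exact .inl (.inr ⟨hv, h2⟩)
      · exact .inr ⟨h1, hv, h2⟩
  · rintro ((h | h) | h)
    · exact h ▸ hy
    · exact h.1
    · exact h.2.1

theorem exists_accessible_lt_of_solo_pair {H : SimpleGraph V} {S : Finset V} {B : Finset κ} {s : ℕ}
    {a b : κ} {g : V → κ} (hg : IsNearEquitable H S B s a b g)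
    (hT : HasEquitableColorings V κ #(B \ accessible H S B a g))
    (hdB : ∀ y ∈ S, g y ∉ accessible H S B a g →
      #{w ∈ S.filter (fun v => g v ∉ accessible H S B a g) | H.Adj y w} <
        #(B \ accessible H S B a g))
    (hb : b ∉ accessible H S B a g) {y₁ y₂ z : V} (hy₁ : y₁ ∈ S) (hy₂ : y₂ ∈ S)
    (hyA₁ : g y₁ ∉ accessible H S B a g) (hyA₂ : g y₂ ∉ accessible H S B a g)
    (hz : z ∈ S) (hzA : g z ∈ accessible H S B a g) (hza : g z ≠ a)
    (hterm : ∀ i ∈ accessible H S B a g, i ≠ g z →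
      Relation.ReflTransGen (Avoid (Movable H S B g) (g z)) i a)
    (hsolo₁ : ∀ w ∈ S, g w = g z → H.Adj y₁ w → w = z)
    (hsolo₂ : ∀ w ∈ S, g w = g z → H.Adj y₂ w → w = z)
    (hadj : H.Adj z y₁) (hy : y₁ ≠ y₂) (hyy : ¬ H.Adj y₁ y₂)
    (hdz : #{w ∈ S.filter (fun v => g v ∉ accessible H S B a g) | H.Adj z w} ≤
      #(B \ accessible H S B a g))
    (hstuck : ∀ X ∈ accessible H S B a g, X ≠ g z → ∃ w ∈ S, g w = X ∧ H.Adj z w) :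
    ∃ b' g', IsNearEquitable H S B s a b' g' ∧
      #(accessible H S B a g) < #(accessible H S B a g') := by
  set A := accessible H S B a g with hA
  have hAB : A ⊆ B := filter_subset _ _
  have haA : a ∈ A := mem_filter.2 ⟨hg.1, .refl⟩
  set Bv := S.filter (fun v => g v ∉ A) with hBv
  have hyBv : y₁ ∈ Bv := mem_filter.2 ⟨hy₁, hyA₁⟩
  have hcard : #Bv = s * #(B \ A) + 1 := by
    have h1 := hg.card_filter_mem (sdiff_subset (s := B) (t := A))
    rw [if_neg (by simp [haA]), if_pos (mem_sdiff.2 ⟨hg.2.1, hb⟩)] at h1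
    rw [← h1, hBv]
    refine congrArg _ (filter_congr fun v hv => ?_)
    simp [hg.2.2.1 v hv]
  obtain ⟨g₂, hg₂⟩ := hT H (Bv.erase y₁) (B \ A) s rfl (by rw [card_erase_of_mem hyBv]; omega) <| by
    intro v hv
    have hv' := mem_filter.1 (mem_of_mem_erase hv)
    exact (card_le_card (filter_subset_filter _ (erase_subset _ _))).trans_lt (hdB v hv'.1 hv'.2)
  obtain ⟨Y, hYB, hY⟩ : ∃ Y ∈ B \ A, ∀ w ∈ Bv.erase y₁, g₂ w = Y → ¬ H.Adj z w := by
    by_contra! hcon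
    have h1 : B \ A ⊆ ((Bv.erase y₁).filter fun w => H.Adj z w).image g₂ := by
      intro c hc
      obtain ⟨w, hw, hwc, hzw⟩ := hcon c hc
      exact mem_image.2 ⟨w, mem_filter.2 ⟨hw, hzw⟩, hwc⟩
    have h2 : (Bv.erase y₁).filter (fun w => H.Adj z w) ⊂ Bv.filter fun w => H.Adj z w := by
      refine (ssubset_iff_of_subset (filter_subset_filter _ (erase_subset _ _))).2 ⟨y₁, ?_, ?_⟩
      · exact mem_filter.2 ⟨hyBv, hadj⟩
      · simp
    have h3 := card_le_card h1
    have h4 := card_lt_card h2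
    have h5 := card_image_le (s := (Bv.erase y₁).filter fun w => H.Adj z w) (f := g₂)
    omega
  have hYA : Y ∉ A := (mem_sdiff.1 hYB).2
  have hzBv : z ∉ Bv := fun h => (mem_filter.1 h).2 hzA
  have hzy : z ≠ y₁ := hadj.ne
  let g₃ : V → κ := fun v => if v = z then Y else if v = y₁ then g z else
    if v ∈ Bv then g₂ v else g v
  have g₃z : g₃ z = Y := by simp [g₃]
  have g₃y : g₃ y₁ = g z := by simp [g₃, hzy.symm]
  have g₃o : ∀ v ∈ S, g v ∈ A → v ≠ z → g₃ v = g v := by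
    intro v hv hvA hvz
    have h1 : v ≠ y₁ := by rintro rfl; exact hyA₁ hvA
    have h2 : v ∉ Bv := fun h => (mem_filter.1 h).2 hvA
    simp [g₃, hvz, h1, h2]
  have g₃B : ∀ v ∈ Bv.erase y₁, g₃ v = g₂ v := by
    intro v hv
    obtain ⟨h1, h2⟩ := mem_erase.1 hv
    have h3 : v ≠ z := by rintro rfl; exact hzBv h2
    simp [g₃, h1, h2, h3]
  have hcases : ∀ v ∈ S, v = z ∨ v = y₁ ∨ (v ≠ z ∧ g v ∈ A) ∨ v ∈ Bv.erase y₁ := by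
    intro v hv
    by_cases h1 : v = z
    · exact .inl h1
    by_cases h2 : v = y₁
    · exact .inr (.inl h2)
    by_cases h3 : g v ∈ A
    · exact .inr (.inr (.inl ⟨h1, h3⟩))
    · exact .inr (.inr (.inr (mem_erase.2 ⟨h2, mem_filter.2 ⟨hv, h3⟩⟩)))
  have hinvA : ∀ v ∈ S, ∀ c ∈ A, g₃ v = c → (v ≠ z ∧ g v = c) ∨ (v = y₁ ∧ c = g z) := by
    intro v hv c hc hvc
    rcases hcases v hv with rfl | rfl | ⟨h1, h2⟩ | h
    · rw [g₃z] at hvc; subst hvc; exact absurd hc hYA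
    · rw [g₃y] at hvc; exact .inr ⟨rfl, hvc.symm⟩
    · rw [g₃o v hv h2 h1] at hvc; exact .inl ⟨h1, hvc⟩
    · rw [g₃B v h] at hvc; subst hvc; exact absurd hc (mem_sdiff.1 (hg₂.1 v h)).2
  have hinvB : ∀ v ∈ S, ∀ c ∉ A, g₃ v = c → (v = z ∧ c = Y) ∨ (v ∈ Bv.erase y₁ ∧ g₂ v = c) := by
    intro v hv c hc hvc
    rcases hcases v hv with rfl | rfl | ⟨h1, h2⟩ | h
    · rw [g₃z] at hvc; exact .inl ⟨rfl, hvc.symm⟩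
    · rw [g₃y] at hvc; subst hvc; exact absurd hzA hc
    · rw [g₃o v hv h2 h1] at hvc; subst hvc; exact absurd h2 hc
    · rw [g₃B v h] at hvc; exact .inr ⟨h, hvc⟩
  have hmem₃ : ∀ v ∈ S, g₃ v ∈ B := by
    intro v hv
    rcases hcases v hv with rfl | rfl | ⟨h1, h2⟩ | h
    · rw [g₃z]; exact (mem_sdiff.1 hYB).1
    · rw [g₃y]; exact hAB hzA
    · rw [g₃o v hv h2 h1]; exact hAB h2
    · rw [g₃B v h]; exact (mem_sdiff.1 (hg₂.1 v h)).1
  have hprop₃ : ∀ v ∈ S, ∀ w ∈ S, H.Adj v w → g₃ v ≠ g₃ w := by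
    intro v hv w hw hvw heq
    by_cases hc : g₃ w ∈ A
    · rcases hinvA v hv _ hc heq with ⟨h1, h2⟩ | ⟨h1, h2⟩ <;>
        rcases hinvA w hw _ hc rfl with ⟨h3, h4⟩ | ⟨h3, h4⟩
      · exact hg.2.2.2.1 v hv w hw hvw (h2.trans h4.symm)
      · subst h3; exact h1 (hsolo₁ v hv (h2.trans h4) hvw.symm)
      · subst h1; exact h3 (hsolo₁ w hw (h4.trans h2) hvw)
      · subst h1 h3; exact hvw.ne rfl
    · rcases hinvB v hv _ hc heq with ⟨h1, h2⟩ | ⟨h1, h2⟩ <;>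
        rcases hinvB w hw _ hc rfl with ⟨h3, h4⟩ | ⟨h3, h4⟩
      · subst h1 h3; exact hvw.ne rfl
      · subst h1; exact hY w h3 (h4.trans h2) hvw
      · subst h3; exact hY v h1 (h2.trans h4) hvw.symm
      · exact hg₂.2.1 v h1 w h3 hvw (h2.trans h4.symm)
  have hne : IsNearEquitable H S B s a Y g₃ := by
    refine ⟨hg.1, (mem_sdiff.1 hYB).1, hmem₃, hprop₃, fun c hc => ?_⟩
    have h0 := hg.2.2.2.2 c hc
    by_cases hcA : c ∈ A
    · rw [if_neg (show c ≠ Y from fun h => hYA (h ▸ hcA))]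
      rw [if_neg (show c ≠ b from fun h => hb (h ▸ hcA))] at h0
      rw [← h0]
      congr 1
      by_cases hcW : c = g z
      · have e : S.filter (fun v => g₃ v = c) =
            insert y₁ ((S.filter fun v => g v = c).erase z) := by
          ext v
          simp only [mem_filter, mem_insert, mem_erase]
          constructor
          · rintro ⟨hv, h⟩
            rcases hinvA v hv c hcA h with ⟨h1, h2⟩ | ⟨h1, h2⟩
            · exact .inr ⟨h1, hv, h2⟩
            · exact .inl h1
          · rintro (rfl | ⟨h1, hv, h2⟩)
            · exact ⟨hy₁, by rw [g₃y, hcW]⟩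
            · exact ⟨hv, by rw [g₃o v hv (h2 ▸ hcA) h1, h2]⟩
        have hz' : z ∈ S.filter fun v => g v = c := mem_filter.2 ⟨hz, hcW.symm⟩
        rw [e, card_insert_of_notMem, card_erase_of_mem hz']
        · have := card_pos.2 ⟨z, hz'⟩
          omega
        · intro h
          have := (mem_filter.1 (mem_of_mem_erase h)).2
          exact hyA₁ (this ▸ hcA)
      · refine congrArg _ (filter_congr fun v hv => ⟨fun h => ?_, fun h => ?_⟩)
        · rcases hinvA v hv c hcA h with ⟨h1, h2⟩ | ⟨h1, h2⟩
          · exact h2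
          · exact absurd h2 hcW
        · rw [g₃o v hv (h ▸ hcA), h]
          rintro rfl
          exact hcW h.symm
    · rw [if_neg (show c ≠ a from fun h => hcA (h ▸ haA))]
      have h1 := hg₂.2.2 c (mem_sdiff.2 ⟨hc, hcA⟩)
      by_cases hcY : c = Y
      · have e : S.filter (fun v => g₃ v = c) =
            insert z ((Bv.erase y₁).filter fun v => g₂ v = c) := by
          ext v
          simp only [mem_filter, mem_insert]
          constructor
          · rintro ⟨hv, h⟩
            rcases hinvB v hv c hcA h with ⟨h1, h2⟩ | h
            · exact .inl h1
            · exact .inr h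
          · rintro (rfl | ⟨h1, h2⟩)
            · exact ⟨hz, by rw [g₃z, hcY]⟩
            · exact ⟨(mem_filter.1 (mem_of_mem_erase h1)).1, by rw [g₃B v h1, h2]⟩
        rw [e, card_insert_of_notMem (fun h => hzBv (mem_of_mem_erase (mem_filter.1 h).1)), h1,
          if_pos hcY]
      · have e : S.filter (fun v => g₃ v = c) = (Bv.erase y₁).filter fun v => g₂ v = c := by
          ext v
          simp only [mem_filter]
          constructor
          · rintro ⟨hv, h⟩
            rcases hinvB v hv c hcA h with ⟨h1, h2⟩ | h
            · exact absurd h2 hcY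
            · exact h
          · rintro ⟨h1, h2⟩
            exact ⟨(mem_filter.1 (mem_of_mem_erase h1)).1, by rw [g₃B v h1, h2]⟩
        rw [e, h1, if_neg hcY]
  refine ⟨Y, g₃, hne, ?_⟩
  have hmemA : ∀ j ∈ B, Relation.ReflTransGen (Movable H S B g) j a → j ∈ A :=
    fun j hj h => mem_filter.2 ⟨hj, h⟩
  have hmv : ∀ i j, Movable H S B g i j → Relation.ReflTransGen (Movable H S B g) j a →
      j ≠ g z → Movable H S B g₃ i j := by
    intro i j hij hj hjz
    have hjA : j ∈ A := hmemA j hij.2.1 hj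
    have hiA : i ∈ A := hmemA i hij.1 (.head hij hj)
    obtain ⟨hiB, hjB, hne, y, hyS, hyi, hyj⟩ := hij
    refine ⟨hiB, hjB, hne, y, hyS, ?_, ?_⟩
    · rw [g₃o y hyS (hyi ▸ hiA), hyi]
      rintro rfl
      obtain ⟨w, hw, hwj, hyw⟩ := hstuck j hjA hjz
      exact hyj w hw hwj hyw
    · intro w hw hwj
      rcases hinvA w hw j hjA hwj with ⟨_, h⟩ | ⟨_, h⟩
      · exact hyj w hw h
      · exact absurd h hjz
  have hacc₃ : ∀ i ∈ A, i ≠ g z → Relation.ReflTransGen (Movable H S B g₃) i a := by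
    intro i hi hiz
    refine reach_mono (hterm i hi hiz) fun i j hij hj => ?_
    exact hmv i j hij.1 (reach_mono hj fun _ _ h _ => h.1) hij.2.2
  have hW₃ : Relation.ReflTransGen (Movable H S B g₃) (g z) a := by
    rcases Relation.ReflTransGen.cases_head (mem_filter.1 hzA).2 with h | ⟨j, hj, hja⟩
    · exact absurd h hza
    · have hjz : j ≠ g z := hj.2.2.1.symm
      exact .head (hmv _ _ hj hja hjz) (hacc₃ j (hmemA j hj.2.1 hja) hjz)
  have hy₂B : y₂ ∈ Bv.erase y₁ := mem_erase.2 ⟨hy.symm, mem_filter.2 ⟨hy₂, hyA₂⟩⟩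
  have hc₂ := mem_sdiff.1 (hg₂.1 y₂ hy₂B)
  have hnew : g₂ y₂ ∈ accessible H S B a g₃ := by
    refine mem_filter.2 ⟨hc₂.1, .head ⟨hc₂.1, hAB hzA, ?_, y₂, hy₂, g₃B y₂ hy₂B, ?_⟩ hW₃⟩
    · intro h; exact hc₂.2 (h ▸ hzA)
    · intro w hw hwz hyw
      rcases hinvA w hw _ hzA hwz with ⟨h1, h2⟩ | ⟨h1, _⟩
      · exact h1 (hsolo₂ w hw h2 hyw)
      · subst h1; exact hyy hyw.symm
  refine card_lt_card ((ssubset_iff_of_subset fun i hi => ?_).2 ⟨_, hnew, hc₂.2⟩)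
  by_cases h : i = g z
  · exact mem_filter.2 ⟨hAB hi, h ▸ hW₃⟩
  · exact mem_filter.2 ⟨hAB hi, hacc₃ i hi h⟩

theorem div_le_div_of_add_le {t q d m : ℚ} (hq : 0 < q) (hd : 0 < d + 1) (htq : q ≤ t)
    (hdq : d + 1 ≤ q) (h : t + d + 1 ≤ m + q) : t / q ≤ m / (d + 1) := by
  rw [div_le_div_iff₀ hq hd]
  nlinarith [mul_nonneg (sub_nonneg.2 hdq) (sub_nonneg.2 htq), mul_le_mul_of_nonneg_right h hq.le]

set_option maxHeartbeats 1000000 in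
theorem exists_equitable_or_accessible_lt {H : SimpleGraph V} {S : Finset V} {B : Finset κ} {s : ℕ}
    {a b : κ} {g : V → κ} (hg : IsNearEquitable H S B s a b g)
    (hT : ∀ q, 1 ≤ q → q < #B → HasEquitableColorings V κ q)
    (hdeg : ∀ v ∈ S, #{w ∈ S | H.Adj v w} < #B) (hb : b ∉ accessible H S B a g) :
    (∃ g', IsEquitable H S B s g') ∨ ∃ b' g', IsNearEquitable H S B s a b' g' ∧
      #(accessible H S B a g) < #(accessible H S B a g') := by
  set A := accessible H S B a g with hA
  have hAB : A ⊆ B := filter_subset _ _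
  have haA : a ∈ A := mem_filter.2 ⟨hg.1, .refl⟩
  set q := #(B \ A) with hq
  have hAq : #A + q = #B := by rw [add_comm]; exact card_sdiff_add_card_eq_card hAB
  have hA1 : 1 ≤ #A := card_pos.2 ⟨a, haA⟩
  have hq1 : 1 ≤ q := card_pos.2 ⟨b, mem_sdiff.2 ⟨hg.2.1, hb⟩⟩
  have hTq := hT q hq1 (by omega)
  set Bv := S.filter (fun v => g v ∉ A) with hBv
  have hcard : #Bv = s * q + 1 := by
    have h1 := hg.card_filter_mem (sdiff_subset (s := B) (t := A))
    rw [if_neg (by simp [haA]), if_pos (mem_sdiff.2 ⟨hg.2.1, hb⟩)] at h1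
    rw [← h1, hBv]
    refine congrArg _ (filter_congr fun v hv => ?_)
    simp [hg.2.2.1 v hv]
  let nb : V → κ → ℕ := fun x c => #{w ∈ S.filter (fun w => g w = c) | H.Adj x w}
  let dB : V → ℕ := fun x => #{w ∈ Bv | H.Adj x w}
  have hnb : ∀ x c, nb x c ≠ 0 ↔ ∃ w ∈ S, g w = c ∧ H.Adj x w := by
    intro x c
    rw [← Nat.pos_iff_ne_zero, card_pos]
    constructor
    · rintro ⟨w, hw⟩
      simp only [mem_filter] at hw
      exact ⟨w, hw.1.1, hw.1.2, hw.2⟩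
    · rintro ⟨w, h1, h2, h3⟩
      exact ⟨w, by simp [h1, h2, h3]⟩
  have hdeg' : ∀ x ∈ S, dB x + ∑ c ∈ A, nb x c < #B := by
    intro x hx
    refine lt_of_eq_of_lt ?_ (hdeg x hx)
    rw [← card_filter_add_card_filter_not (s := S.filter fun w => H.Adj x w) (fun w => g w ∉ A)]
    congr 1
    · simp only [dB, hBv, filter_filter]
      exact congrArg _ (filter_congr fun _ _ => and_comm)
    · rw [card_eq_sum_card_fiberwise (s := (S.filter fun w => H.Adj x w).filter fun w => ¬ g w ∉ A)
        (f := g) (t := A) (fun v hv => not_not.1 (mem_filter.1 hv).2)]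
      refine sum_congr rfl fun c hc => congrArg card ?_
      ext w
      simp only [mem_filter, not_not]
      constructor
      · rintro ⟨⟨h1, h2⟩, h3⟩; exact ⟨⟨⟨h1, h3⟩, h2 ▸ hc⟩, h2⟩
      · rintro ⟨⟨⟨h1, h3⟩, _⟩, h2⟩; exact ⟨⟨h1, h2⟩, h3⟩
  have hbound : ∀ x ∈ S, ∀ D ⊆ A, (∀ c ∈ D, nb x c ≠ 0) → dB x + #D < #B := by
    intro x hx D hD hDn
    have h1 : #D ≤ ∑ c ∈ A, nb x c := by
      rw [card_eq_sum_ones]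
      exact (sum_le_sum fun c hc => Nat.one_le_iff_ne_zero.2 (hDn c hc)).trans
        (sum_le_sum_of_subset hD)
    have := hdeg' x hx
    omega
  have hacc : ∀ y ∈ S, ∀ c ∈ A, g y ∉ A → nb y c ≠ 0 := by
    intro y hy c hc hyA
    rw [hnb]
    by_contra! hcon
    have hm : Movable H S B g (g y) c :=
      ⟨hg.2.2.1 y hy, hAB hc, fun h => hyA (h ▸ hc), y, hy, rfl, hcon⟩
    exact hyA (mem_filter.2 ⟨hg.2.2.1 y hy, .head hm (mem_filter.1 hc).2⟩)
  have hdBlt : ∀ y ∈ S, g y ∉ A → dB y < q := by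
    intro y hy hyA
    have := hbound y hy A Subset.rfl fun c hc => hacc y hy c hc hyA
    omega
  have hcls : ∀ c ∈ A, #{v ∈ S | g v = c} + (if c = a then 1 else 0) = s := by
    intro c hc
    have h1 := hg.2.2.2.2 c (hAB hc)
    rwa [if_neg (show c ≠ b from fun h => hb (h ▸ hc))] at h1
  obtain ⟨i₀, hi₀, hne⟩ : ∃ i₀ ∈ A, i₀ ≠ a := by
    by_contra! hcon
    have hA' : A = {a} := eq_singleton_iff_unique_mem.2 ⟨haA, hcon⟩
    have h1 := sum_card_adj_comm H Bv (S.filter fun w => g w = a)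
    have h2 : #Bv ≤ ∑ y ∈ Bv, nb y a := by
      rw [card_eq_sum_ones]
      exact sum_le_sum fun y hy => Nat.one_le_iff_ne_zero.2
        (hacc y (mem_filter.1 hy).1 a haA (mem_filter.1 hy).2)
    have h3 : ∑ x ∈ S.filter (fun w => g w = a), dB x ≤ #{v ∈ S | g v = a} * q := by
      rw [← smul_eq_mul]
      refine sum_le_card_nsmul _ _ _ fun x hx => ?_
      have := hdeg' x (mem_filter.1 hx).1
      rw [hA', card_singleton] at hAq
      omega
    have h4 := hcls a haA
    rw [if_pos rfl] at h4
    have h5 : #{v ∈ S | g v = a} * q ≤ s * q := Nat.mul_le_mul_right _ (by omega)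
    have h6 : ∑ y ∈ Bv, nb y a = ∑ x ∈ S.filter (fun w => g w = a), dB x := h1
    omega
  obtain ⟨U, hU, T, hTA, hTne, hUT, haT, hterm, hsep⟩ := exists_terminal_set
    (Movable H S B g) A haA hi₀ hne fun i hi => (mem_filter.1 hi).2
  set t := #T with ht
  have ht1 : 1 ≤ t := card_pos.2 hTne
  have hdT : ∀ x ∈ S, g x ∈ T → dB x ≤ q + t := by
    intro x hx hxT
    have h1 := hbound x hx ((A \ T).erase U) ((erase_subset _ _).trans sdiff_subset) <| by
      intro c hc
      obtain ⟨hcU, hc⟩ := mem_erase.1 hc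
      obtain ⟨hcA, hcT⟩ := mem_sdiff.1 hc
      rw [hnb]
      by_contra! hcon
      refine hsep _ hxT c hcA hcT hcU ⟨hAB (hTA hxT), hAB hcA, ?_, x, hx, rfl, hcon⟩
      rintro rfl; exact hcT hxT
    rw [card_erase_of_mem (mem_sdiff.2 ⟨hU, hUT⟩)] at h1
    have h2 := card_sdiff_add_card_eq_card hTA
    omega
  let Sol : V → Finset V := fun y => S.filter fun z => g z ∈ T ∧ H.Adj y z ∧ nb y (g z) = 1
  have hsolo : ∀ y z, z ∈ Sol y → ∀ w ∈ S, g w = g z → H.Adj y w → w = z := by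
    intro y z hz w hw hwz hyw
    obtain ⟨hzS, hzT, hyz, h1⟩ := mem_filter.1 hz
    exact card_le_one.1 h1.le w (by simp [hw, hwz, hyw]) z (by simp [hzS, hyz])
  by_cases hmov : ∃ y ∈ Bv, ∃ z ∈ Sol y, ∃ X ∈ A, X ≠ g z ∧ ∀ w ∈ S, g w = X → ¬ H.Adj z w
  · obtain ⟨y, hy, z, hz, X, hX, hXz, hmove⟩ := hmov
    obtain ⟨hyS, hyA⟩ := mem_filter.1 hy
    obtain ⟨hzS, hzT, hyz, h1⟩ := mem_filter.1 hz
    exact .inl (exists_equitable_of_solo_move hg hTq hdBlt hb hyS hyA hzS (hTA hzT) hX hXz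
      (hterm _ hzT X hX hXz) (hsolo y z hz) hmove)
  right
  push Not at hmov
  have hdsol : ∀ y ∈ Bv, ∀ z ∈ Sol y, dB z ≤ q := by
    intro y hy z hz
    obtain ⟨hzS, hzT, hyz, h1⟩ := mem_filter.1 hz
    have h2 := hbound z hzS (A.erase (g z)) (erase_subset _ _) fun c hc => (hnb z c).2
      (hmov y hy z hz c (mem_of_mem_erase hc) (mem_erase.1 hc).1)
    rw [card_erase_of_mem (hTA hzT)] at h2
    omega
  have hSolcard : ∀ y ∈ Bv, t + dB y + 1 ≤ #(Sol y) + q := by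
    intro y hy
    obtain ⟨hyS, hyA⟩ := mem_filter.1 hy
    have h1 : #(T.filter fun c => nb y c = 1) ≤ #(Sol y) := by
      refine (card_le_card fun c hc => ?_).trans (card_image_le (s := Sol y) (f := g))
      obtain ⟨hcT, hc⟩ := mem_filter.1 hc
      obtain ⟨w, hw, rfl, hyw⟩ := (hnb y c).1 (by omega)
      exact mem_image.2 ⟨w, mem_filter.2 ⟨hw, hcT, hyw, hc⟩, rfl⟩
    have h2 : #A + #(T.filter fun c => ¬ nb y c = 1) ≤ ∑ c ∈ A, nb y c := by
      have : ∑ c ∈ A, (1 + if c ∈ T ∧ ¬ nb y c = 1 then 1 else 0) ≤ ∑ c ∈ A, nb y c := by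
        refine sum_le_sum fun c hc => ?_
        have := hacc y hyS c hc hyA
        split_ifs with h
        · omega
        · omega
      rw [sum_add_distrib, ← card_eq_sum_ones, ← card_filter] at this
      refine le_trans (Nat.add_le_add_left (card_le_card fun c hc => ?_) _) this
      obtain ⟨h3, h4⟩ := mem_filter.1 hc
      exact mem_filter.2 ⟨hTA h3, h3, h4⟩
    have h3 := card_filter_add_card_filter_not (s := T) (fun c => nb y c = 1)
    have h4 := hdeg' y hyS
    omega
  have htq : q < t := by
    obtain ⟨W, hW⟩ := hTne
    have hWA := hTA hW
    by_contra! hcon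
    set C := S.filter fun v => g v = W with hC
    have hCs : #C = s := by
      have := hcls W hWA
      rwa [if_neg (show W ≠ a from fun h => haT (h ▸ hW))] at this
    set C₁ := C.filter fun z => ∃ y ∈ Bv, z ∈ Sol y with hC₁
    set Y₁ := Bv.filter fun y => ∃ z ∈ C₁, H.Adj y z with hY₁
    have h1 : #Y₁ ≤ #C₁ * q := by
      refine (card_le_card fun y hy => ?_).trans (card_biUnion_le_card_mul C₁
        (fun z => Bv.filter fun w => H.Adj z w) q fun z hz => ?_)
      · obtain ⟨hy, z, hz, hyz⟩ := mem_filter.1 hy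
        exact mem_biUnion.2 ⟨z, hz, mem_filter.2 ⟨hy, hyz.symm⟩⟩
      · obtain ⟨_, y, hy, hz⟩ := mem_filter.1 hz
        exact hdsol y hy z hz
    have h2 : #(Bv \ Y₁) * 2 ≤ #(C \ C₁) * (q + t) := by
      have e := sum_card_adj_comm H (Bv \ Y₁) (C \ C₁)
      have l1 : #(Bv \ Y₁) * 2 ≤ ∑ y ∈ Bv \ Y₁, #{x ∈ C \ C₁ | H.Adj y x} := by
        rw [← smul_eq_mul]
        refine card_nsmul_le_sum _ _ _ fun y hy => ?_
        obtain ⟨hyB, hyY⟩ := mem_sdiff.1 hy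
        obtain ⟨hyS, hyA⟩ := mem_filter.1 hyB
        have hno : ∀ z ∈ C₁, ¬ H.Adj y z := fun z hz h => hyY (mem_filter.2 ⟨hyB, z, hz, h⟩)
        have e1 : (C \ C₁).filter (fun x => H.Adj y x) = C.filter fun x => H.Adj y x := by
          ext x
          simp only [mem_filter, mem_sdiff]
          constructor
          · rintro ⟨⟨h, _⟩, h'⟩; exact ⟨h, h'⟩
          · rintro ⟨h, h'⟩; exact ⟨⟨h, fun h'' => hno x h'' h'⟩, h'⟩
        rw [e1]
        have h3 : nb y W ≠ 0 := hacc y hyS W hWA hyA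
        have h4 : nb y W ≠ 1 := by
          intro h4
          obtain ⟨w, hw, hwW, hyw⟩ := (hnb y W).1 h3
          exact hno w (mem_filter.2 ⟨mem_filter.2 ⟨hw, hwW⟩, y, hyB,
            mem_filter.2 ⟨hw, hwW ▸ hW, hyw, hwW ▸ h4⟩⟩) hyw
        change 2 ≤ nb y W
        omega
      have l2 : ∑ x ∈ C \ C₁, #{y ∈ Bv \ Y₁ | H.Adj x y} ≤ #(C \ C₁) * (q + t) := by
        rw [← smul_eq_mul]
        refine sum_le_card_nsmul _ _ _ fun x hx => ?_
        obtain ⟨hxS, hxW⟩ := mem_filter.1 (mem_sdiff.1 hx).1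
        exact (card_le_card (filter_subset_filter _ sdiff_subset)).trans
          (hdT x hxS (hxW ▸ hW))
      omega
    have h3 : #(Bv \ Y₁) + #Y₁ = #Bv := card_sdiff_add_card_eq_card (filter_subset _ Bv)
    have h4 : #(C \ C₁) + #C₁ = #C := card_sdiff_add_card_eq_card (filter_subset _ C)
    have h5 : #(C \ C₁) * (q + t) ≤ #(C \ C₁) * (2 * q) := Nat.mul_le_mul_left _ (by omega)
    have h6 : s * q = #(C \ C₁) * q + #C₁ * q := by rw [← add_mul, h4, hCs]
    have h7 : #(C \ C₁) * (2 * q) = 2 * (#(C \ C₁) * q) := by ring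
    omega
  obtain ⟨z, y₁, hy₁, hz₁, y₂, hy₂, hz₂, hy, hyy⟩ : ∃ z, ∃ y₁ ∈ Bv, z ∈ Sol y₁ ∧ ∃ y₂ ∈ Bv,
      z ∈ Sol y₂ ∧ y₁ ≠ y₂ ∧ ¬ H.Adj y₁ y₂ := by
    by_contra! hcon
    let Sz : V → Finset V := fun z => Bv.filter fun y => z ∈ Sol y
    set All := S.filter fun z => g z ∈ T with hAll
    have hAllcard : #All = s * t := by
      have := hg.card_filter_mem (hTA.trans hAB)
      rwa [if_neg haT, if_neg (fun h => hb (hTA h))] at this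
    have hswap : ∑ y ∈ Bv, ∑ z ∈ Sol y, (1 / (#(Sz z) : ℚ)) =
        ∑ z ∈ All, ∑ y ∈ Sz z, (1 / (#(Sz z) : ℚ)) := by
      refine sum_comm' fun y z => ?_
      simp only [Sz, hAll, Sol, mem_filter]
      tauto
    have hup : ∑ z ∈ All, ∑ y ∈ Sz z, (1 / (#(Sz z) : ℚ)) ≤ s * t := by
      rw [← Nat.cast_mul, ← hAllcard, card_eq_sum_ones, Nat.cast_sum]
      refine sum_le_sum fun z _ => ?_
      rw [sum_const, nsmul_eq_mul, mul_one_div]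
      push_cast
      exact div_self_le_one _
    have hlow : ∀ y ∈ Bv, (t : ℚ) / q ≤ ∑ z ∈ Sol y, (1 / (#(Sz z) : ℚ)) := by
      intro y hyB
      have h1 : ∀ z ∈ Sol y, 1 / ((dB y : ℚ) + 1) ≤ 1 / (#(Sz z) : ℚ) := by
        intro z hz
        have hyz : y ∈ Sz z := mem_filter.2 ⟨hyB, hz⟩
        have h2 : #(Sz z) ≤ dB y + 1 := by
          rw [← card_erase_add_one hyz]
          refine Nat.add_le_add_right (card_le_card fun w hw => ?_) 1
          obtain ⟨hwy, hw⟩ := mem_erase.1 hw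
          obtain ⟨hwB, hw⟩ := mem_filter.1 hw
          exact mem_filter.2 ⟨hwB, hcon z y hyB hz w hwB hw hwy.symm⟩
        have h3 : 0 < #(Sz z) := card_pos.2 ⟨y, hyz⟩
        refine one_div_le_one_div_of_le (by exact_mod_cast h3) (by exact_mod_cast h2)
      have h2 := card_nsmul_le_sum (Sol y) _ _ h1
      refine le_trans ?_ h2
      obtain ⟨hyS, hyA⟩ := mem_filter.1 hyB
      have h3 : t + dB y + 1 ≤ #(Sol y) + q := hSolcard y hyB
      have h4 : dB y < q := hdBlt y hyS hyA
      rw [nsmul_eq_mul, mul_one_div]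
      refine div_le_div_of_add_le (by exact_mod_cast hq1) (by positivity) ?_ ?_ ?_
      · exact_mod_cast htq.le
      · exact_mod_cast h4
      · exact_mod_cast h3
    have h1 := card_nsmul_le_sum Bv _ _ hlow
    rw [hswap, nsmul_eq_mul, hcard] at h1
    have h2 := h1.trans hup
    have h8 : (0 : ℚ) < q := by exact_mod_cast hq1
    have h9 : (0 : ℚ) < t := by exact_mod_cast ht1
    rw [mul_div_assoc', div_le_iff₀ h8] at h2
    push_cast at h2
    nlinarith
  obtain ⟨hyS₁, hyA₁⟩ := mem_filter.1 hy₁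
  obtain ⟨hyS₂, hyA₂⟩ := mem_filter.1 hy₂
  obtain ⟨hzS, hzT, hyz, h1⟩ := mem_filter.1 hz₁
  exact exists_accessible_lt_of_solo_pair hg hTq hdBlt hb hyS₁ hyS₂ hyA₁ hyA₂ hzS (hTA hzT)
    (fun h => haT (h ▸ hzT)) (hterm _ hzT) (hsolo _ _ hz₁) (hsolo _ _ hz₂) hyz.symm hy hyy
    (hdsol _ hy₁ _ hz₁) (hmov _ hy₁ _ hz₁)

theorem IsNearEquitable.exists_equitable {H : SimpleGraph V} {S : Finset V} {B : Finset κ} {s : ℕ}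
    {a b : κ} {g : V → κ} (hg : IsNearEquitable H S B s a b g)
    (hT : ∀ q, 1 ≤ q → q < #B → HasEquitableColorings V κ q)
    (hdeg : ∀ v ∈ S, #{w ∈ S | H.Adj v w} < #B) : ∃ g', IsEquitable H S B s g' := by
  induction hn : #B - #(accessible H S B a g) using Nat.strong_induction_on generalizing b g with
  | _ n ih =>
    by_cases hb : b ∈ accessible H S B a g
    · refine exists_equitable_of_reach _ hg (mem_filter.1 hb).2 fun i j hij _ _ => ?_
      exact ⟨hij.2.1, hij.2.2.2⟩
    · rcases exists_equitable_or_accessible_lt hg hT hdeg hb with h | ⟨b', g', hg', hlt⟩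
      · exact h
      · have h1 : #(accessible H S B a g') ≤ #B := card_le_card (filter_subset _ _)
        exact ih _ (by omega) hg' rfl

/-- The Hajnal–Szemerédi theorem. -/
theorem hasEquitableColorings (V κ : Type*) (q : ℕ) (hq : 1 ≤ q) :
    HasEquitableColorings V κ q := by
  induction q using Nat.strong_induction_on with
  | _ q ih =>
    intro H S B s hB hS hdeg
    subst hB
    let HU : Finset V → SimpleGraph V := fun U =>
      { Adj := fun v w => H.Adj v w ∧ v ∈ U ∧ w ∈ U
        symm := ⟨fun v w h => ⟨h.1.symm, h.2.2, h.2.1⟩⟩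
        loopless := ⟨fun v h => H.loopless.irrefl v h.1⟩ }
    suffices h : ∀ U : Finset V, U ⊆ S → ∃ g, IsEquitable (HU U) S B s g by
      obtain ⟨g, h1, h2, h3⟩ := h S Subset.rfl
      exact ⟨g, h1, fun v hv w hw hvw => h2 v hv w hw ⟨hvw, hv, hw⟩, h3⟩
    intro U
    induction U using Finset.induction_on with
    | empty =>
      intro _
      have e : #S = #(B ×ˢ range s) := by rw [card_product, card_range, hS, mul_comm]
      let f := Finset.equivOfCardEq e
      obtain ⟨c₀, hc₀⟩ := card_pos.1 hq
      let g₀ : V → κ := fun v => if hv : v ∈ S then (f ⟨v, hv⟩).1.1 else c₀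
      have hg₀ : ∀ v (hv : v ∈ S), g₀ v = (f ⟨v, hv⟩).1.1 := fun v hv => dif_pos hv
      refine ⟨g₀, ?_, ?_, ?_⟩
      · intro v hv
        rw [hg₀ v hv]
        exact (mem_product.1 (f ⟨v, hv⟩).2).1
      · intro v _ w _ hvw
        exact absurd hvw.2.1 (by simp)
      · intro c hc
        rw [← card_range s]
        refine card_bij (fun v _ => if hv : v ∈ S then (f ⟨v, hv⟩).1.2 else 0) ?_ ?_ ?_
        · intro v hv
          have hv' := (mem_filter.1 hv).1
          rw [dif_pos hv']
          exact (mem_product.1 (f ⟨v, hv'⟩).2).2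
        · intro v hv w hw h
          obtain ⟨hv, hvc⟩ := mem_filter.1 hv
          obtain ⟨hw, hwc⟩ := mem_filter.1 hw
          rw [hg₀ v hv] at hvc
          rw [hg₀ w hw] at hwc
          rw [dif_pos hv, dif_pos hw] at h
          have : f ⟨v, hv⟩ = f ⟨w, hw⟩ := Subtype.ext (Prod.ext (hvc.trans hwc.symm) h)
          simpa using f.injective this
        · intro i hi
          let p : ↥(B ×ˢ range s) := ⟨(c, i), mem_product.2 ⟨hc, hi⟩⟩
          have hp : (f.symm p).1 ∈ S := (f.symm p).2
          have hfp : f ⟨(f.symm p).1, hp⟩ = p := by simp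
          refine ⟨(f.symm p).1, mem_filter.2 ⟨hp, ?_⟩, ?_⟩
          · rw [hg₀ _ hp, hfp]
          · rw [dif_pos hp, hfp]
    | insert u U huU ihU =>
      intro hUS
      have huS : u ∈ S := hUS (mem_insert_self _ _)
      obtain ⟨g, hg⟩ := ihU ((subset_insert _ _).trans hUS)
      have hdeg' : ∀ v ∈ S, #{w ∈ S | (HU (insert u U)).Adj v w} < #B := fun v hv =>
        (card_le_card (monotone_filter_right _ fun w _ h => h.1)).trans_lt (hdeg v hv)
      have hadj : ∀ v w, v ≠ u → w ≠ u → (HU (insert u U)).Adj v w → (HU U).Adj v w :=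
        fun v w hv hw h => ⟨h.1, (mem_insert.1 h.2.1).resolve_left hv,
          (mem_insert.1 h.2.2).resolve_left hw⟩
      obtain ⟨c, hcB, hc⟩ : ∃ c ∈ B, ∀ w ∈ S, g w = c → ¬ (HU (insert u U)).Adj u w := by
        by_contra! hcon
        have h1 : B ⊆ (S.filter fun w => (HU (insert u U)).Adj u w).image g := by
          intro c hc
          obtain ⟨w, hw, hwc, h⟩ := hcon c hc
          exact mem_image.2 ⟨w, mem_filter.2 ⟨hw, h⟩, hwc⟩
        have h2 := card_le_card h1
        have h3 := card_image_le (s := S.filter fun w => (HU (insert u U)).Adj u w) (f := g)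
        have h4 := hdeg' u huS
        omega
      have hnear : IsNearEquitable (HU (insert u U)) S B s (g u) c (Function.update g u c) := by
        refine ⟨hg.1 u huS, hcB, ?_, ?_, ?_⟩
        · intro v hv
          by_cases h : v = u
          · subst h; simpa using hcB
          · rw [Function.update_of_ne h]; exact hg.1 v hv
        · intro v hv w hw hvw
          by_cases h1 : v = u
          · subst h1
            rw [Function.update_self, Function.update_of_ne hvw.ne']
            exact fun h => hc w hw h.symm hvw
          · by_cases h2 : w = u
            · subst h2
              rw [Function.update_self, Function.update_of_ne h1]
              exact fun h => hc v hv h hvw.symm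
            · rw [Function.update_of_ne h1, Function.update_of_ne h2]
              exact hg.2.1 v hv w hw (hadj v w h1 h2 hvw)
        · intro d hd
          rw [card_class_update huS, hg.2.2 d hd]
      exact hnear.exists_equitable (fun q hq1 hq2 => ih q hq2 hq1)
        fun v hv => by convert hdeg' v hv

end Equitable

section Factor
variable {V : Type*}

/-- `F` is a partition of `A` into `r`-cliques of `G`. -/
def IsFactor (G : SimpleGraph V) (r : ℕ) (A : Finset V) (F : Finset (Finset V)) : Prop :=
  (∀ K ∈ F, G.IsNClique r K) ∧ (F : Set (Finset V)).PairwiseDisjoint id ∧ F.biUnion id = A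

/-- `A` can be partitioned into `r`-cliques of `G`. -/
def HasFactor (G : SimpleGraph V) (r : ℕ) (A : Finset V) : Prop := ∃ F, IsFactor G r A F

/-- The set of all partitions of `A` into `r`-cliques of `G`. -/
noncomputable def factors (G : SimpleGraph V) (r : ℕ) (A : Finset V) : Finset (Finset (Finset V)) :=
  A.powerset.powerset.filter (IsFactor G r A)

/-- The number of vertices of `A` not adjacent to `v`. -/
noncomputable def codeg (G : SimpleGraph V) (A : Finset V) (v : V) : ℕ := #{u ∈ A | ¬ G.Adj v u}

variable {G : SimpleGraph V} {r : ℕ} {A B : Finset V} {F F' : Finset (Finset V)}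

theorem IsFactor.subset (h : IsFactor G r A F) {K : Finset V} (hK : K ∈ F) : K ⊆ A :=
  h.2.2 ▸ subset_biUnion_of_mem id hK

theorem mem_factors : F ∈ factors G r A ↔ IsFactor G r A F := by
  simp only [factors, mem_filter, mem_powerset, and_iff_right_iff_imp]
  exact fun h K hK => mem_powerset.2 (h.subset hK)

theorem HasFactor.one_le (h : HasFactor G r A) : 1 ≤ #(factors G r A) :=
  card_pos.2 (h.imp fun _ h => mem_factors.2 h)

theorem hasFactor_empty : HasFactor G r ∅ := ⟨∅, by simp [IsFactor]⟩

theorem IsFactor.union (h : IsFactor G r A F) (h' : IsFactor G r B F') (hd : Disjoint A B) :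
    IsFactor G r (A ∪ B) (F ∪ F') := by
  refine ⟨fun K hK => (mem_union.1 hK).elim (h.1 K) (h'.1 K), ?_, ?_⟩
  · rw [coe_union]
    refine (Set.pairwiseDisjoint_union).2 ⟨h.2.1, h'.2.1, fun K hK L hL _ => ?_⟩
    exact disjoint_of_subset_left (h.subset hK) (disjoint_of_subset_right (h'.subset hL) hd)
  · rw [union_biUnion, h.2.2, h'.2.2]

theorem HasFactor.union (h : HasFactor G r A) (h' : HasFactor G r B) (hd : Disjoint A B) :
    HasFactor G r (A ∪ B) := by
  obtain ⟨F, h⟩ := h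
  obtain ⟨F', h'⟩ := h'
  exact ⟨_, h.union h' hd⟩

theorem hasFactor_of_isNClique {K : Finset V} (h : G.IsNClique r K) : HasFactor G r K :=
  ⟨{K}, by simp [IsFactor, h]⟩

theorem hasFactor_biUnion {ι : Type*} (s : Finset ι) (K : ι → Finset V)
    (h : ∀ i ∈ s, HasFactor G r (K i)) (hd : ∀ i ∈ s, ∀ j ∈ s, i ≠ j → Disjoint (K i) (K j)) :
    HasFactor G r (s.biUnion K) := by
  induction s using Finset.induction_on with
  | empty => exact hasFactor_empty
  | insert i s hi ih =>
    rw [biUnion_insert]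
    refine (h i (mem_insert_self _ _)).union (ih (fun j hj => h j (mem_insert_of_mem hj))
      fun j hj l hl => hd j (mem_insert_of_mem hj) l (mem_insert_of_mem hl)) ?_
    rw [disjoint_biUnion_right]
    exact fun j hj => hd i (mem_insert_self _ _) j (mem_insert_of_mem hj)
      (by rintro rfl; exact hi hj)

theorem IsFactor.card_eq (h : IsFactor G r A F) : #A = r * #F := by
  rw [← h.2.2, card_biUnion (fun K hK L hL hne => h.2.1 hK hL hne), mul_comm, ← smul_eq_mul]
  exact sum_const_nat fun K hK => (h.1 K hK).card_eq

theorem IsFactor.of_subset (h : IsFactor G r A F) (hF : F' ⊆ F) :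
    IsFactor G r (F'.biUnion id) F' :=
  ⟨fun K hK => h.1 K (hF hK), h.2.1.subset (by exact_mod_cast hF), rfl⟩

theorem IsFactor.sdiff_biUnion (h : IsFactor G r A F) (hF : F' ⊆ F) :
    (F \ F').biUnion id = A \ F'.biUnion id := by
  ext v
  simp only [mem_biUnion, mem_sdiff, id]
  constructor
  · rintro ⟨K, ⟨hK, hK'⟩, hv⟩
    refine ⟨h.subset hK hv, ?_⟩
    rintro ⟨L, hL, hvL⟩
    have hne : K ≠ L := by rintro rfl; exact hK' hL
    exact disjoint_left.1 (h.2.1 hK (hF hL) hne) hv hvL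
  · rintro ⟨hv, hno⟩
    rw [← h.2.2] at hv
    obtain ⟨K, hK, hvK⟩ := mem_biUnion.1 hv
    exact ⟨K, ⟨hK, fun h' => hno ⟨K, h', hvK⟩⟩, hvK⟩

theorem codeg_mono (h : A ⊆ B) (v : V) : codeg G A v ≤ codeg G B v :=
  card_le_card (filter_subset_filter _ h)

theorem codeg_le_card (v : V) : codeg G A v ≤ #A := card_filter_le _ _

theorem card_adj_add_codeg (v : V) : #{u ∈ A | G.Adj v u} + codeg G A v = #A :=
  card_filter_add_card_filter_not _

theorem codeg_union (h : Disjoint A B) (v : V) :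
    codeg G (A ∪ B) v = codeg G A v + codeg G B v := by
  rw [codeg, filter_union, card_union_of_disjoint (disjoint_filter_filter h)]; rfl

theorem codeg_sdiff_add (h : A ⊆ B) (v : V) : codeg G (B \ A) v + codeg G A v = codeg G B v := by
  rw [← codeg_union sdiff_disjoint, sdiff_union_of_subset h]

theorem exists_clique_partition {k p : ℕ} (hcard : #A + p = r * k) (hp : p ≤ k) (hk : 1 ≤ k)
    (hcod : ∀ v ∈ A, codeg G A v ≤ k) :
    ∃ (K : Fin k → Finset V) (Z : Finset (Fin k)), (∀ c, G.IsClique (K c : Set V)) ∧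
      (∀ c d, c ≠ d → Disjoint (K c) (K d)) ∧ univ.biUnion K = A ∧ #Z = p ∧
      ∀ c, #(K c) + (if c ∈ Z then 1 else 0) = r := by
  let H : SimpleGraph (V ⊕ Fin p) :=
    { Adj := fun x y => x ≠ y ∧ ((∃ v w, x = .inl v ∧ y = .inl w ∧ ¬ G.Adj v w) ∨
        ∃ i j, x = .inr i ∧ y = .inr j)
      symm := ⟨fun x y h => ⟨h.1.symm, h.2.imp
        (fun ⟨v, w, h1, h2, h3⟩ => ⟨w, v, h2, h1, fun h => h3 h.symm⟩)
        fun ⟨i, j, h1, h2⟩ => ⟨j, i, h2, h1⟩⟩⟩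
      loopless := ⟨fun x h => h.1 rfl⟩ }
  have hdeg : ∀ x ∈ A.disjSum (univ : Finset (Fin p)),
      #{y ∈ A.disjSum (univ : Finset (Fin p)) | H.Adj x y} < k := by
    rintro (v | i) hx
    · have hv : v ∈ A := by simpa using hx
      have h1 : (A.disjSum (univ : Finset (Fin p))).filter (fun y => H.Adj (.inl v) y) ⊆
          ((A.filter fun u => ¬ G.Adj v u).erase v).map Function.Embedding.inl := by
        intro y hy
        obtain ⟨hyA, hvy, hy | hy⟩ := mem_filter.1 hy
        · obtain ⟨v', w, h1, rfl, h3⟩ := hy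
          obtain rfl := Sum.inl.inj h1
          refine mem_map.2 ⟨w, ?_, rfl⟩
          have : w ∈ A := by simpa using hyA
          exact mem_erase.2 ⟨fun h => hvy (h ▸ rfl), mem_filter.2 ⟨this, h3⟩⟩
        · obtain ⟨i, j, h1, _⟩ := hy
          cases h1
      refine (card_le_card h1).trans_lt ?_
      rw [card_map]
      refine (card_erase_lt_of_mem ?_).trans_le (hcod v hv)
      simp [hv]
    · have h1 : (A.disjSum (univ : Finset (Fin p))).filter (fun y => H.Adj (.inr i) y) ⊆
          ((univ : Finset (Fin p)).erase i).map Function.Embedding.inr := by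
        intro y hy
        obtain ⟨hyA, hvy, hy | hy⟩ := mem_filter.1 hy
        · obtain ⟨v', w, h1, _⟩ := hy
          cases h1
        · obtain ⟨i', j, h1, rfl⟩ := hy
          obtain rfl := Sum.inr.inj h1
          refine mem_map.2 ⟨j, ?_, rfl⟩
          exact mem_erase.2 ⟨fun h => hvy (h ▸ rfl), mem_univ _⟩
      refine (card_le_card h1).trans_lt ?_
      rw [card_map, card_erase_of_mem (mem_univ _), card_univ, Fintype.card_fin]
      have := i.pos
      omega
  obtain ⟨g, -, hg, hgs⟩ := hasEquitableColorings (V ⊕ Fin p) (Fin k) k hk H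
    (A.disjSum univ) univ r (by simp) (by simpa using hcard)
      fun x hx => by convert hdeg x hx
  have hinj : ∀ i j : Fin p, g (.inr i) = g (.inr j) → i = j := by
    intro i j h
    by_contra hne
    exact hg _ (by simp) _ (by simp) ⟨by simpa using hne, .inr ⟨i, j, rfl, rfl⟩⟩ h
  refine ⟨fun c => A.filter fun v => g (.inl v) = c, univ.image fun i => g (.inr i),
    ?_, ?_, ?_, ?_, ?_⟩
  · intro c v hv w hw hne
    rw [mem_coe, mem_filter] at hv hw
    by_contra hadj
    exact hg (.inl v) (by simp [hv.1]) (.inl w) (by simp [hw.1])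
      ⟨by simpa using hne, .inl ⟨v, w, rfl, rfl, hadj⟩⟩ (hv.2.trans hw.2.symm)
  · intro c d hcd
    rw [disjoint_left]
    intro v hv hw
    exact hcd ((mem_filter.1 hv).2.symm.trans (mem_filter.1 hw).2)
  · ext v
    simp
  · rw [card_image_of_injective _ fun i j h => hinj i j h]
    simp
  · intro c
    have e : (A.disjSum (univ : Finset (Fin p))).filter (fun v => g v = c) =
        (A.filter fun v => g (.inl v) = c).disjSum (univ.filter fun i => g (.inr i) = c) := by
      ext (v | i) <;> simp
    have hc : #((A.filter fun v => g (.inl v) = c).disjSum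
        (univ.filter fun i => g (.inr i) = c)) = r := by
      rw [← hgs c (mem_univ c), ← e]
      congr
    rw [← hc, card_disjSum]
    congr 1
    split_ifs with h
    · obtain ⟨i, -, hi⟩ := mem_image.1 h
      symm
      rw [card_eq_one]
      refine ⟨i, eq_singleton_iff_unique_mem.2 ⟨by simp [hi], fun j hj => ?_⟩⟩
      exact hinj _ _ ((mem_filter.1 hj).2.trans hi.symm)
    · symm
      rw [card_eq_zero, filter_eq_empty_iff]
      exact fun i _ hi => h (mem_image.2 ⟨i, mem_univ _, hi⟩)

theorem hasFactor_of_codeg_le {k : ℕ} (hcard : #A = r * k) (hcod : ∀ v ∈ A, codeg G A v ≤ k) :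
    HasFactor G r A := by
  rcases Nat.eq_zero_or_pos k with rfl | hk
  · obtain rfl : A = ∅ := card_eq_zero.1 (by simpa using hcard)
    exact hasFactor_empty
  obtain ⟨K, Z, h1, h2, rfl, h4, h5⟩ :=
    exists_clique_partition (p := 0) hcard (Nat.zero_le _) hk hcod
  refine hasFactor_biUnion _ _ (fun c _ => hasFactor_of_isNClique ⟨h1 c, ?_⟩) fun c _ d _ => h2 c d
  have := h5 c
  rwa [card_eq_zero.1 h4, if_neg (notMem_empty _)] at this

end Factor

section Stability
variable {V : Type*} {G : SimpleGraph V}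

theorem card_adj_all_ge {S K : Finset V} {d : ℕ} (hd : ∀ u ∈ K, codeg G S u ≤ d) :
    #S ≤ #{v ∈ S | ∀ u ∈ K, G.Adj u v} + #K * d := by
  have h1 : S \ (S.filter fun v => ∀ u ∈ K, G.Adj u v) ⊆
      K.biUnion fun u => S.filter fun v => ¬ G.Adj u v := by
    intro v hv
    obtain ⟨hvS, hv⟩ := mem_sdiff.1 hv
    simp only [mem_filter, hvS, true_and, not_forall] at hv
    obtain ⟨u, hu, huv⟩ := hv
    exact mem_biUnion.2 ⟨u, hu, mem_filter.2 ⟨hvS, huv⟩⟩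
  have h2 := (card_le_card h1).trans (card_biUnion_le_card_mul _ _ d hd)
  have h3 := card_sdiff_add_card_eq_card
    (filter_subset (fun v => ∀ u ∈ K, G.Adj u v) S)
  omega

theorem exists_adj_all {S K : Finset V} {d : ℕ} (hd : ∀ u ∈ K, codeg G S u ≤ d)
    (h : #K * d < #S) : ∃ v ∈ S, ∀ u ∈ K, G.Adj u v := by
  have h1 := card_adj_all_ge hd
  obtain ⟨v, hv⟩ := card_pos.1 (show 0 < #{v ∈ S | ∀ u ∈ K, G.Adj u v} by omega)
  exact ⟨v, (mem_filter.1 hv).1, (mem_filter.1 hv).2⟩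

theorem exists_isNClique_add_two {A : Finset V} {d h : ℕ} (hd1 : 1 ≤ d)
    (hcod : ∀ v ∈ A, codeg G A v ≤ d)
    (hind : ∀ S ⊆ A, h ≤ #S → ∃ u ∈ S, ∃ v ∈ S, G.Adj u v) (i : ℕ) :
    ∀ S ⊆ A, i * d + h ≤ #S → ∃ K ⊆ S, G.IsNClique (i + 2) K := by
  induction i with
  | zero =>
    intro S hS hc
    obtain ⟨u, hu, v, hv, huv⟩ := hind S hS (by omega)
    refine ⟨insert u {v}, by simp [insert_subset_iff, hu, hv], ?_⟩
    exact (SimpleGraph.isNClique_singleton (a := v).2 rfl).insert (by simpa using huv)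
  | succ i ih =>
    intro S hS hc
    have e : (i + 1) * d = i * d + d := by ring
    obtain ⟨v, hv⟩ := card_pos.1 (show 0 < #S by omega)
    have h1 := card_adj_add_codeg (G := G) (A := S) v
    have h2 := (codeg_mono hS v).trans (hcod v (hS hv))
    obtain ⟨K, hK, hKc⟩ := ih (S.filter fun u => G.Adj v u) ((filter_subset _ _).trans hS)
      (by omega)
    refine ⟨insert v K, insert_subset hv (hK.trans (filter_subset _ _)), hKc.insert ?_⟩
    exact fun u hu => (mem_filter.1 (hK hu)).2

theorem exists_antitone_enum (ψ : V → ℝ) (n : ℕ) : ∀ A : Finset V, #A = n → A.Nonempty →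
    ∃ e : ℕ → V, Set.InjOn e (range n) ∧ (range n).image e = A ∧
      ∀ i j, i ≤ j → j < n → ψ (e j) ≤ ψ (e i) := by
  induction n with
  | zero => intro A h1 h2; simp_all
  | succ n ih =>
    intro A hA hne
    obtain ⟨m, hm, hmin⟩ := A.exists_min_image ψ hne
    have hc : #(A.erase m) = n := by rw [card_erase_of_mem hm]; omega
    obtain ⟨e, he, hi, ha⟩ : ∃ e : ℕ → V, Set.InjOn e (range n) ∧ (range n).image e = A.erase m ∧
        ∀ i j, i ≤ j → j < n → ψ (e j) ≤ ψ (e i) := by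
      rcases (A.erase m).eq_empty_or_nonempty with h | h
      · rw [h, card_empty] at hc
        subst hc
        exact ⟨fun _ => m, by simp, by simp [h], by simp⟩
      · exact ih _ hc h
    have hmem : ∀ i < n, e i ∈ A.erase m := fun i hi' => hi ▸ mem_image_of_mem _ (mem_range.2 hi')
    have hup : ∀ i < n, Function.update e n m i = e i := fun i hi' =>
      Function.update_of_ne hi'.ne _ _
    refine ⟨Function.update e n m, ?_, ?_, ?_⟩
    · intro i hi1 j hj1 hij
      simp only [coe_range, Set.mem_Iio, Nat.lt_succ_iff_lt_or_eq] at hi1 hj1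
      rcases hi1 with hi1 | rfl <;> rcases hj1 with hj1 | rfl
      · rw [hup i hi1, hup j hj1] at hij
        exact he (by simpa using hi1) (by simpa using hj1) hij
      · rw [hup i hi1, Function.update_self] at hij
        exact absurd hij (mem_erase.1 (hmem i hi1)).1
      · rw [hup j hj1, Function.update_self] at hij
        exact absurd hij.symm (mem_erase.1 (hmem j hj1)).1
      · rfl
    · rw [range_add_one, image_insert, Function.update_self, ← insert_erase hm, ← hi]
      congr 1
      exact image_congr fun i hi' => hup i (by simpa using hi')
    · intro i j hij hj
      rcases Nat.lt_succ_iff_lt_or_eq.1 hj with hj | rfl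
      · rw [hup i (by omega), hup j hj]; exact ha i j hij hj
      · rw [Function.update_self]
        rcases hij.lt_or_eq with h | rfl
        · rw [hup i h]; exact hmin _ (mem_of_mem_erase (hmem i h))
        · rw [Function.update_self]

/-- A weighting bounded on all `r`-cliques forces its decreasing rearrangement to be flat. -/
theorem sub_le_of_weighted_constraints {r : ℕ} {t : ℕ → ℝ} {ε : ℝ} (hε : 0 ≤ ε)
    (ht : ∀ i < r, ∀ j ≤ i, t i ≤ t j)
    (h : ∀ i, 1 ≤ i → i < r → (i + 1 : ℝ) * t (i - 1) - ∑ j ∈ range (i + 1), t j ≤ ε) :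
    ∀ i < r, t 0 - t i + ε ≤ (r + 1 : ℝ) ^ i * ε := by
  intro i
  induction i with
  | zero => intro _; simp
  | succ i ih =>
    intro hi
    have h1 := h (i + 1) (by omega) hi
    have h2 := ih (by omega)
    rw [sum_range_succ, Nat.add_sub_cancel] at h1
    have h3 : ∑ j ∈ range (i + 1), t j ≤ (i + 1 : ℝ) * t 0 := by
      have := sum_le_card_nsmul (range (i + 1)) t (t 0) fun j hj =>
        ht j (by have := mem_range.1 hj; omega) 0 (Nat.zero_le _)
      simpa using this
    push_cast at h1
    have h0 : 0 ≤ t 0 - t i := sub_nonneg.2 (ht i (by omega) 0 (Nat.zero_le _))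
    have hir : ((i : ℝ) + 2) ≤ r := by exact_mod_cast hi
    have h4 : t 0 - t (i + 1) + ε ≤ (r + 1 : ℝ) * (t 0 - t i + ε) := by
      have e : t i - t (i + 1) ≤ ε + (i + 1) * (t 0 - t i) := by nlinarith
      nlinarith
    calc _ ≤ (r + 1 : ℝ) * (t 0 - t i + ε) := h4
      _ ≤ (r + 1 : ℝ) * ((r + 1 : ℝ) ^ i * ε) := by gcongr
      _ = _ := by ring

theorem sum_range_mul_le {F : ℕ → ℝ} (hF : Antitone F) {d h : ℕ} (hh : h ≤ d) (r : ℕ) :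
    ∑ i ∈ range (r * d), F i ≤
      ∑ j ∈ range r, (h * F (j * d) + (d - h : ℝ) * F (j * d + h)) := by
  induction r with
  | zero => simp
  | succ r ih =>
    rw [sum_range_succ _ r, Nat.succ_mul]
    obtain ⟨g, rfl⟩ := Nat.exists_eq_add_of_le hh
    rw [sum_range_add, sum_range_add]
    have h1 := sum_le_card_nsmul (range h) (fun x => F (r * (h + g) + x)) (F (r * (h + g)))
      fun j _ => hF (by omega)
    have h2 := sum_le_card_nsmul (range g) (fun x => F (r * (h + g) + (h + x)))
      (F (r * (h + g) + h)) fun j _ => hF (by omega)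
    simp only [card_range, nsmul_eq_mul] at h1 h2
    push_cast at ih ⊢
    linarith [h1, h2, ih, show ((h : ℝ) + g - h) * F (r * (h + g) + h) =
      g * F (r * (h + g) + h) by ring]

theorem exists_large_of_clique_sum_le {A : Finset V} {d h r : ℕ} {ψ : V → ℝ} {β γ θ : ℝ}
    (hr : 2 ≤ r) (hhd : h < d) (hcod : ∀ v ∈ A, codeg G A v ≤ d)
    (hind : ∀ S ⊆ A, h ≤ #S → ∃ u ∈ S, ∃ v ∈ S, G.Adj u v) (hψ : ∀ v ∈ A, 0 ≤ ψ v)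
    (hcl : ∀ K ⊆ A, G.IsNClique r K → ∑ v ∈ K, ψ v ≤ 1 + γ)
    (hsum : d * (1 - β) ≤ ∑ v ∈ A, ψ v) (hn1 : (r - 1) * d < #A) (hn2 : #A ≤ r * d)
    (hβ : 0 ≤ β) (hγ : 0 ≤ γ) (hθ : d * (γ + β) ≤ (d - h) * θ)
    (hsmall : 2 * (r + 1 : ℝ) ^ (r + 1) * θ < 1 / r) :
    ∃ S ⊆ A, (r - 1) * d + h < #S ∧
      ∀ v ∈ S, 1 / r - 2 * (r + 1 : ℝ) ^ (r + 1) * θ ≤ ψ v := by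
  obtain ⟨e, he, him, hanti⟩ := exists_antitone_enum ψ #A A rfl (card_pos.1 (by omega))
  set n := #A with hn
  let F : ℕ → ℝ := fun i => if i < n then ψ (e i) else 0
  have hF : ∀ i, F i = if i < n then ψ (e i) else 0 := fun _ => rfl
  have hmem : ∀ i < n, e i ∈ A := fun i hi => him ▸ mem_image_of_mem _ (mem_range.2 hi)
  have hF0 : ∀ i, 0 ≤ F i := fun i => by
    rw [hF]; split_ifs with h; exacts [hψ _ (hmem i h), le_rfl]
  have hFa : Antitone F := by
    intro i j hij
    rw [hF j]
    split_ifs with h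
    · rw [hF, if_pos (by omega)]; exact hanti i j hij h
    · exact hF0 i
  have htop : ∀ s ≤ n, ((range s).image e) ⊆ A ∧ #((range s).image e) = s ∧
      ∀ v ∈ (range s).image e, F (s - 1) ≤ ψ v := by
    intro s hs
    refine ⟨?_, ?_, ?_⟩
    · rw [← him]; exact image_subset_image (range_subset_range.2 hs)
    · rw [card_image_of_injOn (he.mono (by simpa using hs)), card_range]
    · intro v hv
      obtain ⟨i, hi, rfl⟩ := mem_image.1 hv
      have hi := mem_range.1 hi
      have : ψ (e i) = F i := by rw [hF, if_pos (by omega)]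
      rw [this]; exact hFa (by omega)
  -- extending a clique greedily
  have hext : ∀ i b, (∃ K ⊆ A, G.IsNClique i K ∧ b ≤ ∑ v ∈ K, ψ v) → ∀ j, i ≤ j → j ≤ r →
      ∃ K ⊆ A, G.IsNClique j K ∧ b + ∑ l ∈ Ico i j, F (l * d) ≤ ∑ v ∈ K, ψ v := by
    intro i b hK j hij
    induction j, hij using Nat.le_induction with
    | base => intro _; simpa using hK
    | succ j hij ih =>
      intro hj
      obtain ⟨K, hKA, hKc, hKs⟩ := ih (by omega)
      have hjd : j * d ≤ (r - 1) * d := Nat.mul_le_mul_right _ (by omega)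
      obtain ⟨h1, h2, h3⟩ := htop (j * d + 1) (by omega)
      obtain ⟨v, hv, hvK⟩ := exists_adj_all (G := G) (S := (range (j * d + 1)).image e) (K := K)
        (d := d) (fun u hu => (codeg_mono h1 u).trans (hcod u (hKA hu))) (by
          rw [h2, hKc.card_eq]; omega)
      have hvn : v ∉ K := fun h => (hvK v h).ne rfl
      refine ⟨insert v K, insert_subset (h1 hv) hKA, hKc.insert fun u hu => (hvK u hu).symm, ?_⟩
      rw [sum_insert hvn, sum_Ico_succ_top hij]
      have := h3 v hv
      simp only [Nat.add_sub_cancel] at this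
      linarith
  have hg : (0 : ℝ) < d - h := by rw [sub_pos]; exact_mod_cast hhd
  set T := ∑ j ∈ range r, F (j * d) with hT
  have hT1 : T ≤ 1 + γ := by
    obtain ⟨K, hKA, hKc, hKs⟩ := hext 0 0 ⟨∅, by simp, by simp, by simp⟩ r (by omega) le_rfl
    rw [zero_add, ← range_eq_Ico] at hKs
    exact hKs.trans (hcl K hKA hKc)
  have hblock : d * (1 - β) ≤ d * T - (d - h) * ∑ j ∈ range r, (F (j * d) - F (j * d + h)) := by
    have h1 : ∑ v ∈ A, ψ v = ∑ i ∈ range (r * d), F i := by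
      rw [← him, sum_image he, ← sum_subset (range_subset_range.2 hn2)]
      · exact sum_congr rfl fun i hi => by rw [hF, if_pos (mem_range.1 hi)]
      · intro i _ hi; rw [hF, if_neg (by simpa using hi)]
    have h2 := sum_range_mul_le hFa hhd.le r
    rw [← h1] at h2
    refine hsum.trans (h2.trans_eq ?_)
    rw [hT, mul_sum, mul_sum, ← sum_sub_distrib]
    exact sum_congr rfl fun j _ => by ring
  have hdiff0 : ∀ j, 0 ≤ F (j * d) - F (j * d + h) := fun j => sub_nonneg.2 (hFa (by omega))
  have hd0 : (0 : ℝ) < d := by exact_mod_cast (show 0 < d by omega)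
  have hθ' : γ + β ≤ θ := by
    have h0 : (0 : ℝ) ≤ h := by positivity
    have : 0 ≤ θ := by
      by_contra hc
      push Not at hc
      nlinarith [mul_pos hg (neg_pos.2 hc), mul_nonneg hd0.le (add_nonneg hγ hβ)]
    by_contra hc
    push Not at hc
    nlinarith [mul_pos hd0 (sub_pos.2 hc), mul_nonneg h0 this]
  have hθ0 : 0 ≤ θ := by linarith
  have hS0 : 0 ≤ ∑ j ∈ range r, (F (j * d) - F (j * d + h)) := sum_nonneg fun j _ => hdiff0 j
  have hT2 : 1 - β ≤ T := by
    have := mul_nonneg hg.le hS0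
    by_contra hc
    push Not at hc
    nlinarith [mul_pos hd0 (sub_pos.2 hc)]
  have hdiff : ∀ j < r, F (j * d) - F (j * d + h) ≤ θ := by
    intro j hj
    have h1 := single_le_sum (f := fun j => F (j * d) - F (j * d + h)) (fun j _ => hdiff0 j)
      (mem_range.2 hj)
    refine h1.trans ?_
    have h2 : (d - h : ℝ) * ∑ j ∈ range r, (F (j * d) - F (j * d + h)) ≤ (d - h) * θ := by
      refine le_trans ?_ hθ
      nlinarith [mul_le_mul_of_nonneg_left hT1 hd0.le]
    exact le_of_mul_le_mul_left h2 hg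
  have hconstr : ∀ i, 1 ≤ i → i < r →
      (i + 1 : ℝ) * F ((i - 1) * d) - ∑ j ∈ range (i + 1), F (j * d) ≤ (r + 1) * θ := by
    intro i hi1 hir
    obtain ⟨i, rfl⟩ := Nat.exists_eq_add_of_le' hi1
    rw [Nat.add_sub_cancel]
    have hid : i * d + d ≤ (r - 1) * d := by
      rw [← Nat.succ_mul]; exact Nat.mul_le_mul_right _ (by omega)
    obtain ⟨h1, h2, h3⟩ := htop (i * d + h) (by omega)
    obtain ⟨K, hK, hKc⟩ := exists_isNClique_add_two (by omega) hcod hind i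
      ((range (i * d + h)).image e) h1 h2.ge
    have hKs : ((i : ℝ) + 2) * F (i * d + h) ≤ ∑ v ∈ K, ψ v := by
      have := card_nsmul_le_sum K ψ (F (i * d + h)) fun v hv =>
        (hFa (by omega)).trans (h3 v (hK hv))
      rw [hKc.card_eq] at this
      simpa using this
    obtain ⟨K', hKA, hKc', hKs'⟩ := hext _ _ ⟨K, hK.trans h1, hKc, hKs⟩ r (by omega) le_rfl
    have h4 := hKs'.trans (hcl _ hKA hKc')
    have h5 := sum_range_add_sum_Ico (fun j => F (j * d)) (show i + 2 ≤ r by omega)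
    have h6 := hdiff i (by omega)
    have h7 : (i : ℝ) + 2 ≤ r := by exact_mod_cast hir
    have h8 : ((i : ℝ) + 2) * (F (i * d) - F (i * d + h)) ≤ r * θ :=
      mul_le_mul h7 h6 (hdiff0 i) (by positivity)
    push_cast
    have e1 : i + 1 + 1 = i + 2 := rfl
    rw [e1]
    nlinarith
  have hflat := sub_le_of_weighted_constraints (r := r) (t := fun i => F (i * d))
    (ε := (r + 1) * θ) (by positivity)
    (fun i _ j hj => hFa (Nat.mul_le_mul_right _ hj)) hconstr (r - 1) (by omega)
  simp only [zero_mul] at hflat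
  have hT3 : T ≤ r * F 0 := by
    have := sum_le_card_nsmul (range r) (fun j => F (j * d)) (F 0) fun j _ => hFa (by omega)
    simpa using this
  have hr0 : (2 : ℝ) ≤ r := by exact_mod_cast hr
  have hlast : 1 / r - 2 * (r + 1 : ℝ) ^ (r + 1) * θ ≤ F ((r - 1) * d + h) := by
    have h1 := hdiff (r - 1) (by omega)
    have h2 : 1 / r - θ ≤ F 0 := by
      rw [sub_le_iff_le_add, div_le_iff₀ (by linarith)]
      nlinarith
    have h3 : (r + 1 : ℝ) ^ (r - 1) * ((r + 1) * θ) ≤ (r + 1 : ℝ) ^ (r + 1) * θ := by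
      rw [← mul_assoc, ← pow_succ]
      gcongr
      · linarith
      · omega
    have h4 : 2 * θ ≤ (r + 1 : ℝ) ^ (r + 1) * θ := by
      gcongr
      have : (r + 1 : ℝ) ^ 1 ≤ (r + 1 : ℝ) ^ (r + 1) := by
        gcongr
        · linarith
        · omega
      linarith
    have h5 : 0 ≤ (r + 1) * θ := by positivity
    linarith
  have hidx : (r - 1) * d + h < n := by
    by_contra hc
    rw [hF, if_neg hc] at hlast
    linarith
  obtain ⟨h1, h2, h3⟩ := htop ((r - 1) * d + h + 1) hidx
  exact ⟨_, h1, by omega, fun v hv => hlast.trans (h3 v hv)⟩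

end Stability

section Flexible
variable {V : Type*} {G : SimpleGraph V} {r : ℕ} {A : Finset V}

theorem exists_hitting {α β : Type*} {S : Finset α} (hS : S.Nonempty) (F : Finset β)
    (R : β → α → Prop) {ρ : ℝ} (hρ : ρ ≤ 1)
    (h : ∀ Q ∈ F, ρ * #S ≤ #{y ∈ S | R Q y}) (l : ℕ) :
    ∃ Y ⊆ S, #Y ≤ l ∧ (#{Q ∈ F | ∀ y ∈ Y, ¬ R Q y} : ℝ) ≤ (1 - ρ) ^ l * #F := by
  induction l with
  | zero => exact ⟨∅, by simp, by simp, by simp⟩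
  | succ l ih =>
    obtain ⟨Y, hYS, hYl, hY⟩ := ih
    set F' := F.filter fun Q => ∀ y ∈ Y, ¬ R Q y with hF'
    have h1 : ∑ y ∈ S, #{Q ∈ F' | R Q y} = ∑ Q ∈ F', #{y ∈ S | R Q y} := by
      simp only [card_filter]; exact sum_comm
    obtain ⟨y, hy, hyc⟩ : ∃ y ∈ S, ρ * #F' ≤ #{Q ∈ F' | R Q y} := by
      by_contra! hc
      have h2 := sum_lt_sum_of_nonempty hS hc
      have h3 : ∑ Q ∈ F', ρ * #S ≤ ∑ Q ∈ F', (#{y ∈ S | R Q y} : ℝ) :=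
        sum_le_sum fun Q hQ => h Q (mem_filter.1 hQ).1
      have h4 : (∑ y ∈ S, (#{Q ∈ F' | R Q y} : ℝ)) = ∑ Q ∈ F', (#{y ∈ S | R Q y} : ℝ) := by
        exact_mod_cast h1
      simp only [sum_const, nsmul_eq_mul] at h2 h3
      nlinarith
    refine ⟨insert y Y, insert_subset hy hYS, (card_insert_le _ _).trans (by omega), ?_⟩
    have h5 : F.filter (fun Q => ∀ z ∈ insert y Y, ¬ R Q z) = F'.filter fun Q => ¬ R Q y := by
      ext Q; simp only [hF', mem_filter, mem_insert, forall_eq_or_imp]; tauto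
    have h6 : (#{Q ∈ F' | R Q y} : ℝ) + #{Q ∈ F' | ¬ R Q y} = #F' := by
      exact_mod_cast card_filter_add_card_filter_not (s := F') (fun Q => R Q y)
    rw [h5, pow_succ]
    nlinarith [mul_le_mul_of_nonneg_left hY (sub_nonneg.2 hρ)]

/-- `U` absorbs every disjoint `(r - 1)`-clique. -/
def IsFlex (G : SimpleGraph V) (r : ℕ) (A U : Finset V) (c : ℕ) : Prop :=
  U ⊆ A ∧ #U = r * c + 1 ∧
    ∀ Q ⊆ A, Disjoint Q U → G.IsNClique (r - 1) Q → HasFactor G r (U ∪ Q)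

/-- Any two vertices can be interchanged by means of a small set avoiding a given one. -/
def IsLinked (G : SimpleGraph V) (r : ℕ) (A : Finset V) (m : ℕ) : Prop :=
  ∀ x ∈ A, ∀ y ∈ A, x ≠ y → ∀ X : Finset V, #X ≤ m → ∃ Z ⊆ A, Disjoint Z X ∧ #Z ≤ 2 * r ∧
    HasFactor G r (insert x Z) ∧ HasFactor G r (insert y Z)

theorem HasFactor.dvd {X : Finset V} (h : HasFactor G r X) : r ∣ #X := by
  obtain ⟨F, hF⟩ := h
  exact ⟨_, hF.card_eq⟩

theorem IsFlex.union {U X : Finset V} {c m : ℕ} (h : IsFlex G r A U c) (hX : HasFactor G r X)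
    (hXA : X ⊆ A) (hd : Disjoint U X) (hm : #X = r * m) : IsFlex G r A (U ∪ X) (c + m) := by
  refine ⟨union_subset h.1 hXA, ?_, ?_⟩
  · rw [card_union_of_disjoint hd, h.2.1, hm]; ring
  · intro Q hQ hQd hQc
    rw [disjoint_union_right] at hQd
    have := (h.2.2 Q hQ hQd.1 hQc).union hX (disjoint_union_left.2 ⟨hd, hQd.2⟩)
    rwa [union_right_comm] at this

theorem exists_gadgets {m : ℕ} (hl : IsLinked G r A m) {x : V} (hx : x ∈ A) {X Y : Finset V}
    (hY : Y ⊆ A) (hxY : x ∉ Y) (hm : #X + #Y * (2 * r) ≤ m) :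
    ∃ Z : V → Finset V, (∀ y ∈ Y, Z y ⊆ A ∧ Disjoint (Z y) X ∧ #(Z y) ≤ 2 * r ∧
      HasFactor G r (insert x (Z y)) ∧ HasFactor G r (insert y (Z y))) ∧
      (Y : Set V).PairwiseDisjoint Z := by
  induction Y using Finset.induction_on with
  | empty => exact ⟨fun _ => ∅, by simp, by simp⟩
  | insert y Y hy ih =>
    rw [card_insert_of_notMem hy, Nat.succ_mul] at hm
    obtain ⟨Z, hZ, hZd⟩ := ih ((subset_insert _ _).trans hY)
      (fun h => hxY (mem_insert_of_mem h)) (by omega)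
    have hc : #(X ∪ Y.biUnion Z) ≤ m :=
      (card_union_le _ _).trans (by
        have := card_biUnion_le_card_mul Y Z (2 * r) fun y hy => (hZ y hy).2.2.1
        omega)
    obtain ⟨W, hWA, hWX, hWc, hW1, hW2⟩ := hl x hx y (hY (mem_insert_self _ _))
      (by rintro rfl; exact hxY (mem_insert_self _ _)) _ hc
    rw [disjoint_union_right, disjoint_biUnion_right] at hWX
    have hup : ∀ z ∈ Y, Function.update Z y W z = Z z := fun z hz =>
      Function.update_of_ne (by rintro rfl; exact hy hz) _ _
    refine ⟨Function.update Z y W, ?_, ?_⟩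
    · intro z hz
      rcases mem_insert.1 hz with rfl | hz
      · rw [Function.update_self]; exact ⟨hWA, hWX.1, hWc, hW1, hW2⟩
      · rw [hup z hz]; exact hZ z hz
    · intro z hz z' hz' hne
      rw [mem_coe, mem_insert] at hz hz'
      simp only [Function.onFun]
      rcases hz with rfl | hz <;> rcases hz' with rfl | hz'
      · exact absurd rfl hne
      · rw [Function.update_self, hup z' hz']; exact hWX.2 z' hz'
      · rw [Function.update_self, hup z hz]; exact (hWX.2 z hz).symm
      · rw [hup z hz, hup z' hz']; exact hZd hz hz' hne

theorem exists_flex {d h l m : ℕ} {ρ : ℝ} (hr : 2 ≤ r) (hd1 : 1 ≤ d)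
    (hcod : ∀ v ∈ A, codeg G A v ≤ d)
    (hind : ∀ S ⊆ A, h ≤ #S → ∃ u ∈ S, ∃ v ∈ S, G.Adj u v) (hl : IsLinked G r A m)
    {S : Finset V} (hS : S ⊆ A) (hSc : (r - 1) * d + h ≤ #S) (hρ : ρ ≤ 1)
    (hρS : (r - 1 : ℝ) * d + (r + 1) + ρ * #S ≤ #S) (hρ0 : 0 < ρ)
    (hhit : (1 - ρ) ^ l * (#A : ℝ) ^ (r - 1) < 1)
    (hm : #(A \ S) + (r + 1) + l + l * (2 * r) ≤ m) :
    ∃ U ⊆ S, ∃ c ≤ 1 + 3 * l, IsFlex G r A U c := by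
  obtain ⟨P, hPS, hPc⟩ := exists_isNClique_add_two hd1 hcod hind (r - 1) S hS hSc
  have hPc : G.IsNClique (r + 1) P := by
    have : r - 1 + 2 = r + 1 := by omega
    rwa [this] at hPc
  obtain ⟨x, hx⟩ : P.Nonempty := card_pos.1 (by rw [hPc.card_eq]; omega)
  have hr1 : ((r - 1 : ℕ) : ℝ) = r - 1 := by rw [Nat.cast_sub (by omega)]; simp
  have hSP := card_sdiff_add_card_eq_card hPS
  rw [hPc.card_eq] at hSP
  have hSPr : (#(S \ P) : ℝ) + (r + 1) = #S := by exact_mod_cast hSP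
  have hr2 : (2 : ℝ) ≤ r := by exact_mod_cast hr
  have hne : (S \ P).Nonempty := by
    rw [← card_pos]
    have h1 : (1 : ℝ) ≤ d := by exact_mod_cast hd1
    have h0 : (0 : ℝ) < #(S \ P) := by
      have : 0 ≤ ρ * #S := by positivity
      nlinarith
    exact_mod_cast h0
  obtain ⟨Y, hYS, hYl, hY⟩ := exists_hitting hne (A.powersetCard (r - 1))
    (fun Q y => ∀ u ∈ Q, G.Adj u y) hρ (fun Q hQ => by
      obtain ⟨hQA, hQc⟩ := mem_powersetCard.1 hQ
      have h1 := card_adj_all_ge (G := G) (S := S \ P) (K := Q) (d := d)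
        fun u hu => (codeg_mono (sdiff_subset.trans hS) u).trans (hcod u (hQA hu))
      have h2 : (#(S \ P) : ℝ) ≤ #{v ∈ S \ P | ∀ u ∈ Q, G.Adj u v} + (r - 1) * d := by
        rw [hQc] at h1
        rw [← hr1]; exact_mod_cast h1
      have h3 : ρ * #(S \ P) ≤ #{v ∈ S \ P | ∀ u ∈ Q, G.Adj u v} := by nlinarith
      convert h3) l
  have hYhit : ∀ Q ⊆ A, #Q = r - 1 → ∃ y ∈ Y, ∀ u ∈ Q, G.Adj u y := by
    intro Q hQ hQc
    by_contra! hc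
    have h1 : 0 < #{Q ∈ A.powersetCard (r - 1) | ∀ y ∈ Y, ¬ ∀ u ∈ Q, G.Adj u y} := by
      refine card_pos.2 ⟨Q, mem_filter.2 ⟨mem_powersetCard.2 ⟨hQ, hQc⟩, ?_⟩⟩
      intro y hy
      push Not
      exact hc y hy
    have h2 : (1 : ℝ) ≤ #{Q ∈ A.powersetCard (r - 1) | ∀ y ∈ Y, ¬ ∀ u ∈ Q, G.Adj u y} := by
      exact_mod_cast h1
    have h3 : (#(A.powersetCard (r - 1)) : ℝ) ≤ (#A : ℝ) ^ (r - 1) := by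
      rw [card_powersetCard]; exact_mod_cast Nat.choose_le_pow _ _
    have h4 := mul_le_mul_of_nonneg_left h3 (pow_nonneg (sub_nonneg.2 hρ) l)
    have h5 : (#{Q ∈ A.powersetCard (r - 1) | ∀ y ∈ Y, ¬ ∀ u ∈ Q, G.Adj u y} : ℝ) ≤
        (1 - ρ) ^ l * #(A.powersetCard (r - 1)) := by convert hY
    linarith
  have hYP : Disjoint Y P := (disjoint_sdiff_self_left).mono_left hYS
  have hYA : Y ⊆ A := hYS.trans (sdiff_subset.trans hS)
  have hxY : x ∉ Y := fun h => disjoint_left.1 hYP h hx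
  obtain ⟨Z, hZ, hZd⟩ := exists_gadgets hl (hS (hPS hx)) (X := A \ S ∪ P ∪ Y) hYA hxY (by
    have h1 := card_union_le (A \ S ∪ P) Y
    have h2 := card_union_le (A \ S) P
    rw [hPc.card_eq] at h2
    have h3 : #Y * (2 * r) ≤ l * (2 * r) := Nat.mul_le_mul_right _ hYl
    omega)
  have hZS : ∀ y ∈ Y, Z y ⊆ S := by
    intro y hy z hz
    by_contra hzS
    exact disjoint_left.1 (hZ y hy).2.1 hz
      (mem_union_left _ (mem_union_left _ (mem_sdiff.2 ⟨(hZ y hy).1 hz, hzS⟩)))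
  have hZP : ∀ y ∈ Y, Disjoint (Z y) P := fun y hy => (hZ y hy).2.1.mono_right
    (subset_union_right.trans subset_union_left)
  have hZY : ∀ y ∈ Y, Disjoint (Z y) Y := fun y hy => (hZ y hy).2.1.mono_right subset_union_right
  set B : V → Finset V := fun y => insert y (Z y) with hB
  have hBd : (Y : Set V).PairwiseDisjoint B := by
    intro y hy z hz hne
    simp only [Function.onFun, hB, disjoint_insert_left, disjoint_insert_right, mem_insert, not_or]
    exact ⟨⟨hne.symm, fun h => disjoint_left.1 (hZY y hy) h hz⟩,
      fun h => disjoint_left.1 (hZY z hz) h hy, hZd hy hz hne⟩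
  have hBP : ∀ y ∈ Y, Disjoint (B y) P := by
    intro y hy
    rw [hB, disjoint_insert_left]
    exact ⟨disjoint_left.1 hYP hy, hZP y hy⟩
  have hBS : ∀ y ∈ Y, B y ⊆ S := fun y hy =>
    insert_subset (sdiff_subset (hYS hy)) (hZS y hy)
  have hBf : HasFactor G r (Y.biUnion B) :=
    hasFactor_biUnion Y B (fun y hy => (hZ y hy).2.2.2.2) hBd
  obtain ⟨q, hq⟩ := hBf.dvd
  have hBc : #(Y.biUnion B) ≤ l * (2 * r + 1) :=
    (card_biUnion_le_card_mul Y B (2 * r + 1) fun y hy =>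
      (card_insert_le _ _).trans (by have := (hZ y hy).2.2.1; omega)).trans
      (Nat.mul_le_mul_right _ hYl)
  have hPB : Disjoint P (Y.biUnion B) :=
    (disjoint_biUnion_right _ _ _).2 fun y hy => (hBP y hy).symm
  refine ⟨P ∪ Y.biUnion B, union_subset hPS (biUnion_subset.2 hBS), q + 1, ?_, ?_, ?_, ?_⟩
  · have : r * q ≤ r * (3 * l) := by
      rw [← hq]; refine hBc.trans ?_
      nlinarith
    have := Nat.le_of_mul_le_mul_left this (by omega)
    omega
  · exact union_subset (hPS.trans hS) (biUnion_subset.2 fun y hy => (hBS y hy).trans hS)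
  · rw [card_union_of_disjoint hPB, hPc.card_eq, hq]; ring
  · intro Q hQ hQd hQc
    obtain ⟨y, hy, hyQ⟩ := hYhit Q hQ hQc.card_eq
    rw [disjoint_union_right, disjoint_biUnion_right] at hQd
    have f1 : HasFactor G r (P.erase x) := hasFactor_of_isNClique (hPc.erase_of_mem hx)
    have f2 : HasFactor G r (insert y Q) := hasFactor_of_isNClique (by
      have := hQc.insert fun u hu => (hyQ u hu).symm
      rwa [Nat.sub_add_cancel (by omega)] at this)
    have f3 := (hZ y hy).2.2.2.1
    have f4 : HasFactor G r ((Y.erase y).biUnion B) :=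
      hasFactor_biUnion _ B (fun z hz => (hZ z (mem_of_mem_erase hz)).2.2.2.2)
        (hBd.subset (by simp))
    have hxB : ∀ z ∈ Y, x ∉ B z := fun z hz h => disjoint_left.1 (hBP z hz) h hx
    have hyPn : y ∉ P := disjoint_left.1 hYP hy
    have hyB : y ∈ B y := mem_insert_self _ _
    have hZB : Z y ⊆ B y := subset_insert _ _
    have d1 : Disjoint (P.erase x) (insert y Q) := by
      rw [disjoint_insert_right]
      exact ⟨fun h => hyPn (mem_of_mem_erase h), (hQd.1.mono_right (erase_subset _ _)).symm⟩
    have d2 : Disjoint (P.erase x ∪ insert y Q) (insert x (Z y)) := by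
      rw [disjoint_insert_right, disjoint_union_left, disjoint_insert_left]
      refine ⟨?_, ((hZP y hy).mono_right (erase_subset _ _)).symm,
        fun h => disjoint_left.1 (hZY y hy) h hy, (hQd.2 y hy).mono_right hZB⟩
      simp only [mem_union, mem_erase, mem_insert, not_or]
      exact ⟨by simp, fun h => hxY (h ▸ hy), fun h => disjoint_left.1 hQd.1 h hx⟩
    have d3 : Disjoint (P.erase x ∪ insert y Q ∪ insert x (Z y)) ((Y.erase y).biUnion B) := by
      rw [disjoint_biUnion_right]
      intro z hz
      obtain ⟨hzy, hz⟩ := mem_erase.1 hz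
      have hd := hBd hy hz hzy.symm
      simp only [disjoint_union_left, disjoint_insert_left]
      exact ⟨⟨((hBP z hz).mono_right (erase_subset _ _)).symm,
        disjoint_left.1 hd hyB, hQd.2 z hz⟩, hxB z hz, hd.mono_left hZB⟩
    have key := ((f1.union f2 d1).union f3 d2).union f4 d3
    convert key using 1
    have e1 : Y.biUnion B = B y ∪ (Y.erase y).biUnion B := by
      rw [← biUnion_insert, insert_erase hy]
    have e2 : P = insert x (P.erase x) := (insert_erase hx).symm
    rw [e1]
    conv_lhs => rw [e2]
    ext z
    simp only [hB, mem_union, mem_insert]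
    tauto

end Flexible

section Absorption
variable {V : Type*} {G : SimpleGraph V} {r : ℕ} {A : Finset V}

theorem hasFactor_of_isFlex {p k : ℕ} {U : ℕ → Finset V} {c : ℕ → ℕ} (hr : 1 ≤ r)
    (hU : ∀ i < p, IsFlex G r A (U i) (c i)) (hUd : (range p : Set ℕ).PairwiseDisjoint U)
    (hcod : ∀ v ∈ A \ (range p).biUnion U, codeg G (A \ (range p).biUnion U) v ≤ k)
    (hcard : #(A \ (range p).biUnion U) + p = r * k) (hp : p ≤ k) (hk : 1 ≤ k) :
    HasFactor G r A := by
  obtain ⟨K, Z, hK, hKd, hKu, hZ, hKc⟩ := exists_clique_partition hcard hp hk hcod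
  obtain ⟨f, hfi, hfr⟩ : ∃ f : Fin k → ℕ, Set.InjOn f Z ∧ Z.image f = range p := by
    have e : Z ≃ range p := Finset.equivOfCardEq (by simpa using hZ)
    refine ⟨fun c => if h : c ∈ Z then e ⟨c, h⟩ else 0, ?_, ?_⟩
    · intro x hx y hy hxy
      rw [mem_coe] at hx hy
      simp only [hx, hy, dif_pos] at hxy
      simpa using e.injective (Subtype.ext hxy)
    · ext i
      simp only [mem_image]
      constructor
      · rintro ⟨x, hx, rfl⟩
        simp only [hx, dif_pos]
        exact (e ⟨x, hx⟩).2
      · intro hi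
        refine ⟨e.symm ⟨i, hi⟩, (e.symm ⟨i, hi⟩).2, ?_⟩
        simp
  have hfp : ∀ x ∈ Z, f x < p := fun x hx =>
    mem_range.1 (hfr ▸ mem_image_of_mem f hx)
  have hUW : ∀ i < p, U i ⊆ (range p).biUnion U := fun i hi =>
    subset_biUnion_of_mem U (mem_range.2 hi)
  have hKA : ∀ x, K x ⊆ A \ (range p).biUnion U := fun x =>
    hKu ▸ subset_biUnion_of_mem K (mem_univ x)
  have hKU : ∀ x, ∀ i < p, Disjoint (K x) (U i) := fun x i hi =>
    disjoint_sdiff_self_left.mono (hKA x) (hUW i hi)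
  set L : Fin k → Finset V := fun x => if x ∈ Z then U (f x) ∪ K x else K x with hL
  have hLf : ∀ x, HasFactor G r (L x) := by
    intro x
    have hx := hKc x
    simp only [hL]
    split_ifs with h
    · rw [if_pos h] at hx
      exact (hU _ (hfp x h)).2.2 _ ((hKA x).trans sdiff_subset) (hKU x _ (hfp x h))
        ⟨hK x, by omega⟩
    · rw [if_neg h] at hx
      exact hasFactor_of_isNClique ⟨hK x, by omega⟩
  have hLd : ∀ x y, x ≠ y → Disjoint (L x) (L y) := by
    intro x y hxy
    simp only [hL]
    split_ifs with h h' h'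
    · simp only [disjoint_union_left, disjoint_union_right]
      exact ⟨⟨hUd (by simpa using hfp x h) (by simpa using hfp y h')
        fun e => hxy (hfi h h' e), hKU x _ (hfp y h')⟩, (hKU y _ (hfp x h)).symm, hKd x y hxy⟩
    · exact disjoint_union_left.2 ⟨(hKU y _ (hfp x h)).symm, hKd x y hxy⟩
    · exact disjoint_union_right.2 ⟨hKU x _ (hfp y h'), hKd x y hxy⟩
    · exact hKd x y hxy
  have key := hasFactor_biUnion univ L (fun x _ => hLf x) (fun x _ y _ h => hLd x y h)
  have hWA : (range p).biUnion U ⊆ A := biUnion_subset.2 fun i hi => (hU i (mem_range.1 hi)).1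
  convert key using 1
  ext v
  simp only [mem_biUnion, mem_univ, true_and]
  constructor
  · intro hv
    by_cases hvW : v ∈ (range p).biUnion U
    · obtain ⟨i, hi, hvi⟩ := mem_biUnion.1 hvW
      rw [← hfr] at hi
      obtain ⟨x, hx, rfl⟩ := mem_image.1 hi
      exact ⟨x, by simp only [hL, if_pos hx]; exact mem_union_left _ hvi⟩
    · have : v ∈ univ.biUnion K := hKu ▸ mem_sdiff.2 ⟨hv, hvW⟩
      obtain ⟨x, -, hx⟩ := mem_biUnion.1 this
      refine ⟨x, ?_⟩
      simp only [hL]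
      split_ifs
      exacts [mem_union_right _ hx, hx]
  · rintro ⟨x, hx⟩
    simp only [hL] at hx
    split_ifs at hx with h
    · rcases mem_union.1 hx with hx | hx
      · exact hWA (hUW _ (hfp x h) hx)
      · exact (mem_sdiff.1 (hKA x hx)).1
    · exact (mem_sdiff.1 (hKA x hx)).1

theorem exists_heavy_or_light (ψ : V → ℝ) (w : ℝ) (S : Finset V) (B : ℕ) :
    (∃ X ⊆ S, HasFactor G r X ∧ #X = r * B ∧ B * w ≤ ∑ v ∈ X, ψ v) ∨
    (∃ X ⊆ S, #X ≤ r * B ∧ ∀ K ⊆ S \ X, G.IsNClique r K → ∑ v ∈ K, ψ v ≤ w) := by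
  induction B with
  | zero => exact Or.inl ⟨∅, by simp, hasFactor_empty, by simp, by simp⟩
  | succ B ih =>
    rcases ih with ⟨X, hXS, hXf, hXc, hXw⟩ | ⟨X, hXS, hXc, hX⟩
    · by_cases h : ∀ K ⊆ S \ X, G.IsNClique r K → ∑ v ∈ K, ψ v ≤ w
      · exact Or.inr ⟨X, hXS, by rw [hXc]; exact Nat.mul_le_mul_left _ (by omega), h⟩
      · push Not at h
        obtain ⟨K, hKS, hK, hKw⟩ := h
        have hd : Disjoint X K := (disjoint_sdiff_self_right).mono_right hKS
        refine Or.inl ⟨X ∪ K, union_subset hXS (hKS.trans sdiff_subset),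
          hXf.union (hasFactor_of_isNClique hK) hd, ?_, ?_⟩
        · rw [card_union_of_disjoint hd, hXc, hK.card_eq]; ring
        · rw [sum_union hd]; push_cast; linarith
    · exact Or.inr ⟨X, hXS, hXc.trans (Nat.mul_le_mul_left _ (by omega)), hX⟩

theorem exists_flex_heavy {k d h l m B σ : ℕ} {ρ γ β θ s : ℝ} (hr : 2 ≤ r)
    (hA : #A = r * k) (hkd : k ≤ d)
    (hcod : ∀ v ∈ A, codeg G A v ≤ d)
    (hind : ∀ S ⊆ A, h ≤ #S → ∃ u ∈ S, ∃ v ∈ S, G.Adj u v) (hl : IsLinked G r A m)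
    (hρ0 : 0 < ρ) (hρ1 : ρ ≤ 1) (hρh : (r + 1) + ρ * (r * d) ≤ h)
    (hhit : (1 - ρ) ^ l * (r * k : ℝ) ^ (r - 1) < 1)
    (hR : (r - 1) * d + h + (σ + (r * (1 + 3 * l) + 1) + r * B) < r * k)
    (hm : r * k + (r + 1) + l + l * (2 * r) ≤ m + ((r - 1) * d + h))
    (hB : 2 + 3 * l ≤ B * γ) (hγ : 0 ≤ γ) (hβ : 0 ≤ β)
    (hs : d * (1 - β) + (σ + (r * (1 + 3 * l) + 1) + r * B) ≤ s)
    (hθ : d * (γ + β) ≤ (d - h) * θ)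
    (hθl : (r * (1 + 3 * l) + 1) * (2 * (r + 1 : ℝ) ^ (r + 1) * θ) ≤ 1 / (2 * r))
    {ψ : V → ℝ} (hψ0 : ∀ v ∈ A, 0 ≤ ψ v) (hψ1 : ∀ v ∈ A, ψ v ≤ 1) (hψs : s ≤ ∑ v ∈ A, ψ v)
    {W : Finset V} (hW : W ⊆ A) (hWc : #W ≤ σ) :
    ∃ U ⊆ A \ W, ∃ c ≤ 1 + 3 * l + B, IsFlex G r A U c ∧ c + 1 / (2 * r) ≤ ∑ v ∈ U, ψ v := by
  have hr2 : (2 : ℝ) ≤ r := by exact_mod_cast hr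
  have hr1 : ((r - 1 : ℕ) : ℝ) = r - 1 := by rw [Nat.cast_sub (by omega)]; simp
  have hrk : r * k = (r - 1) * k + k := by
    conv_lhs => rw [show r = (r - 1) + 1 by omega]
    ring
  have hrd : r * d = (r - 1) * d + d := by
    conv_lhs => rw [show r = (r - 1) + 1 by omega]
    ring
  have hmk : (r - 1) * k ≤ (r - 1) * d := Nat.mul_le_mul_left _ hkd
  have hhk : h < k := by omega
  have base : ∀ S ⊆ A, (r - 1) * d + h ≤ #S → ∃ U ⊆ S, ∃ c ≤ 1 + 3 * l, IsFlex G r A U c := by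
    intro S hS hSc
    have h1 := card_sdiff_add_card_eq_card hS
    refine exists_flex (ρ := ρ) (m := m) hr (by omega) hcod hind hl hS hSc hρ1 ?_ hρ0 ?_ (by omega)
    · have h2 : ((r - 1 : ℕ) : ℝ) * d + h ≤ #S := by exact_mod_cast hSc
      have h3 : (#S : ℝ) ≤ r * d := by
        have : #S ≤ r * d := by omega
        exact_mod_cast this
      rw [hr1] at h2
      nlinarith [mul_le_mul_of_nonneg_left h3 hρ0.le]
    · rw [hA]; exact_mod_cast hhit
  have hAW := card_sdiff_add_card_eq_card hW
  obtain ⟨U, hUS, c, hc, hU⟩ := base (A \ W) sdiff_subset (by omega)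
  have hUA := hU.1
  have hUc : #U ≤ r * (1 + 3 * l) + 1 := by
    rw [hU.2.1]; exact Nat.succ_le_succ (Nat.mul_le_mul_left r hc)
  rcases exists_heavy_or_light (G := G) (r := r) ψ (1 + γ) ((A \ W) \ U) B with
    ⟨X, hXS, hXf, hXc, hXw⟩ | ⟨X, hXS, hXc, hX⟩
  · have hd : Disjoint U X := disjoint_sdiff_self_right.mono_right hXS
    refine ⟨U ∪ X, union_subset hUS (hXS.trans sdiff_subset), c + B, by omega,
      hU.union hXf (hXS.trans (sdiff_subset.trans sdiff_subset)) hd hXc, ?_⟩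
    rw [sum_union hd]
    have h1 : 0 ≤ ∑ v ∈ U, ψ v := sum_nonneg fun v hv => hψ0 v (hUA hv)
    have h2 : (c : ℝ) ≤ 1 + 3 * l := by exact_mod_cast hc
    have h3 : 1 / (2 * r : ℝ) ≤ 1 := by
      rw [div_le_one (by linarith)]; linarith
    push_cast
    linarith
  · set A' := ((A \ W) \ U) \ X with hA'
    have hA'A : A' ⊆ A := sdiff_subset.trans (sdiff_subset.trans sdiff_subset)
    have c1 : #A' + #X = _ := card_sdiff_add_card_eq_card hXS
    have c2 := card_sdiff_add_card_eq_card hUS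
    have hle := card_le_card hA'A
    have hsum : ∑ v ∈ A, ψ v ≤ ∑ v ∈ A', ψ v + #(A \ A') := by
      rw [← sum_sdiff hA'A, add_comm]
      have := sum_le_card_nsmul (A \ A') ψ 1 fun v hv => hψ1 v (sdiff_subset hv)
      simp only [nsmul_eq_mul, mul_one] at this
      linarith
    have hcA' : #(A \ A') ≤ σ + (r * (1 + 3 * l) + 1) + r * B := by
      have := card_sdiff_add_card_eq_card hA'A
      omega
    have hcA'' : (#(A \ A') : ℝ) ≤ σ + (r * (1 + 3 * l) + 1) + r * B := by exact_mod_cast hcA'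
    have hθ0 : 0 ≤ θ := by
      by_contra hcon
      push Not at hcon
      have hg : (0 : ℝ) < d - h := by rw [sub_pos]; exact_mod_cast hhk.trans_le hkd
      have : (0 : ℝ) ≤ d * (γ + β) := by positivity
      nlinarith [mul_pos hg (neg_pos.2 hcon)]
    have hδ0 : 0 ≤ 2 * (r + 1 : ℝ) ^ (r + 1) * θ := by positivity
    obtain ⟨S, hSA', hSc, hSψ⟩ := exists_large_of_clique_sum_le (A := A') (d := d) (h := h)
      (ψ := ψ) hr (by omega) (fun v hv => (codeg_mono hA'A v).trans (hcod v (hA'A hv)))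
      (fun S hS => hind S (hS.trans hA'A)) (fun v hv => hψ0 v (hA'A hv))
      (fun K hK hKc => hX K hK hKc) (by linarith) (by omega) (by omega) hβ hγ hθ (by
        have h1 : (1 : ℝ) ≤ r * (1 + 3 * l) + 1 := by
          have : (0 : ℝ) ≤ r * (1 + 3 * l) := by positivity
          linarith
        have h2 := mul_le_mul_of_nonneg_right h1 hδ0
        have h3 : 1 / (2 * r : ℝ) < 1 / r := by
          apply one_div_lt_one_div_of_lt <;> linarith
        linarith)
    obtain ⟨U', hU'S, c', hc', hU'⟩ := base S (hSA'.trans hA'A) hSc.le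
    refine ⟨U', hU'S.trans (hSA'.trans (sdiff_subset.trans sdiff_subset)), c', by omega, hU', ?_⟩
    have h1 := card_nsmul_le_sum U' ψ _ fun v hv => hSψ v (hU'S hv)
    rw [hU'.2.1, nsmul_eq_mul] at h1
    refine le_trans ?_ h1
    have h2 : (c' : ℝ) ≤ 1 + 3 * l := by exact_mod_cast hc'
    have h3 : (r * c' + 1 : ℝ) * (2 * (r + 1 : ℝ) ^ (r + 1) * θ) ≤ 1 / (2 * r) := by
      refine le_trans (mul_le_mul_of_nonneg_right ?_ hδ0) hθl
      have := mul_le_mul_of_nonneg_left h2 (show (0 : ℝ) ≤ r by linarith)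
      linarith
    have h4 : (r * c' + 1 : ℝ) * (1 / r) = c' + 1 / (2 * r) + 1 / (2 * r) := by
      field_simp; ring
    push_cast
    linarith [h3, h4, mul_sub (r * c' + 1 : ℝ) (1 / r) (2 * (r + 1 : ℝ) ^ (r + 1) * θ)]

end Absorption

section WeightUpdate
variable {V : Type*} {G : SimpleGraph V} {r : ℕ} {A : Finset V}

theorem exp_neg_le {y : ℝ} (h : |y| ≤ 1) : Real.exp (-y) ≤ 1 - y + y ^ 2 := by
  have h1 := Real.abs_exp_sub_one_sub_id_le (x := -y) (by rwa [abs_neg])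
  have h2 := (abs_le.1 h1).2
  have h3 : (-y) ^ 2 = y ^ 2 := by ring
  linarith

theorem codeg_biUnion {s : Finset ℕ} {U : ℕ → Finset V} (h : (s : Set ℕ).PairwiseDisjoint U)
    (v : V) : codeg G (s.biUnion U) v = ∑ i ∈ s, codeg G (U i) v := by
  rw [codeg, filter_biUnion, card_biUnion]
  · rfl
  · intro i hi j hj hij
    exact disjoint_filter_filter (h hi hj hij)

theorem exists_flex_family {X σ p : ℕ} {s g : ℝ} (hg0 : 0 < g) (hg1 : g ≤ 1)
    (hstep : ∀ ψ : V → ℝ, (∀ v ∈ A, 0 ≤ ψ v) → (∀ v ∈ A, ψ v ≤ 1) → s ≤ ∑ v ∈ A, ψ v →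
      ∀ W ⊆ A, #W ≤ σ → ∃ U ⊆ A \ W, ∃ c ≤ X, IsFlex G r A U c ∧ c + g ≤ ∑ v ∈ U, ψ v)
    {T : Finset V} (hT : T.Nonempty) (hTs : ∀ v ∈ T, s ≤ codeg G A v)
    (hr : 1 ≤ r) (hσ : p * (r * X + 1) ≤ σ) : ∀ j ≤ p, ∃ (U : ℕ → Finset V) (c : ℕ → ℕ),
      (∀ i < j, IsFlex G r A (U i) (c i) ∧ c i ≤ X) ∧ (range j : Set ℕ).PairwiseDisjoint U ∧
      ∑ v ∈ T, Real.exp (-(g / (2 * (r * X + 1 : ℝ) ^ 2) *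
        ∑ i ∈ range j, ((codeg G (U i) v : ℝ) - c i))) ≤
        #T * Real.exp (-(j * (g ^ 2 / (4 * (r * X + 1 : ℝ) ^ 2)))) := by
  intro j
  set Y : ℝ := r * X + 1 with hY
  have hY1 : 1 ≤ Y := by rw [hY]; have : (0 : ℝ) ≤ r * X := by positivity
                         linarith
  set μ : ℝ := g / (2 * Y ^ 2) with hμ
  have hμ0 : 0 < μ := by positivity
  induction j with
  | zero => intro _; exact ⟨fun _ => ∅, fun _ => 0, by simp, by simp, by simp⟩
  | succ j ih =>
    intro hj
    obtain ⟨U, c, hU, hUd, hΦ⟩ := ih (by omega)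
    set lam : V → ℝ := fun v => Real.exp (-(μ * ∑ i ∈ range j, ((codeg G (U i) v : ℝ) - c i)))
      with hlam
    have hlam0 : ∀ v, 0 < lam v := fun v => Real.exp_pos _
    set Λ := ∑ v ∈ T, lam v with hΛ
    have hΛ0 : 0 < Λ := sum_pos (fun v _ => hlam0 v) hT
    let ψ : V → ℝ := fun u => (∑ v ∈ T, lam v * if G.Adj v u then 0 else 1) / Λ
    have hψU : ∀ S : Finset V, ∑ u ∈ S, ψ u = (∑ v ∈ T, lam v * codeg G S v) / Λ := by
      intro S
      simp only [ψ]
      rw [← sum_div, sum_comm]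
      congr 1
      refine sum_congr rfl fun v _ => ?_
      rw [← mul_sum, codeg, card_filter]
      push_cast
      congr 1
      exact sum_congr rfl fun u _ => by split_ifs <;> simp_all
    set W := (range j).biUnion U with hW
    have hWA : W ⊆ A := biUnion_subset.2 fun i hi => (hU i (mem_range.1 hi)).1.1
    have hWc : #W ≤ σ := by
      refine (card_biUnion_le_card_mul _ _ (r * X + 1) fun i hi => ?_).trans ?_
      · have := hU i (mem_range.1 hi)
        rw [this.1.2.1]
        exact Nat.succ_le_succ (Nat.mul_le_mul_left r this.2)
      · rw [card_range]
        exact (Nat.mul_le_mul_right _ (by omega)).trans hσ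
    obtain ⟨U', hU'W, c', hc', hU', hψc⟩ := hstep ψ
      (fun u _ => div_nonneg (sum_nonneg fun v _ => mul_nonneg (hlam0 v).le
        (by split_ifs <;> norm_num)) hΛ0.le)
      (fun u _ => (div_le_one hΛ0).2 (sum_le_sum fun v _ => by
        have := (hlam0 v).le
        split_ifs <;> linarith))
      (by
        rw [hψU, le_div_iff₀ hΛ0, hΛ, mul_sum]
        exact sum_le_sum fun v hv => by
          rw [mul_comm]; exact mul_le_mul_of_nonneg_left (hTs v hv) (hlam0 v).le)
      W hWA hWc
    rw [hψU, le_div_iff₀ hΛ0] at hψc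
    have hup : ∀ i < j, Function.update U j U' i = U i := fun i hi =>
      Function.update_of_ne hi.ne _ _
    have hupc : ∀ i < j, Function.update c j c' i = c i := fun i hi =>
      Function.update_of_ne hi.ne _ _
    have hUU' : ∀ i < j, Disjoint (U i) U' := fun i hi =>
      disjoint_sdiff_self_right.mono (subset_biUnion_of_mem U (mem_range.2 hi)) hU'W
    refine ⟨Function.update U j U', Function.update c j c', ?_, ?_, ?_⟩
    · intro i hi
      rcases Nat.lt_succ_iff_lt_or_eq.1 hi with hi | rfl
      · rw [hup i hi, hupc i hi]; exact hU i hi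
      · rw [Function.update_self, Function.update_self]; exact ⟨hU', hc'⟩
    · intro i hi i' hi' hne
      simp only [coe_range, Set.mem_Iio, Nat.lt_succ_iff_lt_or_eq] at hi hi'
      simp only [Function.onFun]
      rcases hi with hi | rfl <;> rcases hi' with hi' | rfl
      · rw [hup i hi, hup i' hi']; exact hUd (by simpa using hi) (by simpa using hi') hne
      · rw [hup i hi, Function.update_self]; exact hUU' i hi
      · rw [hup i' hi', Function.update_self]; exact (hUU' i' hi').symm
      · exact absurd rfl hne
    · have hval : ∀ v, Real.exp (-(μ * ∑ i ∈ range (j + 1),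
          ((codeg G (Function.update U j U' i) v : ℝ) - (Function.update c j c' i : ℕ)))) =
          lam v * Real.exp (-(μ * (codeg G U' v - c'))) := by
        intro v
        rw [hlam, ← Real.exp_add, sum_range_succ, Function.update_self, Function.update_self]
        congr 1
        rw [sum_congr rfl fun i hi => by rw [hup i (mem_range.1 hi), hupc i (mem_range.1 hi)]]
        ring
      rw [sum_congr rfl fun v _ => hval v]
      have hbound : ∀ v, Real.exp (-(μ * (codeg G U' v - c'))) ≤
          1 - μ * (codeg G U' v - c') + (μ * Y) ^ 2 := by
        intro v
        have h1 : |((codeg G U' v : ℝ) - c')| ≤ Y := by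
          have h2 : (codeg G U' v : ℝ) ≤ r * c' + 1 := by
            have := codeg_le_card (G := G) (A := U') v
            rw [hU'.2.1] at this
            exact_mod_cast this
          have h3 : (c' : ℝ) ≤ X := by exact_mod_cast hc'
          have h4 : (1 : ℝ) ≤ r := by exact_mod_cast hr
          have h5 : (0 : ℝ) ≤ codeg G U' v := by positivity
          have h6 : (0 : ℝ) ≤ c' := by positivity
          rw [abs_le]
          constructor <;> nlinarith
        have h7 : |μ * ((codeg G U' v : ℝ) - c')| ≤ μ * Y := by
          rw [abs_mul, abs_of_pos hμ0]; exact mul_le_mul_of_nonneg_left h1 hμ0.le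
        have h8 : μ * Y ≤ 1 := by
          rw [hμ, div_mul_eq_mul_div, div_le_one (by positivity)]
          nlinarith
        have h9 := exp_neg_le (h7.trans h8)
        have h10 : (μ * ((codeg G U' v : ℝ) - c')) ^ 2 ≤ (μ * Y) ^ 2 := by
          rw [← sq_abs]; gcongr
        linarith
      have h1 : ∑ v ∈ T, lam v * Real.exp (-(μ * (codeg G U' v - c'))) ≤
          Λ * (1 - μ * g + (μ * Y) ^ 2) := by
        calc _ ≤ ∑ v ∈ T, lam v * (1 - μ * (codeg G U' v - c') + (μ * Y) ^ 2) :=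
              sum_le_sum fun v _ => mul_le_mul_of_nonneg_left (hbound v) (hlam0 v).le
          _ = Λ * (1 + μ * c' + (μ * Y) ^ 2) - μ * ∑ v ∈ T, lam v * codeg G U' v := by
              rw [hΛ, sum_mul, mul_sum, ← sum_sub_distrib]
              exact sum_congr rfl fun v _ => by ring
          _ ≤ _ := by nlinarith [mul_le_mul_of_nonneg_left hψc hμ0.le]
      have h2 : 1 - μ * g + (μ * Y) ^ 2 ≤ Real.exp (-(g ^ 2 / (4 * Y ^ 2))) := by
        have h3 : 1 - μ * g + (μ * Y) ^ 2 = -(g ^ 2 / (4 * Y ^ 2)) + 1 := by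
          rw [hμ]; field_simp; ring
        rw [h3]; exact Real.add_one_le_exp _
      refine h1.trans ((mul_le_mul_of_nonneg_left h2 hΛ0.le).trans
        ((mul_le_mul_of_nonneg_right hΦ (Real.exp_pos _).le).trans_eq ?_))
      rw [mul_assoc, ← Real.exp_add]
      congr 2
      push_cast
      ring

theorem hasFactor_of_isLinked {k D h l m B p : ℕ} {ρ γ β θ : ℝ} (hr : 2 ≤ r)
    (hA : #A = r * k) (hcod : ∀ v ∈ A, codeg G A v ≤ k + D)
    (hind : ∀ S ⊆ A, h ≤ #S → ∃ u ∈ S, ∃ v ∈ S, G.Adj u v) (hl : IsLinked G r A m)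
    (hρ0 : 0 < ρ) (hρ1 : ρ ≤ 1) (hρh : (r + 1) + ρ * (r * (k + D)) ≤ h)
    (hhit : (1 - ρ) ^ l * (r * k : ℝ) ^ (r - 1) < 1)
    (hR : (r - 1) * (k + D) + h + (p * (r * (1 + 3 * l + B) + 1) + (r * (1 + 3 * l) + 1) + r * B) <
      r * k)
    (hm : r * k + (r + 1) + l + l * (2 * r) ≤ m + ((r - 1) * (k + D) + h))
    (hB : 2 + 3 * l ≤ B * γ) (hγ : 0 ≤ γ) (hβ : 0 ≤ β)
    (hs : (k + D) * (1 - β) + (p * (r * (1 + 3 * l + B) + 1) + (r * (1 + 3 * l) + 1) + r * B) +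
      p * (1 + 3 * l + B) ≤ k)
    (hθ : (k + D) * (γ + β) ≤ (k + D - h) * θ)
    (hθl : (r * (1 + 3 * l) + 1) * (2 * (r + 1 : ℝ) ^ (r + 1) * θ) ≤ 1 / (2 * r))
    (hp : p + p * (1 + 3 * l + B) < k)
    (hD : D + 4 * r * (r * (1 + 3 * l + B) + 1 : ℝ) ^ 2 * Real.log (r * k) ≤ p / (4 * r)) :
    HasFactor G r A := by
  have hr2 : (2 : ℝ) ≤ r := by exact_mod_cast hr
  have hk : 1 ≤ k := by omega
  set X := 1 + 3 * l + B with hX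
  have hXc : (X : ℝ) = 1 + 3 * l + B := by rw [hX]; push_cast; ring
  set s : ℝ := k - p * X with hs'
  set T := A.filter fun v => s ≤ codeg G A v with hT
  rcases T.eq_empty_or_nonempty with hTe | hTne
  · refine hasFactor_of_codeg_le hA fun v hv => ?_
    have h1 : v ∉ T := by rw [hTe]; simp
    rw [hT, mem_filter, not_and, not_le] at h1
    have h2 : (codeg G A v : ℝ) ≤ k := (h1 hv).le.trans (by
      rw [hs']; have : (0 : ℝ) ≤ p * X := by positivity
      linarith)
    exact_mod_cast h2
  obtain ⟨U, c, hU, hUd, hΦ⟩ := exists_flex_family (G := G) (r := r) (A := A) (X := X)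
    (σ := p * (r * X + 1)) (p := p) (s := s) (g := 1 / (2 * r)) (by positivity) (by
      rw [div_le_one (by linarith)]; linarith)
    (fun ψ h0 h1 h2 W hW hWc => exists_flex_heavy (d := k + D) hr hA (by omega) hcod hind hl hρ0 hρ1
      (by push_cast; exact hρh) hhit hR hm hB hγ hβ (by
        rw [hs']; push_cast at hs ⊢; rw [hXc]; linarith)
        (by push_cast; exact hθ) hθl h0 h1 h2 hW hWc)
    hTne (fun v hv => (mem_filter.1 hv).2) (by omega) le_rfl p le_rfl
  set W := (range p).biUnion U with hW
  have hWA : W ⊆ A := biUnion_subset.2 fun i hi => (hU i (mem_range.1 hi)).1.1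
  set C := ∑ i ∈ range p, c i with hC
  have hWc : #W = r * C + p := by
    have h1 : ∀ i ∈ range p, #(U i) = r * c i + 1 := fun i hi => (hU i (mem_range.1 hi)).1.2.1
    rw [hW, card_biUnion hUd, sum_congr rfl h1, sum_add_distrib, ← mul_sum, ← hC]
    simp
  have hCX : C ≤ p * X := by
    have := sum_le_card_nsmul (range p) c X fun i hi => (hU i (mem_range.1 hi)).2
    simpa using this
  have hgain : ∀ v ∈ T, (D : ℝ) ≤ ∑ i ∈ range p, ((codeg G (U i) v : ℝ) - c i) := by
    intro v hv
    set S := ∑ i ∈ range p, ((codeg G (U i) v : ℝ) - c i) with hS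
    set Y : ℝ := r * X + 1 with hY
    have hY0 : 0 < Y := by positivity
    have h1 := single_le_sum (f := fun v => Real.exp (-(1 / (2 * r : ℝ) / (2 * Y ^ 2) *
      ∑ i ∈ range p, ((codeg G (U i) v : ℝ) - c i)))) (fun v _ => (Real.exp_pos _).le) hv
    have hTk : (#T : ℝ) ≤ r * k := by
      have := card_le_card (filter_subset (fun v => s ≤ codeg G A v) A)
      rw [hA] at this; exact_mod_cast this
    have hrk : (0 : ℝ) < r * k := by
      have : (1 : ℝ) ≤ k := by exact_mod_cast hk
      positivity
    have h2 := (h1.trans hΦ).trans (mul_le_mul_of_nonneg_right hTk (Real.exp_pos _).le)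
    rw [← Real.exp_log hrk, ← Real.exp_add, Real.exp_le_exp] at h2
    have hD' : D + 4 * r * Y ^ 2 * Real.log (r * k) ≤ p / (4 * r) := by
      rw [hY, hX]; push_cast; exact hD
    rw [← hS] at h2
    have h3 := mul_le_mul_of_nonneg_left h2 (show (0 : ℝ) ≤ 4 * r * Y ^ 2 by positivity)
    have e1 : 4 * r * Y ^ 2 * -(1 / (2 * r : ℝ) / (2 * Y ^ 2) * S) = -S := by
      field_simp
      ring
    have e2 : 4 * r * Y ^ 2 * (Real.log (r * k) + -(p * ((1 / (2 * r : ℝ)) ^ 2 / (4 * Y ^ 2)))) =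
        4 * r * Y ^ 2 * Real.log (r * k) - p / (4 * r) := by
      field_simp
      ring
    rw [e1, e2] at h3
    linarith
  refine hasFactor_of_isFlex (k := k - C) (by omega) (fun i hi => (hU i hi).1) hUd ?_ ?_
    (by omega) (by omega)
  · intro v hv
    have h1 := codeg_sdiff_add (G := G) hWA v
    rw [codeg_biUnion hUd] at h1
    rw [← hW]
    by_cases hvT : v ∈ T
    · have h2 := hgain v hvT
      rw [sum_sub_distrib] at h2
      have h3 : D + C ≤ ∑ i ∈ range p, codeg G (U i) v := by
        have : ((D + C : ℕ) : ℝ) ≤ ((∑ i ∈ range p, codeg G (U i) v : ℕ) : ℝ) := by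
          rw [hC]; push_cast; linarith
        exact_mod_cast this
      have h4 := hcod v (sdiff_subset hv)
      omega
    · have h2 : ¬ s ≤ codeg G A v := fun h => hvT (mem_filter.2 ⟨sdiff_subset hv, h⟩)
      rw [hs', not_le] at h2
      have h3 : codeg G A v + p * X < k := by
        have : ((codeg G A v + p * X : ℕ) : ℝ) < k := by push_cast; linarith
        exact_mod_cast this
      omega
  · rw [← hW]
    have h1 := card_sdiff_add_card_eq_card hWA
    rw [Nat.mul_sub]
    have : r * C ≤ r * k := Nat.mul_le_mul_left _ (by omega)
    omega

end WeightUpdate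

section Linking
variable {V : Type*} {G : SimpleGraph V} {r : ℕ} {A : Finset V}

set_option maxHeartbeats 2000000 in
theorem hasFactor_of_isLinked_of_large {t k D : ℕ} (hr : 2 ≤ r) (ht : 100 * (r + 1) ^ (r + 3) ≤ t)
    (hkt : t ^ 40 ≤ k) (hlog : Real.log (r * k) ≤ t) (hA : #A = r * k)
    (hcod : ∀ v ∈ A, codeg G A v ≤ k + D) (hD : D * t ^ 16 ≤ k)
    (hind : ∀ S ⊆ A, k ≤ #S + k / t → ∃ u ∈ S, ∃ v ∈ S, G.Adj u v)
    (hl : IsLinked G r A (2 * (k / t))) : HasFactor G r A := by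
  have hr2 : (2 : ℝ) ≤ r := by exact_mod_cast hr
  have htr : 100 * (r + 1) * (r + 1) ≤ t := by
    refine le_trans ?_ ht
    rw [mul_assoc, ← pow_two]
    exact Nat.mul_le_mul_left _ (Nat.pow_le_pow_right (by omega) (by omega))
  have hτ : 100 * ((r : ℝ) + 1) * (r + 1) ≤ t := by exact_mod_cast htr
  have hτ0 : (900 : ℝ) ≤ t := by nlinarith
  have hτr : 100 * (r : ℝ) ≤ t := by nlinarith
  have ht0 : 0 < t := by
    have : (0 : ℝ) < t := by linarith
    exact_mod_cast this
  have hk40 : (t : ℝ) ^ 40 ≤ k := by exact_mod_cast hkt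
  have hτp : (0 : ℝ) < t := by linarith
  have hk0 : (0 : ℝ) < k := lt_of_lt_of_le (by positivity) hk40
  have hk0' : 0 < k := by exact_mod_cast hk0
  set η := k / t with hη
  set p := k / t ^ 14 with hp
  have hη1 : (η : ℝ) ≤ k / t := Nat.cast_div_le
  have hη2 : (k : ℝ) / t - 1 ≤ η := by
    have := Nat.lt_div_mul_add ht0 (a := k)
    have h2 : (k : ℝ) < (η + 1) * t := by
      have h3 : k < (η + 1) * t := by rw [hη]; linarith
      exact_mod_cast h3
    rw [sub_le_iff_le_add, div_le_iff₀ hτp]; exact h2.le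
  have hp1 : (p : ℝ) ≤ k / t ^ 14 := by
    have := Nat.cast_div_le (α := ℝ) (m := k) (n := t ^ 14)
    push_cast at this; exact this
  have hp2 : (k : ℝ) / t ^ 14 - 1 ≤ p := by
    have := Nat.lt_div_mul_add (pow_pos ht0 14) (a := k)
    have h2 : (k : ℝ) < (p + 1) * t ^ 14 := by
      have h3 : k < (p + 1) * t ^ 14 := by rw [hp]; linarith
      exact_mod_cast h3
    rw [sub_le_iff_le_add, div_le_iff₀ (by positivity)]; exact h2.le
  have hD' : (D : ℝ) ≤ k / t ^ 16 := by
    rw [le_div_iff₀ (by positivity)]; exact_mod_cast hD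
  have hηk : η ≤ k := Nat.div_le_self _ _
  -- the scale `w = k / t ^ 16`
  obtain ⟨w, hw⟩ : ∃ w : ℝ, w = k / t ^ 16 := ⟨_, rfl⟩
  have hkw : (k : ℝ) = w * t ^ 16 := by rw [hw]; field_simp
  have hwt : (t : ℝ) ^ 24 ≤ w := by
    rw [hw, le_div_iff₀ (by positivity)]; calc _ = (t : ℝ) ^ 40 := by ring
      _ ≤ _ := hk40
  have hw0 : 0 < w := lt_of_lt_of_le (by positivity) hwt
  have e1 : (k : ℝ) / t = w * t ^ 15 := by rw [hkw]; field_simp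
  have e2 : (k : ℝ) / t ^ 14 = w * t ^ 2 := by rw [hkw]; field_simp
  rw [e1] at hη1 hη2
  rw [e2] at hp1 hp2
  rw [← hw] at hD'
  have hw1 : (1 : ℝ) ≤ w := le_trans (one_le_pow₀ (by linarith)) hwt
  have hX : (1 + 3 * (t : ℝ) ^ 2 + t ^ 8) ≤ 2 * t ^ 8 := by
    have : (t : ℝ) ^ 2 * 4 ≤ t ^ 2 * t ^ 6 := by
      gcongr
      calc (4 : ℝ) ≤ t ^ 1 := by linarith
        _ ≤ t ^ 6 := pow_le_pow_right₀ (by linarith) (by norm_num)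
    have : (1 : ℝ) ≤ t ^ 2 := one_le_pow₀ (by linarith)
    linarith
  have hX' : (r * (1 + 3 * (t : ℝ) ^ 2 + t ^ 8) + 1) ≤ 3 * r * t ^ 8 := by
    have h1 : (1 : ℝ) ≤ r * t ^ 8 := by
      have : (1 : ℝ) ≤ t ^ 8 := one_le_pow₀ (by linarith)
      exact one_le_mul_of_one_le_of_one_le (by linarith) this
    have h2 : (r : ℝ) * (1 + 3 * (t : ℝ) ^ 2 + t ^ 8) ≤ r * (2 * t ^ 8) := by gcongr
    linarith
  have hl' : (r * (1 + 3 * (t : ℝ) ^ 2) + 1) ≤ 5 * r * t ^ 2 := by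
    have : (1 : ℝ) ≤ t ^ 2 := one_le_pow₀ (by linarith)
    have h2 : (r : ℝ) * 1 ≤ r * t ^ 2 := by gcongr
    linarith
  have ht28 : (t : ℝ) ^ 2 ≤ t ^ 8 := pow_le_pow_right₀ (by linarith) (by norm_num)
  have hRR : p * (r * (1 + 3 * (t : ℝ) ^ 2 + t ^ 8) + 1) +
        (r * (1 + 3 * (t : ℝ) ^ 2) + 1) + r * t ^ 8
      ≤ 9 * r * (w * t ^ 10) := by
    have h1 : p * (r * (1 + 3 * (t : ℝ) ^ 2 + t ^ 8) + 1) ≤ (w * t ^ 2) * (3 * r * t ^ 8) := by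
      gcongr
    have h2 : (r : ℝ) * t ^ 8 ≤ r * (w * t ^ 10) := by
      have : 1 * (t : ℝ) ^ 8 ≤ w * t ^ 10 := by
        gcongr
        · linarith
        · norm_num
      gcongr; linarith
    have h3 : 5 * (r : ℝ) * t ^ 2 ≤ 5 * (r * t ^ 8) := by
      rw [mul_assoc]; gcongr
    linarith
  have hRR' : 9 * r * (w * t ^ 10) ≤ w * t ^ 11 / 10 := by
    have : 90 * r * (w * t ^ 10) ≤ t * (w * t ^ 10) := by gcongr; linarith
    linarith
  have hpX : p * (1 + 3 * (t : ℝ) ^ 2 + t ^ 8) ≤ w * t ^ 11 / 10 := by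
    have h1 : p * (1 + 3 * (t : ℝ) ^ 2 + t ^ 8) ≤ (w * t ^ 2) * (2 * t ^ 8) := by gcongr
    have : 20 * (w * t ^ 10) ≤ t * (w * t ^ 10) := by gcongr; linarith
    linarith
  have ht15 : w * (t : ℝ) ^ 11 * 900 ≤ w * t ^ 15 := by
    have : w * (t : ℝ) ^ 11 * 900 ≤ w * t ^ 11 * t ^ 4 := by
      gcongr
      exact hτ0.trans (le_self_pow₀ (by linarith) (by norm_num))
    linarith
  have hrD : (r : ℝ) * w ≤ w * t ^ 11 / 10 := by
    have h1 : (t : ℝ) ≤ t ^ 11 := le_self_pow₀ (by linarith) (by norm_num)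
    have h2 : w * (100 * r) ≤ w * t ^ 11 := by gcongr; exact hτr.trans h1
    have h3 : 0 ≤ w * r := by positivity
    linarith
  have hkη : ((k - η : ℕ) : ℝ) = k - η := by push_cast [hηk]; ring
  have h1w11 : 1 ≤ w * (t : ℝ) ^ 11 := by
    have : (1 : ℝ) ≤ t ^ 11 := one_le_pow₀ (by linarith)
    exact one_le_mul_of_one_le_of_one_le hw1 this
  have hw16 : w * (t : ℝ) ^ 15 * 900 ≤ w * t ^ 16 := by
    have : w * (t : ℝ) ^ 15 * 900 ≤ w * t ^ 15 * t := by gcongr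
    linarith
  refine hasFactor_of_isLinked (D := D) (h := k - η) (l := t ^ 2) (B := t ^ 8) (p := p)
    (ρ := 1 / (4 * r)) (γ := 1 / t ^ 5) (β := 1 / t ^ 5) (θ := 1 / t ^ 3) hr hA hcod
    (fun S hS hc => hind S hS (by omega)) hl (by positivity) ?_ ?_ ?_ ?_ ?_ ?_ (by positivity)
    (by positivity) ?_ ?_ ?_ ?_ ?_
  · rw [div_le_one (by positivity)]; linarith
  · rw [hkη]
    have : 1 / (4 * (r : ℝ)) * (r * (k + D)) = (k + D) / 4 := by field_simp
    rw [this]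
    have : w ≤ w * t ^ 15 := by
      have : (1 : ℝ) ≤ t ^ 15 := one_le_pow₀ (by linarith)
      exact le_mul_of_one_le_right hw0.le this
    have hr1 : (r : ℝ) ≤ w * t ^ 11 := by
      have : (r : ℝ) * 1 ≤ r * w := by gcongr
      linarith
    linarith
  · have hrk : 0 < (r : ℝ) * k := by positivity
    have h1 : (1 - 1 / (4 * (r : ℝ))) ^ t ^ 2 ≤ Real.exp (-(t ^ 2 / (4 * r))) := by
      have h2 : 1 - 1 / (4 * (r : ℝ)) ≤ Real.exp (-(1 / (4 * r))) := by
        have := Real.add_one_le_exp (-(1 / (4 * (r : ℝ))))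
        linarith
      have h3 : 0 ≤ 1 - 1 / (4 * (r : ℝ)) := by
        rw [sub_nonneg, div_le_one (by positivity)]; linarith
      calc _ ≤ (Real.exp (-(1 / (4 * (r : ℝ))))) ^ t ^ 2 := pow_le_pow_left₀ h3 h2 _
        _ = _ := by rw [← Real.exp_nat_mul]; congr 1; push_cast; ring
    have h2 : ((r : ℝ) * k) ^ (r - 1) ≤ Real.exp (r * t) := by
      have hrr : ((r - 1 : ℕ) : ℝ) ≤ r := by exact_mod_cast Nat.sub_le _ _
      calc _ = Real.exp ((r - 1 : ℕ) * Real.log (r * k)) := by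
              rw [Real.exp_nat_mul, Real.exp_log hrk]
        _ ≤ _ := Real.exp_le_exp.2 (by
              calc _ ≤ ((r - 1 : ℕ) : ℝ) * t := by gcongr
                _ ≤ _ := by gcongr)
    calc _ ≤ Real.exp (-(t ^ 2 / (4 * r))) * Real.exp (r * t) := by gcongr
      _ = Real.exp (-(t ^ 2 / (4 * r)) + r * t) := by rw [Real.exp_add]
      _ < 1 := by
        rw [Real.exp_lt_one_iff]
        have : (r : ℝ) * t < t ^ 2 / (4 * r) := by
          rw [lt_div_iff₀ (by positivity)]
          nlinarith
        linarith
  · have hR : ((r : ℝ) - 1) * (k + D) + (k - η) + (p * (r * (1 + 3 * (t : ℝ) ^ 2 + t ^ 8) + 1) +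
        (r * (1 + 3 * (t : ℝ) ^ 2) + 1) + r * t ^ 8) < r * k := by
      have : ((r : ℝ) - 1) * D ≤ r * w := by
        have : ((r : ℝ) - 1) * D ≤ r * D := by gcongr; linarith
        have : (r : ℝ) * D ≤ r * w := by gcongr
        linarith
      linarith
    rw [← Nat.cast_lt (α := ℝ)]
    push_cast [hηk, show 1 ≤ r by omega]
    linarith
  · rw [← Nat.cast_le (α := ℝ)]
    push_cast [hηk, show 1 ≤ r by omega]
    have h3 : (t : ℝ) ^ 2 * (2 * r) ≤ w * t ^ 11 := by
      have a1 : (t : ℝ) ^ 3 ≤ t ^ 11 := pow_le_pow_right₀ (by linarith) (by norm_num)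
      have a2 : (t : ℝ) ^ 2 * (2 * r) ≤ t ^ 3 := by
        have : (t : ℝ) ^ 2 * (2 * r) ≤ t ^ 2 * t := by gcongr; linarith
        linarith
      have a3 : 1 * (t : ℝ) ^ 11 ≤ w * t ^ 11 := by gcongr
      linarith
    have h4 : (t : ℝ) ^ 2 ≤ w * t ^ 11 := by
      have a1 : (t : ℝ) ^ 2 ≤ t ^ 11 := pow_le_pow_right₀ (by linarith) (by norm_num)
      have a3 : 1 * (t : ℝ) ^ 11 ≤ w * t ^ 11 := by gcongr
      linarith
    have h5 : 0 ≤ ((r : ℝ) - 1) * D := mul_nonneg (by linarith) (Nat.cast_nonneg _)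
    have h6 : (r : ℝ) ≤ w * t ^ 11 := by linarith
    linarith
  · push_cast
    have : (t : ℝ) ^ 8 * (1 / t ^ 5) = t ^ 3 := by field_simp
    rw [this]
    have a2 : (t : ℝ) ^ 2 * 900 ≤ t ^ 2 * t := by gcongr
    have a3 : (1 : ℝ) ≤ t ^ 2 := one_le_pow₀ (by linarith)
    linarith
  · push_cast
    have : (k + D : ℝ) * (1 - 1 / t ^ 5) ≤ k + D - w * t ^ 11 := by
      have e : (k : ℝ) * (1 / t ^ 5) = w * t ^ 11 := by rw [hkw]; field_simp
      have : 0 ≤ (D : ℝ) * (1 / t ^ 5) := by positivity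
      linarith
    have hDw : (D : ℝ) ≤ w * t ^ 11 / 10 := by
      have : w * 2 ≤ w * r := by gcongr
      linarith
    linarith
  · rw [hkη]
    have h1 : ((k : ℝ) + D) * (1 / t ^ 5 + 1 / t ^ 5) ≤ 4 * (w * t ^ 11) := by
      have hDk : (D : ℝ) ≤ k := by
        have : (1 : ℝ) ≤ t ^ 16 := one_le_pow₀ (by linarith)
        rw [hkw]; linarith [le_mul_of_one_le_right hw0.le this]
      calc _ ≤ ((k : ℝ) + k) * (1 / t ^ 5 + 1 / t ^ 5) := by gcongr
        _ = _ := by rw [hkw]; field_simp; ring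
    have h2 : (w * t ^ 15 / 2) * (1 / t ^ 3) ≤ (k + D - (k - η)) * (1 / (t : ℝ) ^ 3) := by
      gcongr
      have : (0 : ℝ) ≤ D := Nat.cast_nonneg _
      linarith
    have h3 : (w * t ^ 15 / 2) * (1 / (t : ℝ) ^ 3) = w * t ^ 11 * t / 2 := by field_simp
    have h4 : w * (t : ℝ) ^ 11 * 900 ≤ w * t ^ 11 * t := by gcongr
    linarith
  · push_cast
    have hT : 100 * ((r : ℝ) + 1) ^ (r + 3) ≤ t := by exact_mod_cast ht
    have h1 : (r * (1 + 3 * (t : ℝ) ^ 2) + 1) * (2 * (r + 1 : ℝ) ^ (r + 1) * (1 / t ^ 3)) ≤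
        (5 * r * t ^ 2) * (2 * (r + 1 : ℝ) ^ (r + 1) * (1 / t ^ 3)) := by gcongr
    refine h1.trans ?_
    have h2 : (5 * r * (t : ℝ) ^ 2) * (2 * (r + 1 : ℝ) ^ (r + 1) * (1 / t ^ 3)) =
        10 * r * (r + 1 : ℝ) ^ (r + 1) / t := by field_simp; ring
    rw [h2, div_le_div_iff₀ hτp (by positivity), one_mul]
    refine le_trans ?_ hT
    have h3 : ((r : ℝ) + 1) ^ (r + 3) = (r + 1) ^ (r + 1) * ((r + 1) * (r + 1)) := by ring
    rw [h3]
    have h4 : 0 < ((r : ℝ) + 1) ^ (r + 1) := by positivity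
    have h5 : (20 * r * r : ℝ) ≤ 100 * ((r + 1) * (r + 1)) := by nlinarith
    calc 10 * (r : ℝ) * (r + 1) ^ (r + 1) * (2 * r) = (r + 1) ^ (r + 1) * (20 * r * r) := by ring
      _ ≤ (r + 1) ^ (r + 1) * (100 * ((r + 1) * (r + 1))) := by gcongr
      _ = _ := by ring
  · rw [← Nat.cast_lt (α := ℝ)]
    push_cast
    have h3 : w * (t : ℝ) ^ 2 ≤ w * t ^ 11 :=
      mul_le_mul_of_nonneg_left (pow_le_pow_right₀ (by linarith) (by norm_num)) hw0.le
    linarith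
  · push_cast
    have h1 : (4 * r * (r * (1 + 3 * (t : ℝ) ^ 2 + t ^ 8) + 1) ^ 2 * Real.log (r * k)) ≤
        4 * r * (3 * r * t ^ 8) ^ 2 * t := by
      have : 0 ≤ Real.log (r * k) := Real.log_nonneg (by
        have : (1 : ℝ) ≤ k := by exact_mod_cast hk0'
        exact one_le_mul_of_one_le_of_one_le (by linarith) this)
      gcongr
    have h2 : w * t / (4 * r) ≤ p / (4 * (r : ℝ)) := by
      gcongr
      have : w * t * 900 ≤ w * t ^ 2 := by
        have : w * t * 900 ≤ w * t * t := by gcongr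
        linarith
      have : w * 900 ≤ w * t := by gcongr
      linarith
    have h3 : 4 * r * (3 * r * (t : ℝ) ^ 8) ^ 2 * t ≤ w := by
      refine le_trans ?_ hwt
      have a1 : 4 * r * (3 * r * (t : ℝ) ^ 8) ^ 2 * t = 36 * (r * r * r) * t ^ 17 := by ring
      have a2 : 36 * ((r : ℝ) * r * r) ≤ t * t * t := by
        have b1 : (r : ℝ) * r * r ≤ (t / 100) * (t / 100) * (t / 100) := by
          gcongr <;> linarith
        have b2 : (0:ℝ) < t * t * t := by positivity
        linarith
      have a3 : (t : ℝ) ^ 20 ≤ t ^ 24 := pow_le_pow_right₀ (by linarith) (by norm_num)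
      have a4 : (0:ℝ) < t ^ 17 := by positivity
      calc _ = 36 * ((r : ℝ) * r * r) * t ^ 17 := a1
        _ ≤ (t * t * t) * t ^ 17 := by gcongr
        _ = (t : ℝ) ^ 20 := by ring
        _ ≤ _ := a3
    have h4 : 2 * w ≤ w * t / (4 * r) := by
      rw [le_div_iff₀ (by positivity)]
      have : w * (100 * r) ≤ w * t := by gcongr
      have : 0 ≤ w * r := by positivity
      linarith
    linarith

end Linking

section LinkingTests
variable {V : Type*} {G : SimpleGraph V} {r : ℕ} {A : Finset V}

/-- The number of common neighbours of `x` and `y` in `A`. -/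
noncomputable def conbrs (G : SimpleGraph V) (A : Finset V) (x y : V) : ℕ :=
  #{u ∈ A | G.Adj x u ∧ G.Adj y u}

theorem exists_mem_not_mem {S X : Finset V} (h : #X < #S) : ∃ z ∈ S, z ∉ X := by
  by_contra! hc
  exact absurd (card_le_card hc) (by omega)

theorem isLinked_of_three_le {k D h m : ℕ} (hr : 3 ≤ r) (hk : 1 ≤ k) (hA : #A = r * k)
    (hcod : ∀ v ∈ A, codeg G A v ≤ k + D)
    (hind : ∀ S ⊆ A, h ≤ #S → ∃ u ∈ S, ∃ v ∈ S, G.Adj u v)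
    (hm : (r - 3) * (k + D) + h + 2 * (k + D) + m ≤ r * k) : IsLinked G r A m := by
  intro x hx y hy _ X hX
  set S := {u ∈ A | G.Adj x u ∧ G.Adj y u} \ X with hS
  have h1 : #A ≤ #S + codeg G A x + codeg G A y + #X := by
    have : A ⊆ S ∪ {u ∈ A | ¬ G.Adj x u} ∪ {u ∈ A | ¬ G.Adj y u} ∪ X := by
      intro u hu
      simp only [hS, mem_union, mem_sdiff, mem_filter]
      tauto
    refine (card_le_card this).trans ((card_union_le _ _).trans ?_)
    refine Nat.add_le_add_right ((card_union_le _ _).trans ?_) _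
    exact Nat.add_le_add_right (card_union_le _ _) _
  have hx' := hcod x hx
  have hy' := hcod y hy
  obtain ⟨K, hKS, hK⟩ := exists_isNClique_add_two (i := r - 3) (by omega) hcod hind S
    (fun u hu => (mem_filter.1 (mem_sdiff.1 hu).1).1) (by omega)
  have hKa : ∀ u ∈ K, u ∈ A ∧ G.Adj x u ∧ G.Adj y u := fun u hu =>
    mem_filter.1 (mem_sdiff.1 (hKS hu)).1
  have e : r - 3 + 2 + 1 = r := by omega
  refine ⟨K, fun u hu => (hKa u hu).1, ?_, ?_, ?_, ?_⟩
  · exact disjoint_left.2 fun u hu => (mem_sdiff.1 (hKS hu)).2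
  · rw [hK.card_eq]; omega
  · exact hasFactor_of_isNClique (e ▸ hK.insert fun b hb => (hKa b hb).2.1)
  · exact hasFactor_of_isNClique (e ▸ hK.insert fun b hb => (hKa b hb).2.2)

theorem hasFactor_pair {a b : V} (h : G.Adj a b) : HasFactor G 2 {a, b} := by
  refine hasFactor_of_isNClique (K := {a, b}) ?_
  exact (SimpleGraph.isNClique_singleton (a := b).2 rfl).insert (by simpa using h)

theorem isLinked_two {M m : ℕ} (hm : m + 4 ≤ M)
    (h : ∀ x ∈ A, ∀ y ∈ A, x ≠ y → M ≤ conbrs G A x y ∨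
      M ≤ #{z ∈ A | M ≤ conbrs G A x z ∧ M ≤ conbrs G A z y}) : IsLinked G 2 A m := by
  intro x hx y hy hxy X hX
  rcases h x hx y hy hxy with h | h
  · obtain ⟨z, hz, hzX⟩ := exists_mem_not_mem (S := {u ∈ A | G.Adj x u ∧ G.Adj y u}) (X := X)
      (by rw [conbrs] at h; omega)
    obtain ⟨hzA, hz1, hz2⟩ := mem_filter.1 hz
    exact ⟨{z}, by simpa using hzA, by simpa using hzX, by simp, hasFactor_pair hz1,
      hasFactor_pair hz2⟩
  · have c1 : #(insert x (insert y X)) ≤ m + 2 := by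
      have := card_insert_le x (insert y X); have := card_insert_le y X; omega
    obtain ⟨z, hz, hzX⟩ := exists_mem_not_mem (lt_of_lt_of_le (by omega) h)
      (X := insert x (insert y X))
    obtain ⟨hzA, hz1, hz2⟩ := mem_filter.1 hz
    obtain ⟨a, ha, haX⟩ := exists_mem_not_mem (S := {u ∈ A | G.Adj x u ∧ G.Adj z u})
      (X := insert x (insert y X)) (by rw [conbrs] at hz1; omega)
    obtain ⟨haA, hxa, hza⟩ := mem_filter.1 ha
    have c2 := card_insert_le a (insert x (insert y X))
    obtain ⟨b, hb, hbX⟩ := exists_mem_not_mem (S := {u ∈ A | G.Adj z u ∧ G.Adj y u})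
      (X := insert a (insert x (insert y X))) (by rw [conbrs] at hz2; omega)
    obtain ⟨hbA, hzb, hyb⟩ := mem_filter.1 hb
    simp only [mem_insert, not_or] at hzX haX hbX
    have haz := hza.ne
    have hbz := hzb.ne
    refine ⟨{a, z, b}, ?_, ?_, ?_, ?_, ?_⟩
    · simp [insert_subset_iff, haA, hzA, hbA]
    · simp [hzX, haX, hbX]
    · exact (card_le_three (a := a) (b := z) (c := b)).trans (by norm_num)
    · have := (hasFactor_pair hxa).union (hasFactor_pair hzb) (by
        rw [disjoint_left]; intro u hu; simp only [mem_insert, mem_singleton] at hu ⊢; grind)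
      convert this using 1
      ext u; simp only [mem_insert, mem_singleton, mem_union]; tauto
    · have := (hasFactor_pair hyb).union (hasFactor_pair hza) (by
        rw [disjoint_left]; intro u hu; simp only [mem_insert, mem_singleton] at hu ⊢; grind)
      convert this using 1
      ext u; simp only [mem_insert, mem_singleton, mem_union]; tauto

end LinkingTests

section RandomSubset
variable {V : Type*} {r : ℕ} {A : Finset V}

theorem sum_powerset_union {β : Type*} [AddCommMonoid β] {Q A : Finset V} (h : Disjoint Q A)
    (f : Finset V → β) :
    ∑ B ∈ (Q ∪ A).powerset, f B = ∑ B₁ ∈ Q.powerset, ∑ B₂ ∈ A.powerset, f (B₁ ∪ B₂) := by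
  rw [← sum_product']
  refine sum_nbij' (fun B => (B ∩ Q, B \ Q)) (fun p => p.1 ∪ p.2) ?_ ?_ ?_ ?_ ?_
  · intro B hB
    rw [mem_powerset] at hB
    simp only [mem_product, mem_powerset]
    refine ⟨inter_subset_right, fun v hv => ?_⟩
    have := hB (mem_sdiff.1 hv).1
    exact (mem_union.1 this).resolve_left (mem_sdiff.1 hv).2
  · rintro ⟨B₁, B₂⟩ hB
    simp only [mem_product, mem_powerset] at hB ⊢
    exact union_subset_union hB.1 hB.2
  · intro B _
    ext v; simp only [mem_union, mem_inter, mem_sdiff]; tauto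
  · rintro ⟨B₁, B₂⟩ hB
    simp only [mem_product, mem_powerset] at hB
    have h2 := disjoint_left.1 (h.mono_right hB.2)
    refine Prod.ext ?_ ?_
    · ext v
      simp only [mem_union, mem_inter]
      have := @hB.1 v; have := @h2 v; tauto
    · ext v
      simp only [mem_union, mem_sdiff]
      have := @hB.1 v; have := @h2 v; tauto
  · intro B _
    congr 1
    ext v; simp only [mem_union, mem_inter, mem_sdiff]; tauto

theorem sum_pow_card_subset {q : ℕ} {a : ℝ} (P : Finset (Finset V)) :
    ∀ A : Finset V, (∀ Q ∈ P, Q ⊆ A ∧ #Q = q) → (P : Set (Finset V)).PairwiseDisjoint id →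
      ∑ B ∈ A.powerset, a ^ #{Q ∈ P | Q ⊆ B} = 2 ^ #A * (1 - (1 - a) / 2 ^ q) ^ #P := by
  induction P using Finset.induction_on with
  | empty => intro A _ _; simp
  | insert Q P hQ ih =>
    intro A hP hd
    obtain ⟨hQA, hQq⟩ := hP Q (mem_insert_self _ _)
    have hdis : ∀ R ∈ P, Disjoint Q R := fun R hR =>
      hd (mem_insert_self _ _) (mem_insert_of_mem hR) (by rintro rfl; exact hQ hR)
    have hPA : ∀ R ∈ P, R ⊆ A \ Q ∧ #R = q := fun R hR =>
      ⟨subset_sdiff.2 ⟨(hP R (mem_insert_of_mem hR)).1, (hdis R hR).symm⟩,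
        (hP R (mem_insert_of_mem hR)).2⟩
    have key := ih (A \ Q) hPA (hd.subset (by simp))
    have e : Q ∪ A \ Q = A := union_sdiff_of_subset hQA
    have hsum : ∑ B ∈ A.powerset, a ^ #{R ∈ insert Q P | R ⊆ B} =
        ∑ B₁ ∈ Q.powerset, ∑ B₂ ∈ (A \ Q).powerset,
          a ^ #{R ∈ insert Q P | R ⊆ B₁ ∪ B₂} := by
      conv_lhs => rw [← e]
      exact sum_powerset_union disjoint_sdiff _
    have hsplit : ∀ B₁ ∈ Q.powerset, ∑ B₂ ∈ (A \ Q).powerset,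
        a ^ #{R ∈ insert Q P | R ⊆ B₁ ∪ B₂} = (if B₁ = Q then a else 1) *
          ∑ B₂ ∈ (A \ Q).powerset, a ^ #{R ∈ P | R ⊆ B₂} := by
      intro B₁ hB₁
      rw [mem_powerset] at hB₁
      rw [mul_sum]
      refine sum_congr rfl fun B₂ hB₂ => ?_
      rw [mem_powerset] at hB₂
      have h1 : {R ∈ P | R ⊆ B₁ ∪ B₂} = {R ∈ P | R ⊆ B₂} := by
        refine filter_congr fun R hR => ⟨fun h v hv => ?_, fun h => h.trans subset_union_right⟩
        exact (mem_union.1 (h hv)).resolve_left fun hv1 =>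
          disjoint_left.1 (hdis R hR) (hB₁ hv1) hv
      have h2 : Q ⊆ B₁ ∪ B₂ ↔ B₁ = Q := by
        refine ⟨fun h => subset_antisymm hB₁ fun v hv => ?_, fun h => h ▸ subset_union_left⟩
        exact (mem_union.1 (h hv)).resolve_right fun hv2 => (mem_sdiff.1 (hB₂ hv2)).2 hv
      rw [filter_insert, h1]
      by_cases hc : B₁ = Q
      · rw [if_pos (h2.2 hc), if_pos hc, card_insert_of_notMem (by simp [hQ]), pow_succ, mul_comm]
      · rw [if_neg (fun h => hc (h2.1 h)), if_neg hc, one_mul]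
    have hif : ∑ B₁ ∈ Q.powerset, (if B₁ = Q then a else 1) = 2 ^ q * (1 - (1 - a) / 2 ^ q) := by
      have h3 : ∀ B₁ ∈ Q.powerset, (if B₁ = Q then a else 1) =
          1 - (if B₁ = Q then 1 - a else 0) := by
        intro B₁ _; split_ifs <;> ring
      rw [sum_congr rfl h3, sum_sub_distrib, sum_ite_eq' , if_pos (by simp)]
      simp only [sum_const, card_powerset, hQq, nsmul_eq_mul, mul_one]
      push_cast
      field_simp
    rw [hsum, sum_congr rfl hsplit, ← sum_mul, hif, key, card_insert_of_notMem hQ, pow_succ]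
    have h4 : #A = q + #(A \ Q) := by
      rw [card_sdiff_of_subset hQA, ← hQq]
      have := card_le_card hQA
      omega
    rw [h4, pow_add]
    ring

theorem card_filter_card_subset_le {q : ℕ} {N d : ℝ} {P : Finset (Finset V)}
    (hP : ∀ Q ∈ P, Q ⊆ A ∧ #Q = q) (hd : (P : Set (Finset V)).PairwiseDisjoint id)
    (hN : #P ≤ N) (hd0 : 0 < d) (hdN : d ≤ 2 * N) :
    (#{B ∈ A.powerset | (#{Q ∈ P | Q ⊆ B} : ℝ) + d ≤ #P / 2 ^ q} : ℝ) ≤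
      2 ^ #A * Real.exp (-(d ^ 2 / (4 * N))) := by
  have hN0 : 0 < N := by linarith
  set μ : ℝ := #P / 2 ^ q with hμ
  have hμ0 : 0 ≤ μ := by positivity
  have hμN : μ ≤ N := by
    refine le_trans (div_le_self (Nat.cast_nonneg _) (one_le_pow₀ (by norm_num))) hN
  set l : ℝ := d / (2 * N) with hl
  have hl0 : 0 < l := by positivity
  have hl1 : l ≤ 1 := by rw [hl, div_le_one (by positivity)]; exact hdN
  set a := Real.exp (-l) with ha
  have ha1 : a ≤ 1 - l + l ^ 2 := exp_neg_le (by rw [abs_of_pos hl0]; exact hl1)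
  have ha0 : 0 < a := Real.exp_pos _
  have ha2 : a ≤ 1 := Real.exp_le_one_iff.2 (by linarith)
  have key := sum_pow_card_subset (a := a) P A hP hd
  set T := {B ∈ A.powerset | (#{Q ∈ P | Q ⊆ B} : ℝ) + d ≤ μ} with hT
  have h1 : #T * Real.exp (-(l * (μ - d))) ≤ ∑ B ∈ A.powerset, a ^ #{Q ∈ P | Q ⊆ B} := by
    rw [← nsmul_eq_mul]
    refine (card_nsmul_le_sum T (fun B => a ^ #{Q ∈ P | Q ⊆ B}) _ fun B hB => ?_).trans
      (sum_le_sum_of_subset_of_nonneg (filter_subset _ _) fun _ _ _ => by positivity)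
    have h2 := (mem_filter.1 hB).2
    rw [ha, ← Real.exp_nat_mul]
    refine Real.exp_le_exp.2 ?_
    nlinarith
  have h2 : (1 - (1 - a) / 2 ^ q) ^ #P ≤ Real.exp (-(μ * (1 - a))) := by
    have h3 : 1 - (1 - a) / 2 ^ q ≤ Real.exp (-((1 - a) / 2 ^ q)) := by
      have := Real.add_one_le_exp (-((1 - a) / 2 ^ q)); linarith
    have h4 : 0 ≤ 1 - (1 - a) / 2 ^ q := by
      have : (1 - a) / 2 ^ q ≤ 1 - a :=
        div_le_self (by linarith) (one_le_pow₀ (by norm_num))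
      linarith
    refine (pow_le_pow_left₀ h4 h3 _).trans (le_of_eq ?_)
    rw [← Real.exp_nat_mul]; congr 1; rw [hμ]; ring
  have h5 : (#T : ℝ) ≤ 2 ^ #A * Real.exp (-(μ * (1 - a))) * Real.exp (l * (μ - d)) := by
    have h6 : #T * Real.exp (-(l * (μ - d))) ≤ 2 ^ #A * Real.exp (-(μ * (1 - a))) := by
      rw [key] at h1
      exact h1.trans (by gcongr)
    calc (#T : ℝ) = #T * Real.exp (-(l * (μ - d))) * Real.exp (l * (μ - d)) := by
          rw [mul_assoc, ← Real.exp_add]; simp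
      _ ≤ _ := by gcongr
  refine h5.trans ?_
  rw [mul_assoc, ← Real.exp_add]
  gcongr
  have h7 : μ * (l - l ^ 2) ≤ μ * (1 - a) := mul_le_mul_of_nonneg_left (by linarith) hμ0
  have h8 : μ * l ^ 2 ≤ N * l ^ 2 := by gcongr
  have h9 : N * l ^ 2 - l * d = -(d ^ 2 / (4 * N)) := by rw [hl]; field_simp; ring
  linarith

theorem two_pow_le_card_dvd (hr : 1 ≤ r) (hA : r ≤ #A) :
    2 ^ #A ≤ 2 ^ r * #{B ∈ A.powerset | r ∣ #B} := by
  obtain ⟨R, hRA, hR⟩ := exists_subset_card_eq hA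
  have hex : ∀ B : Finset V, ∃ R' ⊆ R, #R' = (r - #B % r) := fun B =>
    exists_subset_card_eq (by omega)
  choose g hg hgc using hex
  have hle : #(A \ R).powerset ≤ #{B ∈ A.powerset | r ∣ #B} := by
    refine card_le_card_of_injOn (fun B => B ∪ g B) ?_ ?_
    · intro B hB
      rw [mem_coe, mem_powerset] at hB
      have hBR : Disjoint B (g B) :=
        disjoint_of_subset_left hB (disjoint_of_subset_right (hg B) sdiff_disjoint)
      rw [mem_coe, mem_filter, mem_powerset]
      refine ⟨union_subset (hB.trans sdiff_subset) ((hg B).trans hRA), ?_⟩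
      rw [card_union_of_disjoint hBR, hgc]
      have := Nat.mod_lt #B hr
      have h2 := Nat.div_add_mod #B r
      refine ⟨#B / r + 1, ?_⟩
      rw [mul_add]
      omega
    · intro B hB B' hB' he
      rw [mem_coe, mem_powerset] at hB hB'
      have h1 : ∀ B : Finset V, B ⊆ A \ R → (B ∪ g B) \ R = B := by
        intro B hB
        ext v
        simp only [mem_sdiff, mem_union]
        have := @hB v; have := @hg B v
        simp only [mem_sdiff] at *
        tauto
      rw [← h1 B hB, ← h1 B' hB']
      exact congrArg (· \ R) he
  rw [card_powerset, card_sdiff_of_subset hRA, hR] at hle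
  calc 2 ^ #A = 2 ^ r * 2 ^ (#A - r) := by rw [← pow_add]; congr 1; omega
    _ ≤ _ := by gcongr

end RandomSubset

section Halves
variable {V : Type*} {r : ℕ} {A : Finset V}

theorem card_filter_sdiff (p : Finset V → Prop) :
    #{B ∈ A.powerset | p (A \ B)} = #{B ∈ A.powerset | p B} := by
  refine card_nbij' (A \ ·) (A \ ·) ?_ ?_ ?_ ?_
  · intro B hB
    rw [mem_coe, mem_filter, mem_powerset] at hB ⊢
    exact ⟨sdiff_subset, hB.2⟩
  · intro B hB
    rw [mem_coe, mem_filter, mem_powerset] at hB ⊢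
    exact ⟨sdiff_subset, by simpa only [Finset.sdiff_sdiff_eq_self hB.1] using hB.2⟩
  · intro B hB
    rw [mem_coe, mem_filter, mem_powerset] at hB
    exact Finset.sdiff_sdiff_eq_self hB.1
  · intro B hB
    rw [mem_coe, mem_filter, mem_powerset] at hB
    exact Finset.sdiff_sdiff_eq_self hB.1

theorem card_filter_card_inter_le {d : ℕ} {S : Finset V} (hS : S ⊆ A) (hd0 : 0 < d)
    (hdA : d ≤ #A) :
    (#{B ∈ A.powerset | 2 * #(S ∩ B) + 2 * d ≤ #S} : ℝ) ≤
      2 ^ #A * Real.exp (-((d : ℝ) ^ 2 / (4 * #A))) := by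
  have hd : ((S.image ({·}) : Finset (Finset V)) : Set (Finset V)).PairwiseDisjoint id := by
    intro X hX Y hY hXY
    simp only [coe_image, Set.mem_image, mem_coe] at hX hY
    obtain ⟨x, hx, rfl⟩ := hX
    obtain ⟨y, hy, rfl⟩ := hY
    simp only [Function.onFun, id, disjoint_singleton]
    rintro rfl; exact hXY rfl
  have hc : #(S.image ({·} : V → Finset V)) = #S :=
    card_image_of_injective _ singleton_injective
  have hdA' : (d : ℝ) ≤ #A := by exact_mod_cast hdA
  have hd0' : (0 : ℝ) < d := by exact_mod_cast hd0
  have h := card_filter_card_subset_le (A := A) (q := 1) (N := #A) (d := d)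
    (P := S.image ({·})) ?_ hd ?_ hd0' (by linarith)
  · refine le_trans ?_ h
    rw [Nat.cast_le]
    refine card_le_card fun B hB => ?_
    rw [mem_filter] at hB ⊢
    refine ⟨hB.1, ?_⟩
    have e : #{Q ∈ S.image ({·} : V → Finset V) | Q ⊆ B} = #(S ∩ B) := by
      rw [← card_image_of_injective (S ∩ B) (singleton_injective (α := V))]
      congr 1
      ext Q
      simp only [mem_filter, mem_image, mem_inter]
      constructor
      · rintro ⟨⟨x, hx, rfl⟩, hxB⟩
        exact ⟨x, ⟨hx, singleton_subset_iff.1 hxB⟩, rfl⟩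
      · rintro ⟨x, ⟨hx, hxB⟩, rfl⟩
        exact ⟨⟨x, hx, rfl⟩, singleton_subset_iff.2 hxB⟩
    rw [e, hc, pow_one, le_div_iff₀ (by norm_num)]
    have : (2 * #(S ∩ B) + 2 * d : ℝ) ≤ #S := by exact_mod_cast hB.2
    linarith
  · intro Q hQ
    obtain ⟨x, hx, rfl⟩ := mem_image.1 hQ
    exact ⟨singleton_subset_iff.2 (hS hx), card_singleton _⟩
  · rw [hc]; exact_mod_cast card_le_card hS

theorem card_filter_card_pairs_le {d : ℕ} {P : Finset (Finset V)} (hP : ∀ Q ∈ P, Q ⊆ A ∧ #Q = 2)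
    (hPd : (P : Set (Finset V)).PairwiseDisjoint id) (hd0 : 0 < d) (hdA : d ≤ #A) :
    (#{B ∈ A.powerset | 4 * #{Q ∈ P | Q ⊆ B} + 4 * d ≤ #P} : ℝ) ≤
      2 ^ #A * Real.exp (-((d : ℝ) ^ 2 / (4 * #A))) := by
  have hdA' : (d : ℝ) ≤ #A := by exact_mod_cast hdA
  have hd0' : (0 : ℝ) < d := by exact_mod_cast hd0
  have hc : #P ≤ #A := by
    have h1 : #(P.biUnion id) = 2 * #P := by
      rw [card_biUnion hPd, mul_comm, ← smul_eq_mul]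
      exact sum_const_nat fun Q hQ => (hP Q hQ).2
    have h2 : #(P.biUnion id) ≤ #A := card_le_card (biUnion_subset.2 fun Q hQ => (hP Q hQ).1)
    omega
  have h := card_filter_card_subset_le (A := A) (q := 2) (N := #A) (d := d)
    (P := P) hP hPd (by exact_mod_cast hc) hd0' (by linarith)
  refine le_trans ?_ h
  rw [Nat.cast_le]
  refine card_le_card fun B hB => ?_
  rw [mem_filter] at hB ⊢
  refine ⟨hB.1, ?_⟩
  rw [le_div_iff₀ (by norm_num)]
  have : (4 * #{Q ∈ P | Q ⊆ B} + 4 * d : ℝ) ≤ #P := by exact_mod_cast hB.2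
  linarith

/-- The subset `B` contains, up to an error of `d`, its expected share of every set in `𝒮` and of
every family of disjoint pairs in `𝓜`. -/
def IsTypical (𝒮 : Finset (Finset V)) (𝓜 : Finset (Finset (Finset V))) (d : ℕ) (B : Finset V) :
    Prop :=
  (∀ S ∈ 𝒮, #S < 2 * #(S ∩ B) + 2 * d) ∧ ∀ P ∈ 𝓜, #P < 4 * #{Q ∈ P | Q ⊆ B} + 4 * d

theorem card_not_isTypical_le {𝒮 : Finset (Finset V)} {𝓜 : Finset (Finset (Finset V))} {d : ℕ}
    (h𝒮 : ∀ S ∈ 𝒮, S ⊆ A) (h𝓜 : ∀ P ∈ 𝓜, ∀ Q ∈ P, Q ⊆ A ∧ #Q = 2)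
    (h𝓜d : ∀ P ∈ 𝓜, (P : Set (Finset V)).PairwiseDisjoint id) (hd0 : 0 < d) (hdA : d ≤ #A) :
    (#{B ∈ A.powerset | ¬ IsTypical 𝒮 𝓜 d B} : ℝ) ≤
      (#𝒮 + #𝓜) * (2 ^ #A * Real.exp (-((d : ℝ) ^ 2 / (4 * #A)))) := by
  have hsub : {B ∈ A.powerset | ¬ IsTypical 𝒮 𝓜 d B} ⊆
      (𝒮.biUnion fun S => {B ∈ A.powerset | 2 * #(S ∩ B) + 2 * d ≤ #S}) ∪
      (𝓜.biUnion fun P => {B ∈ A.powerset | 4 * #{Q ∈ P | Q ⊆ B} + 4 * d ≤ #P}) := by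
    intro B hB
    rw [mem_filter] at hB
    obtain ⟨hBA, hB⟩ := hB
    simp only [IsTypical, not_and_or, not_forall, not_lt] at hB
    simp only [mem_union, mem_biUnion, mem_filter]
    rcases hB with ⟨S, hS, h⟩ | ⟨P, hP, h⟩
    · exact Or.inl ⟨S, hS, hBA, h⟩
    · exact Or.inr ⟨P, hP, hBA, h⟩
  have h1 := (card_le_card hsub).trans (card_union_le _ _)
  have h2 : (#(𝒮.biUnion fun S => {B ∈ A.powerset | 2 * #(S ∩ B) + 2 * d ≤ #S}) : ℝ) ≤
      #𝒮 * (2 ^ #A * Real.exp (-((d : ℝ) ^ 2 / (4 * #A)))) := by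
    rw [← nsmul_eq_mul]
    refine (Nat.cast_le.2 card_biUnion_le).trans ?_
    rw [Nat.cast_sum]
    refine sum_le_card_nsmul _ _ _ fun S hS => ?_
    exact card_filter_card_inter_le (h𝒮 S hS) hd0 hdA
  have h3 : (#(𝓜.biUnion fun P => {B ∈ A.powerset | 4 * #{Q ∈ P | Q ⊆ B} + 4 * d ≤ #P}) : ℝ) ≤
      #𝓜 * (2 ^ #A * Real.exp (-((d : ℝ) ^ 2 / (4 * #A)))) := by
    rw [← nsmul_eq_mul]
    refine (Nat.cast_le.2 card_biUnion_le).trans ?_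
    rw [Nat.cast_sum]
    refine sum_le_card_nsmul _ _ _ fun P hP => ?_
    exact card_filter_card_pairs_le (h𝓜 P hP) (h𝓜d P hP) hd0 hdA
  have h4 := Nat.cast_le (α := ℝ).2 h1
  push_cast at h4
  linarith

theorem two_pow_le_card_isTypical {𝒮 : Finset (Finset V)} {𝓜 : Finset (Finset (Finset V))} {d : ℕ}
    (h𝒮 : ∀ S ∈ 𝒮, S ⊆ A) (h𝓜 : ∀ P ∈ 𝓜, ∀ Q ∈ P, Q ⊆ A ∧ #Q = 2)
    (h𝓜d : ∀ P ∈ 𝓜, (P : Set (Finset V)).PairwiseDisjoint id) (hd0 : 0 < d) (hdA : d ≤ #A)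
    (hr : 1 ≤ r) (hA : r ≤ #A)
    (hT : 2 ^ (r + 2) * (#𝒮 + #𝓜 : ℝ) * Real.exp (-((d : ℝ) ^ 2 / (4 * #A))) ≤ 1) :
    2 ^ #A ≤ 2 ^ (r + 1) *
      #{B ∈ A.powerset | r ∣ #B ∧ IsTypical 𝒮 𝓜 d B ∧ IsTypical 𝒮 𝓜 d (A \ B)} := by
  have h1 := card_not_isTypical_le h𝒮 h𝓜 h𝓜d hd0 hdA
  have h2 := two_pow_le_card_dvd hr hA
  have hsub : {B ∈ A.powerset | r ∣ #B} ⊆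
      {B ∈ A.powerset | r ∣ #B ∧ IsTypical 𝒮 𝓜 d B ∧ IsTypical 𝒮 𝓜 d (A \ B)} ∪
      ({B ∈ A.powerset | ¬ IsTypical 𝒮 𝓜 d B} ∪ {B ∈ A.powerset | ¬ IsTypical 𝒮 𝓜 d (A \ B)}) := by
    intro B hB
    simp only [mem_union, mem_filter] at hB ⊢
    tauto
  have h3 := (card_le_card hsub).trans ((card_union_le _ _).trans
    (Nat.add_le_add_left (card_union_le _ _) _))
  have he : #{B ∈ A.powerset | ¬ IsTypical 𝒮 𝓜 d (A \ B)} =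
      #{B ∈ A.powerset | ¬ IsTypical 𝒮 𝓜 d B} := by
    convert card_filter_sdiff (A := A) (fun B => ¬ IsTypical 𝒮 𝓜 d B)
  rw [he] at h3
  set g := #{B ∈ A.powerset | r ∣ #B ∧ IsTypical 𝒮 𝓜 d B ∧ IsTypical 𝒮 𝓜 d (A \ B)}
  set b := #{B ∈ A.powerset | ¬ IsTypical 𝒮 𝓜 d B}
  set c := #{B ∈ A.powerset | r ∣ #B}
  have h4 : (2 : ℝ) ^ (r + 2) * b ≤ 2 ^ #A := by
    calc (2 : ℝ) ^ (r + 2) * b ≤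
        2 ^ (r + 2) * ((#𝒮 + #𝓜) * (2 ^ #A * Real.exp (-((d : ℝ) ^ 2 / (4 * #A))))) := by gcongr
      _ = 2 ^ #A * (2 ^ (r + 2) * (#𝒮 + #𝓜 : ℝ) * Real.exp (-((d : ℝ) ^ 2 / (4 * #A)))) := by ring
      _ ≤ 2 ^ #A * 1 := by gcongr
      _ = _ := mul_one _
  have h5 : 2 ^ (r + 2) * b ≤ 2 ^ #A := by exact_mod_cast h4
  have h6 : 2 ^ r * c ≤ 2 ^ r * (g + (b + b)) := Nat.mul_le_mul_left _ h3
  rw [pow_add] at h5 ⊢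
  nlinarith

end Halves

section Recursion
variable {V : Type*} {G : SimpleGraph V} {r : ℕ} {A : Finset V}

theorem sum_card_factors_mul_le {k : ℕ} (hr : 1 ≤ r) (hA : #A = r * k) {𝓑 : Finset (Finset V)}
    (h𝓑 : 𝓑 ⊆ A.powerset) :
    ∑ B ∈ 𝓑, #(factors G r B) * #(factors G r (A \ B)) ≤ 2 ^ k * #(factors G r A) := by
  have h1 : ∑ B ∈ 𝓑, #(factors G r B) * #(factors G r (A \ B)) =
      #(𝓑.sigma fun B => factors G r B ×ˢ factors G r (A \ B)) := by
    rw [card_sigma]; exact sum_congr rfl fun B _ => (card_product _ _).symm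
  have h2 : #((factors G r A).sigma fun F => F.powerset) = 2 ^ k * #(factors G r A) := by
    rw [card_sigma, mul_comm, ← smul_eq_mul]
    refine sum_const_nat fun F hF => ?_
    have := (mem_factors.1 hF).card_eq
    rw [card_powerset, Nat.eq_of_mul_eq_mul_left hr (hA.symm.trans this)]
  rw [h1, ← h2]
  have hinv : ∀ B F₁ F₂, IsFactor G r B F₁ → IsFactor G r (A \ B) F₂ → (F₁ ∪ F₂) \ F₁ = F₂ := by
    intro B F₁ F₂ hF₁ hF₂
    rw [union_sdiff_left, Finset.sdiff_eq_self_iff_disjoint, disjoint_left]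
    intro K hK2 hK1
    have hKc := (hF₁.1 K hK1).card_eq
    obtain ⟨v, hv⟩ : K.Nonempty := card_pos.1 (by omega)
    exact (mem_sdiff.1 (hF₂.subset hK2 hv)).2 (hF₁.subset hK1 hv)
  refine card_le_card_of_injOn (fun p => ⟨p.2.1 ∪ p.2.2, p.2.1⟩) ?_ ?_
  · rintro ⟨B, F₁, F₂⟩ hp
    simp only [coe_sigma, Set.mem_sigma_iff, mem_coe, mem_product, mem_factors] at hp
    obtain ⟨hB, hF₁, hF₂⟩ := hp
    simp only [coe_sigma, Set.mem_sigma_iff, mem_coe, mem_factors, mem_powerset]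
    refine ⟨?_, subset_union_left⟩
    have := hF₁.union hF₂ disjoint_sdiff
    rwa [union_sdiff_of_subset (mem_powerset.1 (h𝓑 hB))] at this
  · rintro ⟨B, F₁, F₂⟩ hp ⟨B', F₁', F₂'⟩ hp' he
    simp only [coe_sigma, Set.mem_sigma_iff, mem_coe, mem_product, mem_factors] at hp hp'
    simp only [Sigma.mk.injEq, heq_eq_eq] at he
    obtain ⟨he, rfl⟩ := he
    have hBB : B = B' := hp.2.1.2.2.symm.trans hp'.2.1.2.2
    subst hBB
    have : F₂ = F₂' := by
      rw [← hinv B F₁ F₂ hp.2.1 hp.2.2, ← hinv B F₁ F₂' hp'.2.1 hp'.2.2, he]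
    rw [this]

theorem div_two_pow_le {a b : ℕ} (ha : 1 ≤ a) (hb : 1 ≤ b) :
    (((a + b : ℕ) : ℝ) / 2) ^ (a + b) ≤ (a : ℝ) ^ a * (b : ℝ) ^ b := by
  have ha0 : (0 : ℝ) < a := by exact_mod_cast ha
  have hb0 : (0 : ℝ) < b := by exact_mod_cast hb
  have h := Real.convexOn_mul_log.2 (Set.mem_Ici.2 ha0.le) (Set.mem_Ici.2 hb0.le)
    (show (0 : ℝ) ≤ 1 / 2 by norm_num) (show (0 : ℝ) ≤ 1 / 2 by norm_num) (by norm_num)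
  simp only [smul_eq_mul] at h
  have hc : (1 / 2 * (a : ℝ) + 1 / 2 * b) = ((a + b : ℕ) : ℝ) / 2 := by push_cast; ring
  rw [hc] at h
  have hs : (0 : ℝ) < ((a + b : ℕ) : ℝ) / 2 := by push_cast; positivity
  have e : ∀ (n : ℕ) (x : ℝ), 0 < x → x ^ n = Real.exp (n * Real.log x) := by
    intro n x hx; rw [Real.exp_nat_mul, Real.exp_log hx]
  rw [e _ _ hs, e _ _ ha0, e _ _ hb0, ← Real.exp_add]
  refine Real.exp_le_exp.2 ?_
  push_cast at h ⊢
  linarith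

theorem le_card_factors_of_halves {k : ℕ} {C : ℝ} (hr : 1 ≤ r) (hA : #A = r * k)
    (hC : 0 < C)
    {𝓑 : Finset (Finset V)} (h𝓑A : 𝓑 ⊆ A.powerset) (h𝓑 : 2 ^ #A ≤ 2 ^ (r + 1) * #𝓑)
    (h : ∀ B ∈ 𝓑, ∃ k₁ k₂ : ℕ, 1 ≤ k₁ ∧ 1 ≤ k₂ ∧ k₁ + k₂ = k ∧
      2 ^ (r + 1) * ((k₁ : ℝ) / C) ^ ((r - 1) * k₁) ≤ #(factors G r B) ∧
      2 ^ (r + 1) * ((k₂ : ℝ) / C) ^ ((r - 1) * k₂) ≤ #(factors G r (A \ B))) :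
    2 ^ (r + 1) * ((k : ℝ) / C) ^ ((r - 1) * k) ≤ #(factors G r A) := by
  have h1 : ∀ B ∈ 𝓑, 2 ^ (r + 1) * (2 ^ (r + 1) * ((k : ℝ) / 2 / C) ^ ((r - 1) * k)) ≤
      #(factors G r B) * #(factors G r (A \ B)) := by
    intro B hB
    obtain ⟨k₁, k₂, h1, h2, rfl, h3, h4⟩ := h B hB
    refine le_trans ?_ (mul_le_mul h3 h4 (by positivity) (by positivity))
    have h5 : ((((k₁ + k₂ : ℕ) : ℝ) / 2) / C) ^ (k₁ + k₂) ≤ (k₁ / C) ^ k₁ * (k₂ / C) ^ k₂ := by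
      rw [div_pow _ C, div_pow _ C, div_pow _ C, div_mul_div_comm, ← pow_add]
      gcongr
      exact div_two_pow_le h1 h2
    have h6 : ((((k₁ + k₂ : ℕ) : ℝ) / 2) / C) ^ ((r - 1) * (k₁ + k₂)) ≤
        (k₁ / C) ^ ((r - 1) * k₁) * (k₂ / C) ^ ((r - 1) * k₂) := by
      rw [mul_comm (r - 1), mul_comm (r - 1), mul_comm (r - 1), pow_mul, pow_mul, pow_mul,
        ← mul_pow]
      exact pow_le_pow_left₀ (by positivity) h5 _
    calc _ ≤ 2 ^ (r + 1) *
          (2 ^ (r + 1) * ((k₁ / C) ^ ((r - 1) * k₁) * (k₂ / C) ^ ((r - 1) * k₂))) := by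
            gcongr
      _ = _ := by ring
  have h2 := sum_card_factors_mul_le (G := G) hr hA h𝓑A
  have h3 : (∑ B ∈ 𝓑, (#(factors G r B) : ℝ) * #(factors G r (A \ B))) ≤
      2 ^ k * #(factors G r A) := by exact_mod_cast h2
  have h4 := (card_nsmul_le_sum 𝓑 _ _ h1).trans h3
  rw [nsmul_eq_mul] at h4
  have h5 : (2 : ℝ) ^ #A ≤ 2 ^ (r + 1) * #𝓑 := by exact_mod_cast h𝓑
  have h6 : (2 : ℝ) ^ #A * (2 ^ (r + 1) * ((k : ℝ) / 2 / C) ^ ((r - 1) * k)) ≤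
      2 ^ k * #(factors G r A) := by
    refine le_trans ?_ h4
    calc _ ≤ (2 ^ (r + 1) * #𝓑) * (2 ^ (r + 1) * ((k : ℝ) / 2 / C) ^ ((r - 1) * k)) := by gcongr
      _ = _ := by ring
  have h7 : ((k : ℝ) / 2 / C) ^ ((r - 1) * k) * 2 ^ ((r - 1) * k) = (k / C) ^ ((r - 1) * k) := by
    rw [← mul_pow]; congr 1; field_simp
  have h8 : #A = k + (r - 1) * k := by
    rw [hA]; obtain ⟨s, rfl⟩ : ∃ s, r = s + 1 := ⟨r - 1, by omega⟩
    simp; ring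
  rw [h8, pow_add] at h6
  have h9 : (2 : ℝ) ^ k * (2 ^ (r + 1) * ((k : ℝ) / C) ^ ((r - 1) * k)) ≤
      2 ^ k * #(factors G r A) := by
    rw [← h7]
    linarith
  exact le_of_mul_le_mul_left h9 (by positivity)

end Recursion

section Extension
variable {V : Type*} {G : SimpleGraph V} {r : ℕ} {R I : Finset V} {F' : Finset (Finset V)}

/-- The `K_{r+1}`-factors of `R ∪ I` each of whose cliques meets `R` in a member of `F'`. -/
noncomputable def extensions (G : SimpleGraph V) (r : ℕ) (R I : Finset V)
    (F' : Finset (Finset V)) : Finset (Finset (Finset V)) :=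
  {F ∈ factors G (r + 1) (R ∪ I) | ∀ L ∈ F, L ∩ R ∈ F'}

theorem exists_mem_extensions_of_injective (hF' : IsFactor G r R F') (hd : Disjoint R I)
    (hc : #I = #F') (f : F' → V) (hf : Function.Injective f)
    (hfI : ∀ K, f K ∈ I ∧ ∀ u ∈ K.1, G.Adj (f K) u) : (extensions G r R I F').Nonempty := by
  set F := univ.image fun K : F' => insert (f K) K.1 with hF
  have hKR : ∀ K : F', K.1 ⊆ R := fun K => hF'.subset K.2
  have hfR : ∀ K : F', f K ∉ R := fun K => disjoint_right.1 hd (hfI K).1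
  refine ⟨F, mem_filter.2 ⟨mem_factors.2 ⟨?_, ?_, ?_⟩, ?_⟩⟩
  · intro L hL
    obtain ⟨K, _, rfl⟩ := mem_image.1 hL
    exact (hF'.1 K.1 K.2).insert (hfI K).2
  · intro L hL M hM hLM
    obtain ⟨K, _, rfl⟩ := mem_image.1 (mem_coe.1 hL)
    obtain ⟨K', _, rfl⟩ := mem_image.1 (mem_coe.1 hM)
    have hne : K ≠ K' := by rintro rfl; exact hLM rfl
    have hdKK := disjoint_left.1 (hF'.2.1 K.2 K'.2 fun h => hne (Subtype.ext h))
    simp only [Function.onFun, id]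
    rw [disjoint_left]
    intro u hu hu'
    rcases mem_insert.1 hu with h | h <;> rcases mem_insert.1 hu' with h' | h'
    · exact hne (hf (h.symm.trans h'))
    · exact hfR K (h ▸ hKR K' h')
    · exact hfR K' (h' ▸ hKR K h)
    · exact hdKK h h'
  · have him : univ.image f = I := by
      refine eq_of_subset_of_card_le (fun v hv => ?_) ?_
      · obtain ⟨K, _, rfl⟩ := mem_image.1 hv; exact (hfI K).1
      · rw [card_image_of_injective _ hf, hc]; simp
    rw [← him, ← hF'.2.2]
    ext u
    simp only [hF, mem_biUnion, mem_image, mem_union, id, mem_univ, true_and]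
    constructor
    · rintro ⟨_, ⟨K, rfl⟩, hu⟩
      rcases mem_insert.1 hu with h | h
      · exact Or.inr ⟨K, h.symm⟩
      · exact Or.inl ⟨K.1, K.2, h⟩
    · rintro (⟨K, hK, h⟩ | ⟨K, rfl⟩)
      · exact ⟨_, ⟨⟨K, hK⟩, rfl⟩, mem_insert_of_mem h⟩
      · exact ⟨_, ⟨K, rfl⟩, mem_insert_self _ _⟩
  · intro L hL
    obtain ⟨K, _, rfl⟩ := mem_image.1 hL
    rw [insert_inter_of_notMem (hfR K), inter_eq_left.2 (hKR K)]
    exact K.2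

theorem extensions_nonempty {d : ℕ} (hF' : IsFactor G r R F') (hd : Disjoint R I) (hc : #I = #F')
    (h1 : ∀ K ∈ F', #{v ∈ I | ¬ ∀ u ∈ K, G.Adj v u} ≤ d)
    (h2 : ∀ v ∈ I, #{K ∈ F' | ¬ ∀ u ∈ K, G.Adj v u} ≤ d) (hm : 2 * d ≤ #I) :
    (extensions G r R I F').Nonempty := by
  have hall := (Finset.all_card_le_biUnion_card_iff_exists_injective
    (fun K : F' => {v ∈ I | ∀ u ∈ K.1, G.Adj v u})).1 ?_
  · obtain ⟨f, hf, hfm⟩ := hall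
    exact exists_mem_extensions_of_injective hF' hd hc f hf fun K => mem_filter.1 (hfm K)
  · intro s
    set N := s.biUnion fun K : F' => {v ∈ I | ∀ u ∈ K.1, G.Adj v u} with hN
    have hNI : N ⊆ I := biUnion_subset.2 fun K _ => filter_subset _ _
    have hs : #s ≤ #F' := by
      calc #s ≤ #(univ : Finset F') := card_le_univ s
        _ = #F' := by simp
    rcases s.eq_empty_or_nonempty with rfl | ⟨K, hK⟩
    · simp
    have h3 : #I ≤ #N + d := by
      have h4 := card_filter_add_card_filter_not (s := I) (fun v => ∀ u ∈ K.1, G.Adj v u)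
      have h5 : #{v ∈ I | ∀ u ∈ K.1, G.Adj v u} ≤ #N :=
        card_le_card (subset_biUnion_of_mem (fun K : F' => {v ∈ I | ∀ u ∈ K.1, G.Adj v u}) hK)
      have := h1 K.1 K.2
      omega
    by_cases hNe : N = I
    · rw [hNe]; omega
    · obtain ⟨v, hvI, hvN⟩ := exists_of_ssubset (hNI.ssubset_of_ne hNe)
      have h6 : s.image Subtype.val ⊆ {K ∈ F' | ¬ ∀ u ∈ K, G.Adj v u} := by
        intro L hL
        obtain ⟨L, hLs, rfl⟩ := mem_image.1 hL
        refine mem_filter.2 ⟨L.2, fun h => hvN ?_⟩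
        exact mem_biUnion.2 ⟨L, hLs, mem_filter.2 ⟨hvI, h⟩⟩
      have h7 := card_le_card h6
      rw [card_image_of_injective _ Subtype.val_injective] at h7
      have := h2 v hvI
      omega

theorem sum_card_extensions_le (hr : 1 ≤ r) (hF' : IsFactor G r R F') (hd : Disjoint R I)
    {K : Finset V} (hK : K ∈ F') :
    ∑ v ∈ I with ∀ u ∈ K, G.Adj v u, #(extensions G r (R \ K) (I.erase v) (F'.erase K)) ≤
      #(extensions G r R I F') := by
  obtain ⟨w, hw⟩ : K.Nonempty := card_pos.1 (by rw [(hF'.1 K hK).card_eq]; omega)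
  have hKR := hF'.subset hK
  have hnot : ∀ v, ∀ F ∈ extensions G r (R \ K) (I.erase v) (F'.erase K), ∀ L ∈ F, w ∉ L := by
    intro v F hF L hL hwL
    have := (mem_factors.1 (mem_filter.1 hF).1).subset hL hwL
    rcases mem_union.1 this with h | h
    · exact (mem_sdiff.1 h).2 hw
    · exact disjoint_left.1 hd (hKR hw) (mem_of_mem_erase h)
  rw [← card_sigma]
  refine card_le_card_of_injOn (fun p => insert (insert p.1 K) p.2) ?_ ?_
  · rintro ⟨v, F⟩ hp
    simp only [coe_sigma, Set.mem_sigma_iff, mem_coe, mem_filter] at hp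
    obtain ⟨⟨hvI, hvK⟩, hF⟩ := hp
    have hvR : v ∉ R := disjoint_right.1 hd hvI
    obtain ⟨hF1, hF2⟩ := mem_filter.1 hF
    rw [mem_factors] at hF1
    have hcl : G.IsNClique (r + 1) (insert v K) := (hF'.1 K hK).insert hvK
    have hone : IsFactor G (r + 1) (insert v K) {insert v K} := by simp [IsFactor, hcl]
    have hdis : Disjoint (insert v K) (R \ K ∪ I.erase v) := by
      rw [disjoint_left]
      intro u hu hu'
      rcases mem_insert.1 hu with rfl | h
      · rcases mem_union.1 hu' with h' | h'
        · exact hvR (mem_sdiff.1 h').1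
        · exact (mem_erase.1 h').1 rfl
      · rcases mem_union.1 hu' with h' | h'
        · exact (mem_sdiff.1 h').2 h
        · exact disjoint_left.1 hd (hKR h) (mem_of_mem_erase h')
    have hun : insert v K ∪ (R \ K ∪ I.erase v) = R ∪ I := by
      ext u
      simp only [mem_union, mem_insert, mem_sdiff, mem_erase]
      have := @hKR u
      by_cases huv : u = v
      · subst huv; tauto
      · tauto
    simp only [mem_coe]
    refine mem_filter.2 ⟨mem_factors.2 ?_, ?_⟩
    · have := hone.union hF1 hdis
      rwa [hun, ← insert_eq] at this
    · intro L hL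
      rcases mem_insert.1 hL with rfl | hL
      · rw [insert_inter_of_notMem hvR, inter_eq_left.2 hKR]; exact hK
      · have h1 := hF2 L hL
        have h2 : L ∩ R = L ∩ (R \ K) := by
          ext u
          simp only [mem_inter, mem_sdiff]
          refine ⟨fun h => ⟨h.1, h.2, fun huK => ?_⟩, fun h => ⟨h.1, h.2.1⟩⟩
          have := hF1.subset hL h.1
          exact disjoint_left.1 hdis (mem_insert_of_mem huK) this
        rw [h2]; exact mem_of_mem_erase h1
  · rintro ⟨v, F⟩ hp ⟨v', F₁⟩ hp' he
    simp only [coe_sigma, Set.mem_sigma_iff, mem_coe, mem_filter] at hp hp'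
    simp only at he
    have hvK : ∀ v ∈ I, v ∉ K := fun v hv hvK => disjoint_left.1 hd (hKR hvK) hv
    have h1 : insert v K = insert v' K := by
      have h2 : insert v K ∈ insert (insert v' K) F₁ := he ▸ mem_insert_self _ _
      refine (mem_insert.1 h2).resolve_right fun h3 => ?_
      exact hnot v' F₁ hp'.2 _ h3 (mem_insert_of_mem hw)
    have hv : v = v' := by
      have : v ∈ insert v' K := h1 ▸ mem_insert_self _ _
      exact (mem_insert.1 this).resolve_right (hvK v hp.1.1)
    subst hv
    have h4 : ∀ F ∈ extensions G r (R \ K) (I.erase v) (F'.erase K), insert v K ∉ F :=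
      fun F hF h => hnot v F hF _ h (mem_insert_of_mem hw)
    have : F = F₁ := by
      rw [← erase_insert (h4 F hp.2), ← erase_insert (h4 F₁ hp'.2), he]
    rw [this]

theorem factorial_le_card_extensions {d : ℕ} (hr : 1 ≤ r) (m : ℕ) :
    ∀ (R I : Finset V) (F' : Finset (Finset V)), IsFactor G r R F' → Disjoint R I → #I = m →
      #F' = m → (∀ K ∈ F', #{v ∈ I | ¬ ∀ u ∈ K, G.Adj v u} ≤ d) →
      (∀ v ∈ I, #{K ∈ F' | ¬ ∀ u ∈ K, G.Adj v u} ≤ d) → 2 * d ≤ m →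
      m.factorial ≤ 2 ^ m * (2 * d).factorial * #(extensions G r R I F') := by
  induction m with
  | zero =>
    intro R I F' hF' hd hI hc h1 h2 hm
    have := card_pos.2 (extensions_nonempty hF' hd (by omega) h1 h2 (by omega))
    rw [pow_zero, one_mul, Nat.factorial_zero]
    exact Nat.mul_pos (Nat.factorial_pos _) this
  | succ m ih =>
    intro R I F' hF' hd hI hc h1 h2 hm
    rcases hm.eq_or_lt with he | hlt
    · have := card_pos.2 (extensions_nonempty hF' hd (by omega) h1 h2 (by omega))
      rw [he, mul_right_comm]
      exact Nat.le_mul_of_pos_left _ (Nat.mul_pos (by positivity) this)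
    obtain ⟨K, hK⟩ : F'.Nonempty := card_pos.1 (by omega)
    have hsum := sum_card_extensions_le hr hF' hd hK
    have hstep : ∀ v ∈ {v ∈ I | ∀ u ∈ K, G.Adj v u}, m.factorial ≤
        2 ^ m * (2 * d).factorial * #(extensions G r (R \ K) (I.erase v) (F'.erase K)) := by
      intro v hv
      obtain ⟨hvI, -⟩ := mem_filter.1 hv
      refine ih _ _ _ ?_ ?_ ?_ ?_ ?_ ?_ (by omega)
      · have h3 := hF'.of_subset (erase_subset K F')
        have h4 := hF'.sdiff_biUnion (singleton_subset_iff.2 hK)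
        rw [sdiff_singleton_eq_erase, singleton_biUnion, id] at h4
        rwa [h4] at h3
      · exact (hd.mono_left sdiff_subset).mono_right (erase_subset _ _)
      · rw [card_erase_of_mem hvI]; omega
      · rw [card_erase_of_mem hK]; omega
      · intro L hL
        exact (card_le_card (filter_subset_filter _ (erase_subset _ _))).trans
          (h1 L (mem_of_mem_erase hL))
      · intro u hu
        exact (card_le_card (filter_subset_filter _ (erase_subset _ _))).trans
          (h2 u (mem_of_mem_erase hu))
    have h5 := card_nsmul_le_sum _ _ _ hstep
    rw [smul_eq_mul, ← mul_sum] at h5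
    have h6 : m + 1 ≤ 2 * #{v ∈ I | ∀ u ∈ K, G.Adj v u} := by
      have := card_filter_add_card_filter_not (s := I) (fun v => ∀ u ∈ K, G.Adj v u)
      have := h1 K hK
      omega
    calc (m + 1).factorial = (m + 1) * m.factorial := rfl
      _ ≤ 2 * #{v ∈ I | ∀ u ∈ K, G.Adj v u} * m.factorial := Nat.mul_le_mul_right _ h6
      _ = 2 * (#{v ∈ I | ∀ u ∈ K, G.Adj v u} * m.factorial) := by ring
      _ ≤ 2 * (2 ^ m * (2 * d).factorial * #(extensions G r R I F')) :=
          Nat.mul_le_mul_left _ (h5.trans (Nat.mul_le_mul_left _ hsum))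
      _ = _ := by ring

theorem sum_card_extensions_le_card_factors (hr : 1 ≤ r) :
    ∑ F' ∈ factors G r R, #(extensions G r R I F') ≤ #(factors G (r + 1) (R ∪ I)) := by
  rw [← card_biUnion]
  · exact card_le_card (biUnion_subset.2 fun F' _ => filter_subset _ _)
  · intro F₁ hF₁ F₂ hF₂ hne
    refine disjoint_left.2 ?_
    intro F h1 h2
    have key : ∀ F₁ ∈ factors G r R, ∀ F₂ ∈ factors G r R, F ∈ extensions G r R I F₁ →
        F ∈ extensions G r R I F₂ → F₁ ⊆ F₂ := by
      intro F₁ hF₁ F₂ hF₂ h1 h2 K hK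
      have hF₁' := mem_factors.1 hF₁
      obtain ⟨w, hw⟩ : K.Nonempty := card_pos.1 (by rw [(hF₁'.1 K hK).card_eq]; omega)
      have hwR := hF₁'.subset hK hw
      obtain ⟨hF, h3⟩ := mem_filter.1 h1
      have h4 := (mem_filter.1 h2).2
      have h5 : w ∈ F.biUnion id := by
        rw [(mem_factors.1 hF).2.2]; exact mem_union_left _ hwR
      obtain ⟨L, hL, hwL⟩ := mem_biUnion.1 h5
      have h6 : L ∩ R = K := by
        by_contra hne
        exact disjoint_left.1 (hF₁'.2.1 (h3 L hL) hK hne) (mem_inter.2 ⟨hwL, hwR⟩) hw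
      rw [← h6]; exact h4 L hL
    exact hne (subset_antisymm (key _ hF₁ _ hF₂ h1 h2) (key _ hF₂ _ hF₁ h2 h1))

end Extension

section Independent
variable {V : Type*} {G : SimpleGraph V} {r : ℕ} {A B I : Finset V}

theorem card_factors_le_of_hasFactor_sdiff (hr : 1 ≤ r) (hB : B ⊆ A)
    (h : HasFactor G r (A \ B)) : #(factors G r B) ≤ #(factors G r A) := by
  obtain ⟨H, hH⟩ := h
  have key : ∀ F ∈ factors G r B, ∀ K ∈ F, K ∉ H := by
    intro F hF K hK hK'
    have h0 := (mem_factors.1 hF).subset hK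
    have h1 := hH.subset hK'
    obtain ⟨v, hv⟩ := card_pos.1 (((hH.1 K hK').card_eq).symm ▸ hr : 0 < #K)
    exact (mem_sdiff.1 (h1 hv)).2 (h0 hv)
  refine card_le_card_of_injOn (fun F => F ∪ H) (fun F hF => ?_) fun F hF F' hF' he => ?_
  · have := (mem_factors.1 hF).union hH disjoint_sdiff
    rw [union_sdiff_of_subset hB] at this
    exact mem_factors.2 this
  · ext K
    have h1 : K ∈ F ∪ H ↔ K ∈ F' ∪ H := by
      have : F ∪ H = F' ∪ H := he
      rw [this]
    have h2 := key F hF K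
    have h3 := key F' hF' K
    simp only [mem_union] at h1
    tauto

theorem card_inter_le_one (hI : ∀ u ∈ I, ∀ v ∈ I, ¬ G.Adj u v) {K : Finset V}
    (hK : G.IsNClique r K) : #(K ∩ I) ≤ 1 := by
  refine card_le_one.2 fun u hu v hv => ?_
  by_contra hne
  exact hI u (mem_inter.1 hu).2 v (mem_inter.1 hv).2
    (hK.1 (mem_inter.1 hu).1 (mem_inter.1 hv).1 hne)

theorem card_filter_not_forall_le_mul {h : ℕ} {K : Finset V} (hK : #K = r)
    (hc : ∀ u ∈ K, codeg G I u ≤ h) : #{v ∈ I | ¬ ∀ u ∈ K, G.Adj v u} ≤ r * h := by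
  have : ({v ∈ I | ¬ ∀ u ∈ K, G.Adj v u} : Finset V) ⊆
      K.biUnion fun u => {v ∈ I | ¬ G.Adj u v} := by
    intro v hv
    rw [mem_filter] at hv
    push Not at hv
    obtain ⟨hvI, u, hu, hn⟩ := hv
    exact mem_biUnion.2 ⟨u, hu, mem_filter.2 ⟨hvI, fun h => hn h.symm⟩⟩
  refine (card_le_card this).trans (card_biUnion_le.trans ?_)
  rw [← hK, ← smul_eq_mul]
  exact sum_le_card_nsmul _ _ _ hc

theorem card_filter_not_forall_le_codeg {R : Finset V} {F : Finset (Finset V)}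
    (hF : IsFactor G r R F) (v : V) : #{K ∈ F | ¬ ∀ u ∈ K, G.Adj v u} ≤ codeg G R v := by
  have h : ∀ K ∈ ({K ∈ F | ¬ ∀ u ∈ K, G.Adj v u} : Finset (Finset V)), ∃ u ∈ K, ¬ G.Adj v u := by
    intro K hK
    have := (mem_filter.1 hK).2
    push Not at this
    exact this
  have : Nonempty V := ⟨v⟩
  choose! f hf using h
  refine card_le_card_of_injOn f (fun K hK => ?_) fun K hK L hL he => ?_
  · exact mem_filter.2 ⟨hF.subset (mem_filter.1 hK).1 (hf K hK).1, (hf K hK).2⟩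
  · by_contra hne
    have := hF.2.1 (mem_filter.1 hK).1 (mem_filter.1 hL).1 hne
    exact disjoint_left.1 this (hf K hK).1 (he ▸ (hf L hL).1)

theorem sum_codeg_comm (X Y : Finset V) :
    ∑ x ∈ X, codeg G Y x = ∑ y ∈ Y, codeg G X y := by
  simp only [codeg, card_filter]
  rw [sum_comm]
  exact sum_congr rfl fun y _ => sum_congr rfl fun x _ => by simp only [G.adj_comm]

theorem exists_subset_card_factors_mul_factorial_le {k D η b h d : ℕ} (hr : 1 ≤ r)
    (hA : #A = (r + 1) * k) (hIA : I ⊆ A) (hI : ∀ u ∈ I, ∀ v ∈ I, ¬ G.Adj u v)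
    (hIk : k ≤ #I + η) (hcod : ∀ v ∈ A, codeg G A v ≤ k + D) (hF : HasFactor G (r + 1) A)
    (h0 : 0 < h) (hb : k * (D + η) ≤ h * b) (hd : D + η ≤ d) (hd' : r * h ≤ d)
    (hk : 2 * d + (η + b) ≤ k) :
    ∃ m R, k ≤ m + (η + b) ∧ m ≤ k ∧ #R = r * m ∧ (∀ v ∈ R, codeg G R v ≤ k + D) ∧
      HasFactor G r R ∧ #(factors G r R) * m.factorial ≤
        2 ^ m * (2 * d).factorial * #(factors G (r + 1) A) := by
  obtain ⟨F₀, hF₀⟩ := hF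
  have hF₀c : #F₀ = k := by
    have := hF₀.card_eq
    rw [hA] at this
    exact (Nat.eq_of_mul_eq_mul_left (Nat.succ_pos r) this).symm
  have hI1 : ∀ K ∈ F₀, #(K ∩ I) ≤ 1 := fun K hK => card_inter_le_one hI (hF₀.1 K hK)
  have hIsum : #I = ∑ K ∈ F₀, #(K ∩ I) := by
    rw [← card_biUnion]
    · congr 1
      rw [← biUnion_inter]
      have := hF₀.2.2
      have h2 : F₀.biUnion (fun K => K) = A := this
      rw [h2, inter_eq_right.2 hIA]
    · intro K hK L hL hne
      exact disjoint_of_subset_left inter_subset_left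
        (disjoint_of_subset_right inter_subset_left (hF₀.2.1 hK hL hne))
  have hIle : #I ≤ k := by
    rw [hIsum, ← hF₀c, card_eq_sum_ones]
    exact sum_le_sum hI1
  have hmiss : ∀ v ∈ I, codeg G (A \ I) v ≤ D + η := by
    intro v hv
    have h1 := codeg_sdiff_add (G := G) hIA v
    have h2 : codeg G I v = #I := by
      unfold codeg
      congr 1
      exact filter_true_of_mem fun u hu => hI v hv u hu
    have h3 := hcod v (hIA hv)
    omega
  set W := ({w ∈ A \ I | h < codeg G I w} : Finset V) with hW
  have hWb : #W ≤ b := by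
    refine Nat.le_of_mul_le_mul_left ?_ h0
    calc h * #W = ∑ w ∈ W, h := by simp [mul_comm]
      _ ≤ ∑ w ∈ W, codeg G I w := sum_le_sum fun w hw => (mem_filter.1 hw).2.le
      _ ≤ ∑ w ∈ A \ I, codeg G I w := sum_le_sum_of_subset (filter_subset _ _)
      _ = ∑ v ∈ I, codeg G (A \ I) v := sum_codeg_comm _ _
      _ ≤ #I • (D + η) := sum_le_card_nsmul _ _ _ hmiss
      _ ≤ k * (D + η) := by rw [smul_eq_mul]; gcongr
      _ ≤ h * b := hb
  set F₁ := ({K ∈ F₀ | (K ∩ I).Nonempty ∧ Disjoint K W} : Finset (Finset V)) with hF₁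
  have hF₁s : F₁ ⊆ F₀ := filter_subset _ _
  have hone : ∀ K ∈ F₁, #(K ∩ I) = 1 := fun K hK =>
    le_antisymm (hI1 K (hF₁s hK)) (card_pos.2 (mem_filter.1 hK).2.1)
  have hrest : #(F₀ \ F₁) ≤ η + b := by
    have h1 : F₀ \ F₁ ⊆ ({K ∈ F₀ | ¬ (K ∩ I).Nonempty} : Finset (Finset V)) ∪
        ({K ∈ F₀ | ¬ Disjoint K W} : Finset (Finset V)) := by
      intro K hK
      simp only [hF₁, mem_sdiff, mem_filter, mem_union] at hK ⊢
      tauto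
    refine (card_le_card h1).trans ((card_union_le _ _).trans (add_le_add ?_ ?_))
    · have h2 : #I = #({K ∈ F₀ | (K ∩ I).Nonempty} : Finset (Finset V)) := by
        rw [hIsum, card_filter]
        refine sum_congr rfl fun K hK => ?_
        split_ifs with h
        · exact le_antisymm (hI1 K hK) (card_pos.2 h)
        · rw [not_nonempty_iff_eq_empty.1 h, card_empty]
      have h3 := card_filter_add_card_filter_not (s := F₀) (fun K => (K ∩ I).Nonempty)
      omega
    · refine le_trans ?_ hWb
      have h : ∀ K ∈ ({K ∈ F₀ | ¬ Disjoint K W} : Finset (Finset V)), ∃ w ∈ K, w ∈ W :=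
        fun K hK => not_disjoint_iff.1 (mem_filter.1 hK).2
      rcases isEmpty_or_nonempty V with hV | hV
      · rw [filter_false_of_mem fun K hK h' => h' (disjoint_left.2 fun w => hV.elim w)]
        simp
      choose! f hf using h
      refine card_le_card_of_injOn f (fun K hK => (hf K hK).2) fun K hK L hL he => ?_
      by_contra hne
      have := hF₀.2.1 (mem_filter.1 hK).1 (mem_filter.1 hL).1 hne
      exact disjoint_left.1 this (hf K hK).1 (he ▸ (hf L hL).1)
  have hcF := card_sdiff_add_card_eq_card hF₁s
  set A₁ := F₁.biUnion id with hA₁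
  have hA₁A : A₁ ⊆ A := biUnion_subset.2 fun K hK => hF₀.subset (hF₁s hK)
  have hdisj : ∀ K ∈ F₁, ∀ L ∈ F₁, K ≠ L → Disjoint K L := fun K hK L hL hne =>
    hF₀.2.1 (hF₁s hK) (hF₁s hL) hne
  have hR : A₁ \ I = F₁.biUnion fun K => K \ I := by
    ext v
    simp only [hA₁, mem_sdiff, mem_biUnion, id]
    tauto
  have hRI : (A₁ \ I) ∪ (A₁ ∩ I) = A₁ := sdiff_union_inter _ _
  have hI₁c : #(A₁ ∩ I) = #F₁ := by
    rw [hA₁, biUnion_inter, card_biUnion, card_eq_sum_ones]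
    · exact sum_congr rfl hone
    · exact fun K hK L hL hne => disjoint_of_subset_left inter_subset_left
        (disjoint_of_subset_right inter_subset_left (hdisj K hK L hL hne))
  have hRc : #(A₁ \ I) = r * #F₁ := by
    have h1 := (hF₀.of_subset hF₁s).card_eq
    have h2 := card_sdiff_add_card_inter A₁ I
    have h3 : #A₁ = (r + 1) * #F₁ := h1
    rw [add_mul, one_mul] at h3
    omega
  refine ⟨#F₁, A₁ \ I, by omega, by omega, hRc, fun v hv => ?_, ?_, ?_⟩
  · have h1 := hA₁A (mem_sdiff.1 hv).1
    exact (codeg_mono (sdiff_subset.trans hA₁A) v).trans (hcod v h1)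
  · rw [hR]
    refine hasFactor_biUnion _ _ (fun K hK => hasFactor_of_isNClique ⟨?_, ?_⟩)
      fun K hK L hL hne => disjoint_of_subset_left sdiff_subset
        (disjoint_of_subset_right sdiff_subset (hdisj K hK L hL hne))
    · exact (hF₀.1 K (hF₁s hK)).1.subset (by exact_mod_cast sdiff_subset)
    · have h1 := card_sdiff_add_card_inter K I
      have h2 := (hF₀.1 K (hF₁s hK)).card_eq
      have h3 := hone K hK
      omega
  · have hdRI : Disjoint (A₁ \ I) (A₁ ∩ I) := disjoint_sdiff_inter _ _
    have hext : ∀ F' ∈ factors G r (A₁ \ I), (#F₁).factorial ≤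
        2 ^ #F₁ * (2 * d).factorial * #(extensions G r (A₁ \ I) (A₁ ∩ I) F') := by
      intro F' hF'
      have hF' := mem_factors.1 hF'
      refine factorial_le_card_extensions (d := d) hr _ _ _ _ hF' hdRI hI₁c ?_ ?_ ?_ ?_
      · have := hF'.card_eq
        rw [hRc] at this
        exact (Nat.eq_of_mul_eq_mul_left hr this).symm
      · intro K hK
        refine (card_filter_not_forall_le_mul (h := h) (hF'.1 K hK).card_eq
          fun u hu => ?_).trans hd'
        refine (codeg_mono inter_subset_right u).trans ?_
        have hu' := mem_sdiff.1 (hF'.subset hK hu)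
        obtain ⟨L, hL, huL⟩ := mem_biUnion.1 hu'.1
        have h2 := disjoint_left.1 (mem_filter.1 hL).2.2 huL
        rw [hW, mem_filter, not_and, not_lt] at h2
        exact h2 (mem_sdiff.2 ⟨hA₁A hu'.1, hu'.2⟩)
      · intro v hv
        refine (card_filter_not_forall_le_codeg hF' v).trans ?_
        exact ((codeg_mono (sdiff_subset_sdiff hA₁A le_rfl) v).trans
          (hmiss v (mem_inter.1 hv).2)).trans hd
      · omega
    have h1 := sum_card_extensions_le_card_factors (G := G) (R := A₁ \ I) (I := A₁ ∩ I) hr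
    rw [hRI] at h1
    have h2 : #(factors G (r + 1) A₁) ≤ #(factors G (r + 1) A) := by
      refine card_factors_le_of_hasFactor_sdiff (Nat.succ_pos r) hA₁A ?_
      rw [← hF₀.sdiff_biUnion hF₁s]
      exact ⟨_, hF₀.of_subset sdiff_subset⟩
    calc #(factors G r (A₁ \ I)) * (#F₁).factorial
        = ∑ F' ∈ factors G r (A₁ \ I), (#F₁).factorial := by simp
      _ ≤ ∑ F' ∈ factors G r (A₁ \ I),
          2 ^ #F₁ * (2 * d).factorial * #(extensions G r (A₁ \ I) (A₁ ∩ I) F') :=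
            sum_le_sum hext
      _ = 2 ^ #F₁ * (2 * d).factorial *
          ∑ F' ∈ factors G r (A₁ \ I), #(extensions G r (A₁ \ I) (A₁ ∩ I) F') := by
            rw [mul_sum]
      _ ≤ _ := by gcongr; exact h1.trans h2

end Independent

section Count

theorem pow_le_of_factorial_le {m k d : ℕ} {N : ℝ} (hN : 0 ≤ N) (hmk : m ≤ k)
    (hm : ((k : ℝ) - m) * Real.log k ≤ k) (hd : (2 * d : ℝ) * Real.log k ≤ k) (hdk : 2 * d ≤ k)
    (h : (m.factorial : ℝ) ≤ 4 ^ m * (2 * d).factorial * N) : ((k : ℝ) / 100) ^ k ≤ N := by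
  rcases Nat.eq_zero_or_pos k with rfl | hk
  · obtain rfl : m = 0 := by omega
    obtain rfl : d = 0 := by omega
    simpa using h
  have hk' : (0 : ℝ) < k := by exact_mod_cast hk
  have hpow : ∀ j : ℕ, (j : ℝ) * Real.log k ≤ k → (k : ℝ) ^ j ≤ Real.exp k := by
    intro j hj
    rw [← Real.exp_log hk', ← Real.exp_nat_mul, Real.exp_log hk']
    exact Real.exp_le_exp.2 hj
  have h1 : (k : ℝ) ^ k ≤ Real.exp k * k.factorial := by
    have := Real.pow_div_factorial_le_exp (k : ℝ) hk'.le k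
    rwa [div_le_iff₀ (by positivity)] at this
  have h2 : (k.factorial : ℝ) ≤ m.factorial * Real.exp k := by
    have h3 : k.factorial ≤ m.factorial * k ^ (k - m) := by
      have := Nat.factorial_mul_pow_sub_le_factorial hmk
      have h4 := Nat.factorial_mul_descFactorial (Nat.sub_le k m)
      rw [Nat.sub_sub_self hmk] at h4
      rw [← h4]
      gcongr
      exact Nat.descFactorial_le_pow _ _
    calc (k.factorial : ℝ) ≤ m.factorial * (k : ℝ) ^ (k - m) := by exact_mod_cast h3
      _ ≤ _ := by
        gcongr
        exact hpow _ (by rw [Nat.cast_sub hmk]; exact hm)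
  have h3 : ((2 * d).factorial : ℝ) ≤ Real.exp k := by
    calc ((2 * d).factorial : ℝ) ≤ ((2 * d : ℕ) : ℝ) ^ (2 * d) := by
          exact_mod_cast Nat.factorial_le_pow _
      _ ≤ (k : ℝ) ^ (2 * d) := by gcongr
      _ ≤ _ := hpow _ (by push_cast; exact hd)
  have h4 : Real.exp k = Real.exp 1 ^ k := by rw [← Real.exp_nat_mul, mul_one]
  have h5 : Real.exp 1 ^ 3 * 4 ≤ 100 := by
    have := Real.exp_one_lt_d9
    calc Real.exp 1 ^ 3 * 4 ≤ 2.72 ^ 3 * 4 := by gcongr; linarith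
      _ ≤ 100 := by norm_num
  rw [div_pow, div_le_iff₀ (by positivity)]
  calc (k : ℝ) ^ k ≤ Real.exp k * (m.factorial * Real.exp k) := h1.trans (by gcongr)
    _ ≤ Real.exp k * ((4 ^ m * Real.exp k * N) * Real.exp k) := by
        gcongr
        exact h.trans (by gcongr)
    _ ≤ Real.exp k * ((4 ^ k * Real.exp k * N) * Real.exp k) := by gcongr; norm_num
    _ = N * (Real.exp 1 ^ 3 * 4) ^ k := by rw [h4]; ring
    _ ≤ N * 100 ^ k := by gcongr

end Count

section Matching
variable {V : Type*} {G : SimpleGraph V} {r : ℕ} {A B X Y R I : Finset V} {F : Finset (Finset V)}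

theorem IsFactor.sum_card_inter (h : IsFactor G r A F) (X : Finset V) :
    ∑ K ∈ F, #(K ∩ X) = #(A ∩ X) := by
  rw [← h.2.2, biUnion_inter, card_biUnion]
  · rfl
  · exact fun K hK L hL hne => disjoint_of_subset_left inter_subset_left
      (disjoint_of_subset_right inter_subset_left (h.2.1 hK hL hne))

theorem isFactor_one_image_singleton (G : SimpleGraph V) (R : Finset V) :
    IsFactor G 1 R (R.image fun v => {v}) := by
  refine ⟨fun K hK => ?_, fun K hK L hL hne => ?_, ?_⟩
  · obtain ⟨v, _, rfl⟩ := mem_image.1 hK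
    exact ⟨by simp, by simp⟩
  · obtain ⟨v, _, rfl⟩ := mem_image.1 (mem_coe.1 hK)
    obtain ⟨w, _, rfl⟩ := mem_image.1 (mem_coe.1 hL)
    refine disjoint_singleton.2 ?_
    rintro rfl
    exact hne rfl
  · ext v
    simp

theorem factorial_le_card_factors_two {p E : ℕ} (hRI : Disjoint R I) (hR : #R = p) (hI : #I = p)
    (h1 : ∀ u ∈ R, codeg G I u ≤ E) (h2 : ∀ u ∈ I, codeg G R u ≤ E) (hp : 2 * E ≤ p) :
    p.factorial ≤ 2 ^ p * (2 * E).factorial * #(factors G 2 (R ∪ I)) := by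
  have hF := isFactor_one_image_singleton G R
  refine (factorial_le_card_extensions (d := E) le_rfl p R I _ hF hRI hI ?_ ?_ ?_ hp).trans ?_
  · rw [card_image_of_injective _ singleton_injective, hR]
  · intro K hK
    have := card_filter_not_forall_le_mul (G := G) (I := I) (h := E) (hF.1 K hK).card_eq
      fun u hu => h1 u (hF.subset hK hu)
    rwa [one_mul] at this
  · exact fun v hv => (card_filter_not_forall_le_codeg hF v).trans (h2 v hv)
  · gcongr
    exact filter_subset _ _

theorem card_factors_mul_le (hr : 1 ≤ r) (hd : Disjoint A B) :
    #(factors G r A) * #(factors G r B) ≤ #(factors G r (A ∪ B)) := by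
  rw [← card_product]
  refine card_le_card_of_injOn (fun p => p.1 ∪ p.2) (fun p hp => ?_) fun p hp q hq he => ?_
  · obtain ⟨h1, h2⟩ := mem_product.1 hp
    exact mem_factors.2 ((mem_factors.1 h1).union (mem_factors.1 h2) hd)
  · obtain ⟨h1, h2⟩ := mem_product.1 hp
    obtain ⟨h3, h4⟩ := mem_product.1 hq
    have key : ∀ F ∈ factors G r A, ∀ H ∈ factors G r B, ∀ K ∈ F, K ∉ H := by
      intro F hF H hH K hK hK'
      have h5 := (mem_factors.1 hF).subset hK
      have h6 := (mem_factors.1 hH).subset hK'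
      obtain ⟨v, hv⟩ := card_pos.1 ((((mem_factors.1 hF).1 K hK).card_eq).symm ▸ hr : 0 < #K)
      exact disjoint_left.1 hd (h5 hv) (h6 hv)
    have h5 : ∀ K, K ∈ p.1 ∨ K ∈ p.2 ↔ K ∈ q.1 ∨ K ∈ q.2 := fun K => by
      have he' : p.1 ∪ p.2 = q.1 ∪ q.2 := he
      rw [← mem_union, ← mem_union, he']
    refine Prod.ext (ext fun K => ?_) (ext fun K => ?_)
    · exact ⟨fun h => ((h5 K).1 (Or.inl h)).resolve_right (key _ h1 _ h4 K h),
        fun h => ((h5 K).2 (Or.inl h)).resolve_right (key _ h3 _ h2 K h)⟩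
    · exact ⟨fun h => ((h5 K).1 (Or.inr h)).resolve_left fun h' => key _ h3 _ h2 K h' h,
        fun h => ((h5 K).2 (Or.inr h)).resolve_left fun h' => key _ h1 _ h4 K h' h⟩

theorem factorial_le_card_factors_two_of_codeg {p E : ℕ} (hX : #X = 2 * p)
    (h : ∀ u ∈ X, codeg G X u ≤ E) (hp : 2 * E ≤ p) :
    p.factorial ≤ 2 ^ p * (2 * E).factorial * #(factors G 2 X) := by
  obtain ⟨R, hR, hRc⟩ := exists_subset_card_eq (show p ≤ #X by omega)
  have hc := card_sdiff_add_card_eq_card hR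
  have := factorial_le_card_factors_two (G := G) (R := R) (I := X \ R) (p := p) (E := E)
    disjoint_sdiff hRc (by omega) (fun u hu => (codeg_mono sdiff_subset u).trans (h u (hR hu)))
    (fun u hu => (codeg_mono hR u).trans (h u (mem_sdiff.1 hu).1)) hp
  rwa [union_sdiff_of_subset hR] at this

theorem IsFactor.exists_subset_of_card_sdiff_le {e : ℕ} (h : IsFactor G r A F)
    (hB : #(A \ B) ≤ e) : ∃ F' ⊆ F, (∀ K ∈ F', K ⊆ B) ∧ #F ≤ #F' + e := by
  refine ⟨{K ∈ F | K ⊆ B}, filter_subset _ _, fun K hK => (mem_filter.1 hK).2, ?_⟩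
  have h1 := card_filter_add_card_filter_not (s := F) (fun K => K ⊆ B)
  have h2 : #({K ∈ F | ¬ K ⊆ B}) ≤ #(A \ B) := by
    rcases isEmpty_or_nonempty V with hV | hV
    · rw [filter_false_of_mem fun K hK h' => h' fun w => hV.elim w]
      simp
    have h3 : ∀ K ∈ ({K ∈ F | ¬ K ⊆ B} : Finset (Finset V)), ∃ w ∈ K, w ∉ B :=
      fun K hK => not_subset.1 (mem_filter.1 hK).2
    choose! f hf using h3
    refine card_le_card_of_injOn f (fun K hK => ?_) fun K hK L hL he => ?_
    · exact mem_sdiff.2 ⟨h.subset (mem_filter.1 hK).1 (hf K hK).1, (hf K hK).2⟩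
    · by_contra hne
      have := h.2.1 (mem_filter.1 hK).1 (mem_filter.1 hL).1 hne
      exact disjoint_left.1 this (hf K hK).1 (he ▸ (hf L hL).1)
  omega

theorem factorial_le_of_two_almost_cliques {k E : ℕ} (hA : #A = 2 * k) (hF : HasFactor G 2 A)
    (hXY : Disjoint X Y) (hrest : #(A \ (X ∪ Y)) ≤ 5 * E) (hXk : #X ≤ k + E) (hYk : #Y ≤ k + E)
    (hX : ∀ u ∈ X, codeg G X u ≤ E) (hY : ∀ u ∈ Y, codeg G Y u ≤ E) (hk : 20 * E + 2 ≤ k) :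
    ∃ m, k ≤ m + (11 * E + 1) ∧ m ≤ k ∧
      m.factorial ≤ 4 ^ m * (4 * E).factorial * #(factors G 2 A) := by
  obtain ⟨F, hF⟩ := hF
  have hFc : #F = k := by have := hF.card_eq; omega
  obtain ⟨F₁, hF₁, hF₁s, hF₁c⟩ := hF.exists_subset_of_card_sdiff_le hrest
  have hF₁f := hF.of_subset hF₁
  obtain ⟨F₂, hF₂, hF₂c, hev⟩ : ∃ F₂ ⊆ F₁, #F₁ ≤ #F₂ + 1 ∧ Even (∑ K ∈ F₂, #(K ∩ X)) := by
    rcases Nat.even_or_odd (∑ K ∈ F₁, #(K ∩ X)) with he | ho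
    · exact ⟨F₁, le_rfl, by omega, he⟩
    · obtain ⟨K, hK, hKo⟩ : ∃ K ∈ F₁, Odd (#(K ∩ X)) := by
        by_contra! hcon
        have : Even (∑ K ∈ F₁, #(K ∩ X)) := Finset.even_sum _ fun K hK =>
          Nat.not_odd_iff_even.1 (hcon K hK)
        exact (Nat.not_odd_iff_even.2 this) ho
      refine ⟨F₁.erase K, erase_subset _ _, by rw [card_erase_of_mem hK]; omega, ?_⟩
      rw [← add_sum_erase _ _ hK] at ho
      exact (Nat.odd_add.1 ho).1 hKo
  have hF₂f := hF.of_subset (hF₂.trans hF₁)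
  set A₂ := F₂.biUnion id with hA₂
  have hA₂c : #A₂ = 2 * #F₂ := hF₂f.card_eq
  have hA₂s : A₂ ⊆ X ∪ Y := biUnion_subset.2 fun K hK => hF₁s K (hF₂ hK)
  have hA₂A : A₂ ⊆ A := biUnion_subset.2 fun K hK => hF.subset (hF₁ (hF₂ hK))
  rw [hF₂f.sum_card_inter] at hev
  obtain ⟨p, hp⟩ := hev.two_dvd
  have hsplit : (A₂ ∩ X) ∪ (A₂ ∩ Y) = A₂ := by
    rw [← inter_union_distrib_left, inter_eq_left.2 hA₂s]
  have hd : Disjoint (A₂ ∩ X) (A₂ ∩ Y) :=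
    disjoint_of_subset_left inter_subset_right (disjoint_of_subset_right inter_subset_right hXY)
  have hcs := card_union_of_disjoint hd
  rw [hsplit] at hcs
  have hX₂ : #(A₂ ∩ X) ≤ #X := card_le_card inter_subset_right
  have hY₂ : #(A₂ ∩ Y) ≤ #Y := card_le_card inter_subset_right
  have hle1 := card_le_card hF₁
  have hle2 := card_le_card hF₂
  obtain ⟨q, hq⟩ : ∃ q, #(A₂ ∩ Y) = 2 * q := ⟨#F₂ - p, by omega⟩
  have h1 := factorial_le_card_factors_two_of_codeg (G := G) hp
    (fun u hu => (codeg_mono inter_subset_right u).trans (hX u (mem_inter.1 hu).2)) (by omega)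
  have h2 := factorial_le_card_factors_two_of_codeg (G := G) hq
    (fun u hu => (codeg_mono inter_subset_right u).trans (hY u (mem_inter.1 hu).2)) (by omega)
  have h3 := card_factors_mul_le (G := G) (r := 2) (by norm_num) hd
  rw [hsplit] at h3
  have h4 : #(factors G 2 A₂) ≤ #(factors G 2 A) := by
    refine card_factors_le_of_hasFactor_sdiff (by norm_num) hA₂A ?_
    rw [← hF.sdiff_biUnion (hF₂.trans hF₁)]
    exact ⟨_, hF.of_subset sdiff_subset⟩
  refine ⟨#F₂, by omega, by omega, ?_⟩
  have hpq : #F₂ = p + q := by omega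
  have h5 : (p + q).factorial ≤ 2 ^ (p + q) * (p.factorial * q.factorial) := by
    rw [← Nat.add_choose_mul_factorial_mul_factorial, mul_assoc]
    gcongr
    exact Nat.choose_le_two_pow _ _
  have h6 : (2 * E).factorial * (2 * E).factorial ≤ (4 * E).factorial := by
    have := Nat.factorial_mul_factorial_dvd_factorial_add (2 * E) (2 * E)
    rw [show 2 * E + 2 * E = 4 * E by ring] at this
    exact Nat.le_of_dvd (Nat.factorial_pos _) this
  rw [hpq]
  calc (p + q).factorial ≤ 2 ^ (p + q) * (p.factorial * q.factorial) := h5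
    _ ≤ 2 ^ (p + q) * ((2 ^ p * (2 * E).factorial * #(factors G 2 (A₂ ∩ X))) *
        (2 ^ q * (2 * E).factorial * #(factors G 2 (A₂ ∩ Y)))) := by gcongr
    _ = (2 ^ (p + q) * (2 ^ p * 2 ^ q)) * ((2 * E).factorial * (2 * E).factorial) *
        (#(factors G 2 (A₂ ∩ X)) * #(factors G 2 (A₂ ∩ Y))) := by ring
    _ ≤ (2 ^ (p + q) * (2 ^ p * 2 ^ q)) * (4 * E).factorial * #(factors G 2 A) := by
        gcongr
        exact h3.trans h4
    _ = _ := by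
        rw [← pow_add, ← mul_pow]
        norm_num

theorem factorial_le_of_almost_bipartite_of_le {k E : ℕ} (hA : #A = 2 * k)
    (hF : IsFactor G 2 A F) {F₁ : Finset (Finset V)} (hF₁ : F₁ ⊆ F) (hF₁s : ∀ K ∈ F₁, K ⊆ X ∪ Y)
    (hF₁c : #F ≤ #F₁ + 5 * E)
    (hXY : Disjoint X Y) (hXk : #X ≤ k + E)
    (hX : ∀ u ∈ X, codeg G Y u ≤ E) (hY : ∀ u ∈ Y, codeg G X u ≤ E) (hk : 20 * E + 2 ≤ k)
    (hle : #F₁ ≤ #(F₁.biUnion id ∩ X)) :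
    ∃ m, k ≤ m + (11 * E + 1) ∧ m ≤ k ∧
      m.factorial ≤ 4 ^ m * (4 * E).factorial * #(factors G 2 A) := by
  have hFc : #F = k := by have := hF.card_eq; omega
  have hF₁f := hF.of_subset hF₁
  have hsum := hF₁f.sum_card_inter X
  set P₂ := ({K ∈ F₁ | #(K ∩ X) = 2} : Finset (Finset V)) with hP₂
  set P₀ := ({K ∈ F₁ | #(K ∩ X) = 0} : Finset (Finset V)) with hP₀
  have hcount : #(F₁.biUnion id ∩ X) + #P₀ = #F₁ + #P₂ := by
    rw [← hsum, hP₀, hP₂, card_filter, card_filter, card_eq_sum_ones, ← sum_add_distrib,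
      ← sum_add_distrib]
    refine sum_congr rfl fun K hK => ?_
    have h1 := (hF₁f.1 K hK).card_eq
    have h2 : #(K ∩ X) ≤ #K := card_le_card inter_subset_left
    split_ifs <;> omega
  obtain ⟨T, hT, hTc⟩ := exists_subset_card_eq (show #P₂ - #P₀ ≤ #P₂ by omega)
  have hTF : T ⊆ F₁ := hT.trans (filter_subset _ _)
  set F₂ := F₁ \ T with hF₂
  have hF₂F₁ : F₂ ⊆ F₁ := sdiff_subset
  have hF₂c : #F₂ + #T = #F₁ := card_sdiff_add_card_eq_card hTF
  have hF₂f := hF.of_subset (hF₂F₁.trans hF₁)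
  have hsum₂ := hF₂f.sum_card_inter X
  set A₂ := F₂.biUnion id with hA₂
  have hA₂c : #A₂ = 2 * #F₂ := hF₂f.card_eq
  have hA₂s : A₂ ⊆ X ∪ Y := biUnion_subset.2 fun K hK => hF₁s K (hF₂F₁ hK)
  have hA₂A : A₂ ⊆ A := biUnion_subset.2 fun K hK => hF.subset (hF₁ (hF₂F₁ hK))
  have hsplit : (A₂ ∩ X) ∪ (A₂ ∩ Y) = A₂ := by
    rw [← inter_union_distrib_left, inter_eq_left.2 hA₂s]
  have hd : Disjoint (A₂ ∩ X) (A₂ ∩ Y) :=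
    disjoint_of_subset_left inter_subset_right (disjoint_of_subset_right inter_subset_right hXY)
  have hcs := card_union_of_disjoint hd
  rw [hsplit] at hcs
  have hTs : ∑ K ∈ T, #(K ∩ X) = 2 * #T := by
    rw [mul_comm, ← smul_eq_mul]
    exact sum_const_nat fun K hK => (mem_filter.1 (hT hK)).2
  have hsd := sum_sdiff (f := fun K => #(K ∩ X)) hTF
  have hX₁ : #(F₁.biUnion id ∩ X) ≤ #X := card_le_card inter_subset_right
  have hle1 := card_le_card hF₁
  have hXm : #(A₂ ∩ X) = #F₂ := by
    rw [hTs, ← hF₂, hsum₂, hsum] at hsd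
    omega
  have hYm : #(A₂ ∩ Y) = #F₂ := by omega
  have h1 := factorial_le_card_factors_two (G := G) hd hXm hYm
    (fun u hu => (codeg_mono inter_subset_right u).trans (hX u (mem_inter.1 hu).2))
    (fun u hu => (codeg_mono inter_subset_right u).trans (hY u (mem_inter.1 hu).2)) (by omega)
  rw [hsplit] at h1
  have h4 : #(factors G 2 A₂) ≤ #(factors G 2 A) := by
    refine card_factors_le_of_hasFactor_sdiff (by norm_num) hA₂A ?_
    rw [← hF.sdiff_biUnion (hF₂F₁.trans hF₁)]
    exact ⟨_, hF.of_subset sdiff_subset⟩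
  refine ⟨#F₂, by omega, by omega, h1.trans ?_⟩
  gcongr <;> omega

theorem factorial_le_of_almost_bipartite {k E : ℕ} (hA : #A = 2 * k) (hF : HasFactor G 2 A)
    (hXY : Disjoint X Y) (hrest : #(A \ (X ∪ Y)) ≤ 5 * E) (hXk : #X ≤ k + E) (hYk : #Y ≤ k + E)
    (hX : ∀ u ∈ X, codeg G Y u ≤ E) (hY : ∀ u ∈ Y, codeg G X u ≤ E) (hk : 20 * E + 2 ≤ k) :
    ∃ m, k ≤ m + (11 * E + 1) ∧ m ≤ k ∧
      m.factorial ≤ 4 ^ m * (4 * E).factorial * #(factors G 2 A) := by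
  obtain ⟨F, hF⟩ := hF
  obtain ⟨F₁, hF₁, hF₁s, hF₁c⟩ := hF.exists_subset_of_card_sdiff_le hrest
  have hc : #(F₁.biUnion id) = 2 * #F₁ := (hF.of_subset hF₁).card_eq
  have hs : F₁.biUnion id ⊆ X ∪ Y := biUnion_subset.2 hF₁s
  have hsplit : (F₁.biUnion id ∩ X) ∪ (F₁.biUnion id ∩ Y) = F₁.biUnion id := by
    rw [← inter_union_distrib_left, inter_eq_left.2 hs]
  have hle := card_union_le (F₁.biUnion id ∩ X) (F₁.biUnion id ∩ Y)
  rw [hsplit] at hle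
  rcases le_total (#F₁) (#(F₁.biUnion id ∩ X)) with h | h
  · exact factorial_le_of_almost_bipartite_of_le hA hF hF₁ hF₁s hF₁c hXY hXk hX hY hk h
  · exact factorial_le_of_almost_bipartite_of_le hA hF hF₁
      (fun K hK => (union_comm X Y) ▸ hF₁s K hK) hF₁c hXY.symm hYk hY hX hk (by omega)

end Matching

section Unlinked
variable {V : Type*} {G : SimpleGraph V} {A S T : Finset V}

theorem card_le_or_card_le {E : ℕ} (hS : ∀ s ∈ S, codeg G T s ≤ E)
    (hT : ∀ t ∈ T, #{u ∈ S | G.Adj t u} ≤ E) : #S ≤ 2 * E ∨ #T ≤ 2 * E := by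
  by_contra! hcon
  have h1 : #S * #T ≤ #T * E + #S * E := by
    calc #S * #T = ∑ s ∈ S, #T := by simp
      _ ≤ ∑ s ∈ S, (#{u ∈ T | G.Adj s u} + E) := sum_le_sum fun s hs => by
          rw [← card_adj_add_codeg (G := G) s]
          exact Nat.add_le_add_left (hS s hs) _
      _ = ∑ s ∈ S, #{u ∈ T | G.Adj s u} + #S * E := by rw [sum_add_distrib]; simp
      _ = ∑ t ∈ T, #{u ∈ S | G.Adj t u} + #S * E := by
          congr 1
          exact sum_card_adj_comm G S T
      _ ≤ #T * E + #S * E := by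
          gcongr
          rw [← smul_eq_mul]
          exact sum_le_card_nsmul _ _ _ hT
  rcases le_total (#S) (#T) with h | h
  · have h2 : (2 * E + 1) * #T ≤ #S * #T := by gcongr; omega
    have h3 : #S * E ≤ #T * E := by gcongr
    have h4 : (2 * E + 1) * #T = #T * E + #T * E + #T := by ring
    omega
  · have h2 : #S * (2 * E + 1) ≤ #S * #T := by gcongr; omega
    have h3 : #T * E ≤ #S * E := by gcongr
    have h4 : #S * (2 * E + 1) = #S * E + #S * E + #S := by ring
    omega

theorem factorial_le_of_conbrs_lt {k D M E : ℕ} (hA : #A = 2 * k) (hF : HasFactor G 2 A)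
    (hcod : ∀ v ∈ A, codeg G A v ≤ k + D) (hE : 4 * D + 4 * M ≤ E) (hk : 20 * E + 2 ≤ k)
    {x y : V} (hx : x ∈ A) (hy : y ∈ A) (hxy : conbrs G A x y < M)
    (hZ : #{z ∈ A | M ≤ conbrs G A x z ∧ M ≤ conbrs G A z y} < M) :
    ∃ m, k ≤ m + (11 * E + 1) ∧ m ≤ k ∧
      m.factorial ≤ 4 ^ m * (4 * E).factorial * #(factors G 2 A) := by
  set Q := ({u ∈ A | G.Adj y u} : Finset V) with hQ
  set P := ({u ∈ A | ¬ G.Adj y u} : Finset V) with hP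
  have hPQ : Disjoint P Q := (disjoint_filter_filter_not _ _ _).symm
  have hPQA : P ∪ Q = A := by
    ext u
    simp only [hP, hQ, mem_union, mem_filter]
    tauto
  have hPA : P ⊆ A := filter_subset _ _
  have hQA : Q ⊆ A := filter_subset _ _
  have hPc : #P ≤ k + D := hcod y hy
  have hPQc : #P + #Q = 2 * k := by rw [← card_union_of_disjoint hPQ, hPQA, hA]
  have hco : ∀ v, codeg G P v + codeg G Q v = codeg G A v := by
    intro v
    have := codeg_sdiff_add (G := G) hPA v
    rw [show A \ P = Q by rw [← hPQA, union_sdiff_cancel_left hPQ]] at this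
    omega
  have hnb : ∀ (S : Finset V) v, #{u ∈ S | G.Adj v u} + codeg G S v = #S :=
    fun S v => card_adj_add_codeg v
  have hconQ : ∀ z, #{u ∈ Q | G.Adj z u} = conbrs G A z y := by
    intro z
    unfold conbrs
    rw [hQ, filter_filter]
    congr 1
    ext u
    simp only [mem_filter]
    tauto
  have hconP : ∀ z, #{u ∈ P | G.Adj z u} ≤ codeg G P x + conbrs G A x z := by
    intro z
    refine (card_le_card (t := ({u ∈ P | ¬ G.Adj x u} : Finset V) ∪
      ({u ∈ A | G.Adj x u ∧ G.Adj z u} : Finset V)) fun u hu => ?_).trans (card_union_le _ _)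
    have h1 := mem_filter.1 hu
    have h2 := hPA h1.1
    simp only [mem_union, mem_filter]
    tauto
  have hx1 := hconQ x
  have hx2 := hnb P x
  have hx3 := hnb Q x
  have hx4 := hco x
  have hx5 := hcod x hx
  set Vx := ({z ∈ A | conbrs G A z y < M} : Finset V) with hVx
  set Vy := ({z ∈ A | conbrs G A x z < M} : Finset V) with hVy
  have hVxQ : ∀ z ∈ Vx, #{u ∈ Q | G.Adj z u} ≤ E := by
    intro z hz
    have := (mem_filter.1 hz).2
    rw [hconQ]
    omega
  have hVxP : ∀ z ∈ Vx, codeg G P z ≤ E := by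
    intro z hz
    have h1 := (mem_filter.1 hz).2
    have h2 := hcod z (mem_filter.1 hz).1
    have h3 := hco z
    have h4 := hnb Q z
    rw [hconQ] at h4
    omega
  have hVyP : ∀ z ∈ Vy, #{u ∈ P | G.Adj z u} ≤ E := by
    intro z hz
    have h1 := (mem_filter.1 hz).2
    have h2 := hconP z
    omega
  have hVyQ : ∀ z ∈ Vy, codeg G Q z ≤ E := by
    intro z hz
    have h1 := (mem_filter.1 hz).2
    have h2 := hconP z
    have h3 := hco z
    have h4 := hnb P z
    have h5 := hcod z (mem_filter.1 hz).1
    omega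
  have hcov : #(A \ (Vx ∪ Vy)) ≤ M := by
    refine le_trans (card_le_card fun z hz => ?_) hZ.le
    simp only [hVx, hVy, mem_sdiff, mem_union, mem_filter, not_or, not_and, not_lt] at hz ⊢
    exact ⟨hz.1, hz.2.2 hz.1, hz.2.1 hz.1⟩
  have hsub : ∀ {S S' : Finset V} (v), S ⊆ S' → #{u ∈ S' | G.Adj v u} ≤ E →
      #{u ∈ S | G.Adj v u} ≤ E := fun v h h' => (card_le_card (filter_subset_filter _ h)).trans h'
  have hsc : ∀ {S S' : Finset V} (v), S ⊆ S' → codeg G S' v ≤ E → codeg G S v ≤ E :=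
    fun v h h' => (codeg_mono h v).trans h'
  have hab : #(P ∩ Vx) ≤ 2 * E ∨ #(P ∩ Vy) ≤ 2 * E := card_le_or_card_le
    (fun s hs => hsc s inter_subset_left (hVxP s (mem_inter.1 hs).2))
    (fun t ht => hsub t inter_subset_left (hVyP t (mem_inter.1 ht).2))
  have hac : #(Q ∩ Vx) ≤ 2 * E ∨ #(P ∩ Vx) ≤ 2 * E := card_le_or_card_le
    (fun s hs => hsc s inter_subset_left (hVxP s (mem_inter.1 hs).2))
    (fun t ht => hsub t inter_subset_left (hVxQ t (mem_inter.1 ht).2))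
  have hcd : #(Q ∩ Vy) ≤ 2 * E ∨ #(Q ∩ Vx) ≤ 2 * E := card_le_or_card_le
    (fun s hs => hsc s inter_subset_left (hVyQ s (mem_inter.1 hs).2))
    (fun t ht => hsub t inter_subset_left (hVxQ t (mem_inter.1 ht).2))
  have hbd : #(P ∩ Vy) ≤ 2 * E ∨ #(Q ∩ Vy) ≤ 2 * E := card_le_or_card_le
    (fun s hs => hsc s inter_subset_left (hVyQ s (mem_inter.1 hs).2))
    (fun t ht => hsub t inter_subset_left (hVyP t (mem_inter.1 ht).2))
  have hdj : ∀ S T : Finset V, Disjoint (P ∩ S) (Q ∩ T) := fun S T =>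
    disjoint_of_subset_left inter_subset_left (disjoint_of_subset_right inter_subset_left hPQ)
  have hrest : ∀ S T U W : Finset V, (∀ u ∈ A, u ∈ Vx ∪ Vy → u ∉ S → u ∉ T → u ∈ U ∪ W) →
      #U ≤ 2 * E → #W ≤ 2 * E → #(A \ (S ∪ T)) ≤ 5 * E := by
    intro S T U W h hU hW
    have h1 : A \ (S ∪ T) ⊆ (A \ (Vx ∪ Vy)) ∪ (U ∪ W) := by
      intro u hu
      simp only [mem_sdiff, mem_union, not_or] at hu ⊢
      by_cases hV : u ∈ Vx ∨ u ∈ Vy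
      · exact Or.inr (mem_union.1 (h u hu.1 (mem_union.2 hV) hu.2.1 hu.2.2))
      · exact Or.inl ⟨hu.1, not_or.1 hV⟩
    have h2 := (card_le_card h1).trans (card_union_le _ _)
    have h3 := card_union_le U W
    omega
  have hmem : ∀ u ∈ A, u ∈ P ∨ u ∈ Q := fun u hu => mem_union.1 (hPQA.symm ▸ hu)
  have hcard : ∀ S : Finset V, #(P ∩ S) ≤ k + E ∧ #(Q ∩ S) ≤ k + E := fun S => by
    have h1 : #(P ∩ S) ≤ #P := card_le_card inter_subset_left
    have h2 : #(Q ∩ S) ≤ #Q := card_le_card inter_subset_left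
    constructor <;> omega
  by_cases hcase : #(P ∩ Vy) ≤ 2 * E ∧ #(Q ∩ Vx) ≤ 2 * E
  · refine factorial_le_of_two_almost_cliques hA hF (hdj Vx Vy)
      (hrest _ _ (P ∩ Vy) (Q ∩ Vx) ?_ hcase.1 hcase.2) (hcard Vx).1 (hcard Vy).2 ?_ ?_ hk
    · intro u hu hV h1 h2
      rcases hmem u hu with h | h <;> rcases mem_union.1 hV with h' | h'
      · exact absurd (mem_inter.2 ⟨h, h'⟩) h1
      · exact mem_union_left _ (mem_inter.2 ⟨h, h'⟩)
      · exact mem_union_right _ (mem_inter.2 ⟨h, h'⟩)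
      · exact absurd (mem_inter.2 ⟨h, h'⟩) h2
    · exact fun u hu => hsc u inter_subset_left (hVxP u (mem_inter.1 hu).2)
    · exact fun u hu => hsc u inter_subset_left (hVyQ u (mem_inter.1 hu).2)
  · refine factorial_le_of_almost_bipartite hA hF (hdj Vy Vx)
      (hrest _ _ (P ∩ Vx) (Q ∩ Vy) ?_ (by omega) (by omega)) (hcard Vy).1 (hcard Vx).2 ?_ ?_ hk
    · intro u hu hV h1 h2
      rcases hmem u hu with h | h <;> rcases mem_union.1 hV with h' | h'
      · exact mem_union_left _ (mem_inter.2 ⟨h, h'⟩)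
      · exact absurd (mem_inter.2 ⟨h, h'⟩) h1
      · exact absurd (mem_inter.2 ⟨h, h'⟩) h2
      · exact mem_union_right _ (mem_inter.2 ⟨h, h'⟩)
    · exact fun u hu => hsc u inter_subset_left (hVyQ u (mem_inter.1 hu).2)
    · exact fun u hu => hsc u inter_subset_left (hVxP u (mem_inter.1 hu).2)

end Unlinked

section Typical
variable {V : Type*} {G : SimpleGraph V} {r : ℕ} {A B : Finset V}
  {𝒮 : Finset (Finset V)} {𝓜 : Finset (Finset (Finset V))}

/-- `P` is a matching of `G` with all its vertices in `J`. -/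
def IsMatchingIn (G : SimpleGraph V) (J : Finset V) (P : Finset (Finset V)) : Prop :=
  (∀ Q ∈ P, ∃ a ∈ J, ∃ b ∈ J, G.Adj a b ∧ Q = {a, b}) ∧ (P : Set (Finset V)).PairwiseDisjoint id

theorem exists_independent_of_forall_isMatchingIn {M : ℕ} (J : Finset V)
    (h : ∀ P, IsMatchingIn G J P → #P < M) :
    ∃ I ⊆ J, (∀ u ∈ I, ∀ v ∈ I, ¬ G.Adj u v) ∧ #J ≤ #I + 2 * M := by
  have hfin : (J.powerset.powerset.filter (IsMatchingIn G J)).Nonempty :=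
    ⟨∅, mem_filter.2 ⟨by simp, by simp [IsMatchingIn]⟩⟩
  obtain ⟨P, hP, hmax⟩ := exists_max_image _ (fun P => #P) hfin
  have hPm := (mem_filter.1 hP).2
  have hPs := (mem_filter.1 hP).1
  refine ⟨J \ P.biUnion id, sdiff_subset, fun u hu v hv huv => ?_, ?_⟩
  · rw [mem_sdiff] at hu hv
    have hnew : ∀ Q ∈ P, Disjoint ({u, v} : Finset V) Q := by
      intro Q hQ
      rw [disjoint_left]
      intro w hw hwQ
      have : w ∈ P.biUnion id := mem_biUnion.2 ⟨Q, hQ, hwQ⟩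
      rcases mem_insert.1 hw with rfl | hw
      · exact hu.2 this
      · rw [mem_singleton.1 hw] at this
        exact hv.2 this
    have hnot : ({u, v} : Finset V) ∉ P := fun hmem =>
      hu.2 (mem_biUnion.2 ⟨_, hmem, mem_insert_self _ _⟩)
    have hP' : insert {u, v} P ∈ J.powerset.powerset.filter (IsMatchingIn G J) := by
      refine mem_filter.2 ⟨mem_powerset.2 (insert_subset (mem_powerset.2 ?_)
        (mem_powerset.1 hPs)), fun Q hQ => ?_, ?_⟩
      · exact insert_subset hu.1 (singleton_subset_iff.2 hv.1)
      · rcases mem_insert.1 hQ with rfl | hQ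
        · exact ⟨u, hu.1, v, hv.1, huv, rfl⟩
        · exact hPm.1 Q hQ
      · rw [coe_insert]
        exact hPm.2.insert fun Q hQ _ => hnew Q hQ
    have := hmax _ hP'
    rw [card_insert_of_notMem hnot] at this
    omega
  · have h1 : #(P.biUnion id) ≤ #P * 2 := card_biUnion_le_card_mul _ _ _ fun Q hQ => by
      obtain ⟨a, _, b, _, _, rfl⟩ := hPm.1 Q hQ
      exact card_le_two
    have h2 := le_card_sdiff (P.biUnion id) J
    have h3 := h P hPm
    omega

theorem two_mul_codeg_le_of_isTypical {d : ℕ} (hB : B ⊆ A) {v : V}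
    (hJ : ({u ∈ A | ¬ G.Adj v u} : Finset V) ∈ 𝒮) (hT' : IsTypical 𝒮 𝓜 d (A \ B)) :
    2 * codeg G B v < codeg G A v + 2 * d := by
  have h1 := hT'.1 _ hJ
  have h2 : ({u ∈ A | ¬ G.Adj v u} ∩ (A \ B) : Finset V) = {u ∈ A \ B | ¬ G.Adj v u} := by
    ext u
    simp only [mem_inter, mem_filter, mem_sdiff]
    tauto
  have h3 := codeg_sdiff_add (G := G) hB v
  rw [h2] at h1
  change codeg G A v < 2 * codeg G (A \ B) v + 2 * d at h1
  omega

theorem exists_adj_of_isTypical {k k₁ D M d e : ℕ} (hB : B ⊆ A) (hk : k < 2 * k₁ + 2 * d)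
    (hcod : ∀ v ∈ A, codeg G A v ≤ k + D)
    (hJ : ∀ v ∈ A, ({u ∈ A | ¬ G.Adj v u} : Finset V) ∈ 𝒮)
    (hM : ∀ v ∈ A, codeg G A v + M ≤ k ∨
      ∃ P ∈ 𝓜, IsMatchingIn G {u ∈ A | ¬ G.Adj v u} P ∧ M ≤ #P)
    (hT : IsTypical 𝒮 𝓜 d B) (hT' : IsTypical 𝒮 𝓜 d (A \ B)) (he : e < k₁)
    (hMe : 4 * e + 12 * d + 2 * D < M) {S : Finset V} (hS : S ⊆ B) (hSk : k₁ ≤ #S + e) :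
    ∃ u ∈ S, ∃ v ∈ S, G.Adj u v := by
  by_contra! hind
  obtain ⟨v, hv⟩ := card_pos.1 (show 0 < #S by omega)
  have hvA := hB (hS hv)
  have h1 := two_mul_codeg_le_of_isTypical hB (hJ v hvA) hT'
  have hSJ : S ⊆ {u ∈ B | ¬ G.Adj v u} := fun u hu => mem_filter.2 ⟨hS hu, hind v hv u hu⟩
  have h2 : #S ≤ codeg G B v := card_le_card hSJ
  rcases hM v hvA with h | ⟨P, hP, hPm, hPM⟩
  · omega
  · have h3 := hT.2 P hP
    have h4 : ∀ Q ∈ ({Q ∈ P | Q ⊆ B} : Finset (Finset V)),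
        ∃ w ∈ Q, w ∈ ({u ∈ B | ¬ G.Adj v u} : Finset V) \ S := by
      intro Q hQ
      obtain ⟨hQP, hQB⟩ := mem_filter.1 hQ
      obtain ⟨a, ha, b, hb, hab, rfl⟩ := hPm.1 Q hQP
      have hnot : a ∉ S ∨ b ∉ S := by
        by_contra! hc
        exact hind a hc.1 b hc.2 hab
      rcases hnot with h | h
      · exact ⟨a, by simp, mem_sdiff.2 ⟨mem_filter.2 ⟨hQB (by simp), (mem_filter.1 ha).2⟩, h⟩⟩
      · exact ⟨b, by simp, mem_sdiff.2 ⟨mem_filter.2 ⟨hQB (by simp), (mem_filter.1 hb).2⟩, h⟩⟩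
    have : Nonempty V := ⟨v⟩
    choose! f hf using h4
    have h5 : #({Q ∈ P | Q ⊆ B} : Finset (Finset V)) ≤
        #(({u ∈ B | ¬ G.Adj v u} : Finset V) \ S) := by
      refine card_le_card_of_injOn f (fun Q hQ => (hf Q hQ).2) fun Q hQ Q' hQ' he => ?_
      by_contra hne
      have := hPm.2 (mem_filter.1 hQ).1 (mem_filter.1 hQ').1 hne
      exact disjoint_left.1 this (hf Q hQ).1 (he ▸ (hf Q' hQ').1)
    have h6 := card_sdiff_add_card_eq_card hSJ
    change _ = codeg G B v at h6
    have h7 := hcod v hvA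
    have h8 : #({Q ∈ P | Q ⊆ B} : Finset (Finset V)) + #S ≤ codeg G B v := by omega
    have h9 : #P < 4 * #({Q ∈ P | Q ⊆ B} : Finset (Finset V)) + 4 * d := by convert h3
    omega

theorem isLinked_two_of_isTypical {M d m : ℕ} (hB : B ⊆ A)
    (hC : ∀ x ∈ A, ∀ y ∈ A, ({u ∈ A | G.Adj x u ∧ G.Adj y u} : Finset V) ∈ 𝒮)
    (hZ : ∀ x ∈ A, ∀ y ∈ A,
      ({z ∈ A | M ≤ conbrs G A x z ∧ M ≤ conbrs G A z y} : Finset V) ∈ 𝒮)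
    (hlink : ∀ x ∈ A, ∀ y ∈ A, x ≠ y → M ≤ conbrs G A x y ∨
      M ≤ #{z ∈ A | M ≤ conbrs G A x z ∧ M ≤ conbrs G A z y})
    (hT : IsTypical 𝒮 𝓜 d B) (hm : 2 * m + 2 * d + 10 ≤ M) : IsLinked G 2 B m := by
  have hcon : ∀ x ∈ A, ∀ y ∈ A, M ≤ conbrs G A x y → m + 4 ≤ conbrs G B x y := by
    intro x hx y hy h
    have h1 := hT.1 _ (hC x hx y hy)
    have h2 : ({u ∈ A | G.Adj x u ∧ G.Adj y u} ∩ B : Finset V) =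
        {u ∈ B | G.Adj x u ∧ G.Adj y u} := by
      ext u
      have := @hB u
      simp only [mem_inter, mem_filter]
      tauto
    rw [h2] at h1
    change conbrs G A x y < 2 * conbrs G B x y + 2 * d at h1
    omega
  refine isLinked_two (M := m + 4) le_rfl fun x hx y hy hxy => ?_
  refine (hlink x (hB hx) y (hB hy) hxy).imp (hcon x (hB hx) y (hB hy)) fun h => ?_
  have h1 := hT.1 _ (hZ x (hB hx) y (hB hy))
  have h2 : ({z ∈ A | M ≤ conbrs G A x z ∧ M ≤ conbrs G A z y} ∩ B : Finset V) ⊆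
      {z ∈ B | m + 4 ≤ conbrs G B x z ∧ m + 4 ≤ conbrs G B z y} := by
    intro z hz
    obtain ⟨hz, hzB⟩ := mem_inter.1 hz
    obtain ⟨hzA, h3, h4⟩ := mem_filter.1 hz
    exact mem_filter.2 ⟨hzB, hcon x (hB hx) z hzA h3, hcon z hzA y (hB hy) h4⟩
  have h3 := card_le_card h2
  omega

theorem hasFactor_of_isTypical {k k₁ D M d t : ℕ} (hr : 2 ≤ r)
    (hcod : ∀ v ∈ A, codeg G A v ≤ k + D) (hB : B ⊆ A) (hBk : #B = r * k₁)
    (hk : k < 2 * k₁ + 2 * d)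
    (hJ : ∀ v ∈ A, ({u ∈ A | ¬ G.Adj v u} : Finset V) ∈ 𝒮)
    (hC : ∀ x ∈ A, ∀ y ∈ A, ({u ∈ A | G.Adj x u ∧ G.Adj y u} : Finset V) ∈ 𝒮)
    (hZ : ∀ x ∈ A, ∀ y ∈ A,
      ({z ∈ A | M ≤ conbrs G A x z ∧ M ≤ conbrs G A z y} : Finset V) ∈ 𝒮)
    (hM : ∀ v ∈ A, codeg G A v + M ≤ k ∨
      ∃ P ∈ 𝓜, IsMatchingIn G {u ∈ A | ¬ G.Adj v u} P ∧ M ≤ #P)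
    (hlink : r = 2 → ∀ x ∈ A, ∀ y ∈ A, x ≠ y → M ≤ conbrs G A x y ∨
      M ≤ #{z ∈ A | M ≤ conbrs G A x z ∧ M ≤ conbrs G A z y})
    (hT : IsTypical 𝒮 𝓜 d B) (hT' : IsTypical 𝒮 𝓜 d (A \ B))
    (ht : 100 * (r + 1) ^ (r + 3) ≤ t) (htk : t ^ 40 ≤ k₁) (hlog : Real.log (r * k₁) ≤ t)
    (hMt : 12 * (k₁ / t) + 12 * d + 2 * D + 10 < M) (hDt : (D / 2 + 2 * d) * t ^ 16 ≤ k₁)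
    (hDr : r * (D / 2 + 2 * d) ≤ k₁ / t) :
    (∀ v ∈ B, codeg G B v ≤ k₁ + (D / 2 + 2 * d)) ∧ HasFactor G r B := by
  have hcB : ∀ v ∈ B, codeg G B v ≤ k₁ + (D / 2 + 2 * d) := by
    intro v hv
    have h1 := two_mul_codeg_le_of_isTypical hB (hJ v (hB hv)) hT'
    have h2 := hcod v (hB hv)
    omega
  have ht100 : 100 ≤ t := by
    refine le_trans ?_ ht
    have : 1 ≤ (r + 1) ^ (r + 3) := Nat.one_le_pow _ _ (by omega)
    omega
  have hk₁ : 1 ≤ k₁ := le_trans (Nat.one_le_pow _ _ (by omega)) htk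
  have h100 : k₁ / t ≤ k₁ / 100 := Nat.div_le_div_left ht100 (by norm_num)
  have hind : ∀ S ⊆ B, k₁ ≤ #S + 3 * (k₁ / t) → ∃ u ∈ S, ∃ v ∈ S, G.Adj u v := fun S hS h =>
    exists_adj_of_isTypical hB hk hcod hJ hM hT hT' (by omega) (by omega) hS h
  refine ⟨hcB, hasFactor_of_isLinked_of_large hr ht htk hlog hBk hcB hDt
    (fun S hS h => hind S hS (by omega)) ?_⟩
  rcases hr.eq_or_lt with h2 | h3
  · subst h2
    exact isLinked_two_of_isTypical hB hC hZ (hlink rfl) hT (by omega)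
  · refine isLinked_of_three_le (h := k₁ - 3 * (k₁ / t)) h3 hk₁ hBk hcB
      (fun S hS h => hind S hS (by omega)) ?_
    obtain ⟨p, rfl⟩ : ∃ p, r = p + 3 := ⟨r - 3, by omega⟩
    rw [Nat.add_sub_cancel]
    have h5 : (p + 3) * k₁ = p * k₁ + 3 * k₁ := by ring
    have h6 : p * (k₁ + (D / 2 + 2 * d)) = p * k₁ + p * (D / 2 + 2 * d) := by ring
    have h7 : (p + 3) * (D / 2 + 2 * d) = p * (D / 2 + 2 * d) + 3 * (D / 2 + 2 * d) := by ring
    omega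

end Typical

section TypicalHalves
variable {V : Type*} {G : SimpleGraph V} {r : ℕ} {A : Finset V}

theorem exists_halves {k D M d t : ℕ} (hr : 2 ≤ r) (hk : 1 ≤ k) (hA : #A = r * k)
    (hcod : ∀ v ∈ A, codeg G A v ≤ k + D)
    (hM : ∀ v ∈ A, codeg G A v + M ≤ k ∨
      ∃ P, IsMatchingIn G {u ∈ A | ¬ G.Adj v u} P ∧ M ≤ #P)
    (hlink : r = 2 → ∀ x ∈ A, ∀ y ∈ A, x ≠ y → M ≤ conbrs G A x y ∨
      M ≤ #{z ∈ A | M ≤ conbrs G A x z ∧ M ≤ conbrs G A z y})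
    (hd0 : 0 < d) (hdk : d ≤ k)
    (hexp : 2 ^ (r + 2) * (5 * (r * k) ^ 2) * Real.exp (-((d : ℝ) ^ 2 / (4 * (r * k)))) ≤ 1)
    (ht : 100 * (r + 1) ^ (r + 3) ≤ t) (htk : 3 * t ^ 40 ≤ k) (hdk3 : 6 * d ≤ k)
    (hlog : Real.log (r * k) ≤ t)
    (hMt : 12 * (k / t) + 12 * d + 2 * D + 10 < M) (hDt : 3 * ((D / 2 + 2 * d) * t ^ 16) ≤ k)
    (hDr : 3 * (r * (D / 2 + 2 * d) * t) ≤ k) :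
    ∃ 𝓑 ⊆ A.powerset, 2 ^ #A ≤ 2 ^ (r + 1) * #𝓑 ∧ ∀ B ∈ 𝓑, ∃ k₁ k₂, k₁ + k₂ = k ∧
      k < 2 * k₁ + 2 * d ∧ k < 2 * k₂ + 2 * d ∧ #B = r * k₁ ∧ #(A \ B) = r * k₂ ∧
      (∀ v ∈ B, codeg G B v ≤ k₁ + (D / 2 + 2 * d)) ∧ HasFactor G r B ∧
      (∀ v ∈ A \ B, codeg G (A \ B) v ≤ k₂ + (D / 2 + 2 * d)) ∧ HasFactor G r (A \ B) := by
  have hA0 : 1 ≤ #A := by rw [hA]; exact Nat.mul_pos (by omega) hk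
  have hP : ∀ v ∈ A, ∃ P, IsMatchingIn G {u ∈ A | ¬ G.Adj v u} P ∧
      (codeg G A v + M ≤ k ∨ M ≤ #P) := by
    intro v hv
    rcases hM v hv with h | ⟨P, h1, h2⟩
    · exact ⟨∅, by simp [IsMatchingIn], Or.inl h⟩
    · exact ⟨P, h1, Or.inr h2⟩
  choose! P hPm hPM using hP
  set 𝒮 : Finset (Finset V) := {A} ∪ A.image (fun v => {u ∈ A | ¬ G.Adj v u}) ∪
    (A ×ˢ A).image (fun p => {u ∈ A | G.Adj p.1 u ∧ G.Adj p.2 u}) ∪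
    (A ×ˢ A).image (fun p => {z ∈ A | M ≤ conbrs G A p.1 z ∧ M ≤ conbrs G A z p.2}) with h𝒮
  set 𝓜 := A.image P with h𝓜
  have h𝒮A : ∀ S ∈ 𝒮, S ⊆ A := by
    intro S hS
    simp only [h𝒮, mem_union, mem_singleton, mem_image] at hS
    rcases hS with ((rfl | ⟨v, _, rfl⟩) | ⟨p, _, rfl⟩) | ⟨p, _, rfl⟩
    · exact le_rfl
    all_goals exact filter_subset _ _
  have hA𝒮 : A ∈ 𝒮 := by simp [h𝒮]
  have hJ : ∀ v ∈ A, ({u ∈ A | ¬ G.Adj v u} : Finset V) ∈ 𝒮 := fun v hv =>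
    mem_union_left _ (mem_union_left _ (mem_union_right _
      (mem_image_of_mem (fun v => ({u ∈ A | ¬ G.Adj v u} : Finset V)) hv)))
  have hC : ∀ x ∈ A, ∀ y ∈ A, ({u ∈ A | G.Adj x u ∧ G.Adj y u} : Finset V) ∈ 𝒮 :=
    fun x hx y hy => mem_union_left _ (mem_union_right _
      (mem_image_of_mem (fun p : V × V => ({u ∈ A | G.Adj p.1 u ∧ G.Adj p.2 u} : Finset V))
        (mk_mem_product hx hy)))
  have hZ : ∀ x ∈ A, ∀ y ∈ A,
      ({z ∈ A | M ≤ conbrs G A x z ∧ M ≤ conbrs G A z y} : Finset V) ∈ 𝒮 :=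
    fun x hx y hy => mem_union_right _
      (mem_image_of_mem (fun p : V × V => ({z ∈ A | M ≤ conbrs G A p.1 z ∧
        M ≤ conbrs G A z p.2} : Finset V)) (mk_mem_product hx hy))
  have hc𝒮 : #𝒮 + #𝓜 ≤ 5 * (#A) ^ 2 := by
    have h1 : #𝒮 ≤ 1 + #A + #A * #A + #A * #A := by
      refine (card_union_le _ _).trans (add_le_add ((card_union_le _ _).trans (add_le_add
        ((card_union_le _ _).trans (add_le_add (card_singleton A).le card_image_le)) ?_)) ?_)
      all_goals exact card_image_le.trans (card_product _ _).le
    have h2 : #𝓜 ≤ #A := card_image_le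
    have h3 : #A ≤ #A * #A := Nat.le_mul_of_pos_left _ hA0
    have h4 : 5 * (#A) ^ 2 = 5 * (#A * #A) := by ring
    omega
  have hM' : ∀ v ∈ A, codeg G A v + M ≤ k ∨
      ∃ P ∈ 𝓜, IsMatchingIn G {u ∈ A | ¬ G.Adj v u} P ∧ M ≤ #P := fun v hv =>
    (hPM v hv).imp id fun h => ⟨P v, mem_image_of_mem _ hv, hPm v hv, h⟩
  have hpow := two_pow_le_card_isTypical (A := A) (r := r) (𝒮 := 𝒮) (𝓜 := 𝓜) (d := d) h𝒮A
    (fun R hR Q hQ => by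
      obtain ⟨v, hv, rfl⟩ := mem_image.1 hR
      obtain ⟨a, ha, b, hb, hab, rfl⟩ := (hPm v hv).1 Q hQ
      exact ⟨insert_subset (mem_filter.1 ha).1 (singleton_subset_iff.2 (mem_filter.1 hb).1),
        card_pair hab.ne⟩)
    (fun R hR => by
      obtain ⟨v, hv, rfl⟩ := mem_image.1 hR
      exact (hPm v hv).2)
    hd0 (by rw [hA]; exact hdk.trans (Nat.le_mul_of_pos_left _ (by omega))) (by omega)
    (by rw [hA]; exact Nat.le_mul_of_pos_right _ hk) (by
      refine le_trans ?_ hexp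
      have h1 : (#𝒮 + #𝓜 : ℝ) ≤ 5 * (r * k) ^ 2 := by
        have : ((#𝒮 + #𝓜 : ℕ) : ℝ) ≤ ((5 * (#A) ^ 2 : ℕ) : ℝ) := by exact_mod_cast hc𝒮
        rw [hA] at this
        push_cast at this
        exact this
      have h2 : ((#A : ℕ) : ℝ) = r * k := by rw [hA]; push_cast; ring
      rw [h2]
      gcongr)
  refine ⟨_, filter_subset _ _, hpow, fun B hB => ?_⟩
  obtain ⟨hBA, hrB, hT, hT'⟩ := mem_filter.1 hB
  rw [mem_powerset] at hBA
  obtain ⟨k₁, hk₁⟩ := hrB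
  have hcs := card_sdiff_add_card_eq_card hBA
  have hk₁k : k₁ ≤ k := by
    refine Nat.le_of_mul_le_mul_left ?_ (show 0 < r by omega)
    rw [← hk₁, ← hA]
    exact card_le_card hBA
  obtain ⟨k₂, rfl⟩ := Nat.exists_eq_add_of_le hk₁k
  have hk₂ : #(A \ B) = r * k₂ := by
    rw [hA, hk₁, mul_add] at hcs
    omega
  have hlt : ∀ k' : ℕ, r * (k₁ + k₂) < 2 * (r * k') + 2 * d → k₁ + k₂ < 2 * k' + 2 * d := by
    intro k' h
    refine Nat.lt_of_mul_lt_mul_left (a := r) (h.trans_le ?_)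
    have : 2 * d ≤ r * (2 * d) := Nat.le_mul_of_pos_left _ (by omega)
    rw [mul_add]
    linarith
  have hB1 := hT.1 A hA𝒮
  have hB2 := hT'.1 A hA𝒮
  rw [inter_eq_right.2 hBA, hA, hk₁] at hB1
  rw [inter_eq_right.2 sdiff_subset, hA, hk₂] at hB2
  have hk1 := hlt _ hB1
  have hk2 := hlt _ hB2
  have ht0 : 0 < t := lt_of_lt_of_le (by positivity) ht
  have main : ∀ (B' : Finset V) (k' : ℕ), B' ⊆ A → #B' = r * k' → k₁ + k₂ < 2 * k' + 2 * d →
      k' ≤ k₁ + k₂ → IsTypical 𝒮 𝓜 d B' → IsTypical 𝒮 𝓜 d (A \ B') →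
      (∀ v ∈ B', codeg G B' v ≤ k' + (D / 2 + 2 * d)) ∧ HasFactor G r B' := by
    intro B' k' hB' hc hk' hk'' h1 h2
    have hdiv : k' / t ≤ (k₁ + k₂) / t := Nat.div_le_div_right hk''
    have hk'0 : 0 < k' := by omega
    refine hasFactor_of_isTypical hr hcod hB' hc hk' hJ hC hZ hM' hlink h1 h2 ht (by omega) ?_
      (by omega) (by omega) ?_
    · refine le_trans (Real.log_le_log ?_ ?_) hlog
      · have : 0 < r := by omega
        positivity
      · gcongr
    · rw [Nat.le_div_iff_mul_le ht0]
      omega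
  have hm1 := main B k₁ hBA hk₁ hk1 (by omega) hT hT'
  have hm2 := main (A \ B) k₂ sdiff_subset hk₂ hk2 (by omega) hT'
    (by rwa [Finset.sdiff_sdiff_eq_self hBA])
  exact ⟨k₁, k₂, rfl, hk1, hk2, hk₁, hk₂, hm1.1, hm1.2, hm2.1, hm2.2⟩

end TypicalHalves

section Scale

theorem exists_scale {c : ℝ} (hc : 0 < c) (hc4 : c ≤ 1 / 4) (r q₀ : ℕ) (hr : 1 ≤ r) (K : ℝ)
    (hK : 0 ≤ K) : ∃ k₀ : ℕ, ∀ k : ℕ, k₀ ≤ k → ∃ q : ℕ, q₀ ≤ q ∧ q ^ 320 ≤ k ∧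
      (∀ D : ℕ, (D : ℝ) ≤ (k : ℝ) ^ (1 - c) → D * q ^ 80 ≤ k) ∧ K * Real.log (r * k) ≤ q ∧
      K * (k : ℝ) ^ (c / 160) ≤ q ∧ K * (k : ℝ) ^ c ≤ (q : ℝ) ^ 84 := by
  have hy : Filter.Tendsto (fun k : ℕ => (k : ℝ) ^ (c / 80)) Filter.atTop Filter.atTop :=
    (tendsto_rpow_atTop (by positivity)).comp tendsto_natCast_atTop_atTop
  have hz : Filter.Tendsto (fun k : ℕ => (k : ℝ) ^ (c / 160)) Filter.atTop Filter.atTop :=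
    (tendsto_rpow_atTop (by positivity)).comp tendsto_natCast_atTop_atTop
  have hlog : ∀ᶠ k : ℕ in Filter.atTop, ‖Real.log k‖ ≤ 1 / (8 * (K + 1)) * ‖(k : ℝ) ^ (c / 80)‖ :=
    tendsto_natCast_atTop_atTop.eventually
      ((isLittleO_log_rpow_atTop (show 0 < c / 80 by positivity)).def (by positivity))
  have h1 := hy.eventually_ge_atTop ((q₀ : ℝ) + 2 + K * 2 ^ 80 + 4 * K * Real.log r)
  have h2 := hz.eventually_ge_atTop (2 * K)
  obtain ⟨k₀, hk₀⟩ := Filter.eventually_atTop.1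
    ((h1.and h2).and (hlog.and (Filter.eventually_ge_atTop 1)))
  refine ⟨k₀, fun k hk => ?_⟩
  obtain ⟨⟨h1, h2⟩, h3, hk1⟩ := hk₀ k hk
  have hk0 : (1 : ℝ) ≤ k := by exact_mod_cast hk1
  have hkp : (0 : ℝ) < k := by linarith
  set y := (k : ℝ) ^ (c / 80) with hy'
  have hy0 : 0 < y := Real.rpow_pos_of_pos hkp _
  have hlr : 0 ≤ Real.log r := Real.log_nonneg (by exact_mod_cast hr)
  have hKl : 0 ≤ K * Real.log r := mul_nonneg hK hlr
  have hq1 : ((⌊y⌋₊ : ℕ) : ℝ) ≤ y := Nat.floor_le hy0.le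
  have hq2 : y < (⌊y⌋₊ : ℕ) + 1 := Nat.lt_floor_add_one y
  have hq0 : ((q₀ : ℕ) : ℝ) ≤ (⌊y⌋₊ : ℕ) := by nlinarith [Nat.cast_nonneg (α := ℝ) q₀]
  have hyk : ∀ j : ℕ, y ^ j = (k : ℝ) ^ (c / 80 * j) := fun j => by
    rw [hy', Real.rpow_mul hkp.le, Real.rpow_natCast]
  have hqK : K * 2 ^ 80 + 1 ≤ (⌊y⌋₊ : ℕ) := by linarith [Nat.cast_nonneg (α := ℝ) q₀]
  have hKp : 0 ≤ K * 2 ^ 80 := by positivity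
  have hy2 : y ≤ 2 * (⌊y⌋₊ : ℕ) := by linarith
  refine ⟨⌊y⌋₊, by exact_mod_cast hq0, ?_, fun D hD => ?_, ?_, ?_, ?_⟩
  · have : ((⌊y⌋₊ : ℕ) : ℝ) ^ 320 ≤ k := by
      calc ((⌊y⌋₊ : ℕ) : ℝ) ^ 320 ≤ y ^ 320 := by gcongr
        _ = (k : ℝ) ^ (4 * c) := by rw [hyk]; congr 1; push_cast; ring
        _ ≤ (k : ℝ) ^ (1 : ℝ) := Real.rpow_le_rpow_of_exponent_le hk0 (by linarith)
        _ = k := Real.rpow_one _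
    exact_mod_cast this
  · have : (D : ℝ) * ((⌊y⌋₊ : ℕ) : ℝ) ^ 80 ≤ k := by
      calc (D : ℝ) * ((⌊y⌋₊ : ℕ) : ℝ) ^ 80 ≤ (k : ℝ) ^ (1 - c) * y ^ 80 := by gcongr
        _ = (k : ℝ) ^ (1 : ℝ) := by
          rw [hyk, ← Real.rpow_add hkp]; congr 1; push_cast; ring
        _ = k := Real.rpow_one _
    exact_mod_cast this
  · have hr0 : (0 : ℝ) < r := by exact_mod_cast hr
    rw [Real.log_mul hr0.ne' hkp.ne', mul_add]
    have h4 : K * Real.log k ≤ y / 8 := by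
      rw [Real.norm_of_nonneg (Real.log_nonneg hk0), Real.norm_of_nonneg hy0.le] at h3
      calc K * Real.log k ≤ (K + 1) * (1 / (8 * (K + 1)) * y) := by
            gcongr
            linarith
        _ = y / 8 := by field_simp
    linarith [Nat.cast_nonneg (α := ℝ) q₀]
  · have h4 : (k : ℝ) ^ (c / 160) * (k : ℝ) ^ (c / 160) = y := by
      rw [← Real.rpow_add hkp]; congr 1; ring
    have h5 : 0 ≤ (k : ℝ) ^ (c / 160) := Real.rpow_nonneg hkp.le _
    have h6 : 2 * K * (k : ℝ) ^ (c / 160) ≤ y := by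
      rw [← h4]
      gcongr
    linarith
  · have h4 : (k : ℝ) ^ c = y ^ 80 := by rw [hyk]; congr 1; push_cast; ring
    have hq : (1 : ℝ) ≤ (⌊y⌋₊ : ℕ) := by linarith
    rw [h4]
    calc K * y ^ 80 ≤ K * (2 * (⌊y⌋₊ : ℕ)) ^ 80 := by gcongr
      _ = (K * 2 ^ 80) * (⌊y⌋₊ : ℕ) ^ 80 := by ring
      _ ≤ (⌊y⌋₊ : ℕ) * (⌊y⌋₊ : ℕ) ^ 80 := by gcongr; linarith
      _ ≤ (⌊y⌋₊ : ℕ) ^ 4 * (⌊y⌋₊ : ℕ) ^ 80 := by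
          gcongr
          exact le_self_pow₀ hq (by norm_num)
      _ = _ := by rw [← pow_add]

theorem surplus_half_le {c : ℝ} (hc : 0 < c) (hc4 : c ≤ 1 / 4) {k k₁ d D : ℕ} (hk : 1 ≤ k)
    (hk₁ : k < 2 * k₁ + 2 * d) (hdk : 6 * d ≤ k) (hd : 16 * d * (k : ℝ) ^ c ≤ c * k)
    (hD : (D : ℝ) ≤ (k : ℝ) ^ (1 - c)) :
    ((D / 2 + 2 * d : ℕ) : ℝ) ≤ (k₁ : ℝ) ^ (1 - c) := by
  have hk0 : (1 : ℝ) ≤ k := by exact_mod_cast hk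
  have hkp : (0 : ℝ) < k := by linarith
  have hd6 : 6 * (d : ℝ) ≤ k := by exact_mod_cast hdk
  have hd0 : (0 : ℝ) ≤ d := Nat.cast_nonneg _
  have hk₁' : (k : ℝ) < 2 * k₁ + 2 * d := by exact_mod_cast hk₁
  set p := (k : ℝ) ^ c with hp
  have hp1 : 1 ≤ p := Real.one_le_rpow hk0 hc.le
  have hp0 : 0 < p := by linarith
  have h2c : 1 + c / 2 ≤ (2 : ℝ) ^ c := by
    rw [Real.rpow_def_of_pos (by norm_num)]
    have h1 := Real.add_one_le_exp (Real.log 2 * c)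
    have h2 := Real.log_two_gt_d9
    have h3 : 1 / 2 * c ≤ Real.log 2 * c := by gcongr; linarith
    linarith
  have hsub : (k : ℝ) ^ (1 - c) = k / p := by rw [Real.rpow_sub hkp, Real.rpow_one]
  set z := ((k : ℝ) - 2 * d) / 2 with hz
  have hz0 : 0 < z := by rw [hz]; linarith
  have hzk : z ≤ k / 2 := by rw [hz]; linarith
  have h1 : (k₁ : ℝ) ^ (1 - c) ≥ z * (1 + c / 2) / p := by
    calc (k₁ : ℝ) ^ (1 - c) ≥ z ^ (1 - c) := by
          refine Real.rpow_le_rpow hz0.le ?_ (by linarith)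
          rw [hz]; linarith
      _ = z / z ^ c := by rw [Real.rpow_sub hz0, Real.rpow_one]
      _ ≥ z / (k / 2) ^ c := by
          refine div_le_div_of_nonneg_left hz0.le (Real.rpow_pos_of_pos hz0 _) ?_
          exact Real.rpow_le_rpow hz0.le hzk hc.le
      _ = z * 2 ^ c / p := by
          rw [Real.div_rpow hkp.le (by norm_num)]
          field_simp
          exact hp
      _ ≥ z * (1 + c / 2) / p := by gcongr
  refine le_trans ?_ h1
  rw [le_div_iff₀ hp0]
  have h2 : ((D / 2 : ℕ) : ℝ) ≤ k / p / 2 := by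
    refine Nat.cast_div_le.trans ?_
    push_cast
    rw [← hsub]
    gcongr
  push_cast
  have h3 : k / p / 2 * p = k / 2 := by field_simp
  have h4 : ((D / 2 : ℕ) : ℝ) * p ≤ k / 2 := by
    rw [← h3]
    gcongr
  have h5 : (d : ℝ) ≤ d * p := le_mul_of_one_le_right hd0 hp1
  have h6 : (d : ℝ) * c ≤ d * 1 := by gcongr; linarith
  rw [hz]
  nlinarith

theorem two_pow_mul_exp_le_one {r k d q : ℕ} (hr : 1 ≤ r) (hq : 48 * r + 10 ≤ q)
    (hqk : q ^ 320 ≤ k) (hlog : Real.log (r * k) ≤ q) (hd : (k : ℝ) ≤ 2 * (d * (q : ℝ) ^ 84)) :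
    2 ^ (r + 2) * (5 * ((r : ℝ) * k) ^ 2) * Real.exp (-((d : ℝ) ^ 2 / (4 * (r * k)))) ≤ 1 := by
  have hq0 : (1 : ℝ) ≤ q := by exact_mod_cast (show 1 ≤ q by omega)
  have hr0 : (1 : ℝ) ≤ r := by exact_mod_cast hr
  have hq' : 48 * (r : ℝ) + 10 ≤ q := by exact_mod_cast hq
  have hqk' : (q : ℝ) ^ 320 ≤ k := by exact_mod_cast hqk
  have hk0 : (0 : ℝ) < k := lt_of_lt_of_le (by positivity) hqk'
  have h1 : (r : ℝ) * k ≤ Real.exp q := by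
    rw [← Real.exp_log (show (0 : ℝ) < r * k by positivity)]
    exact Real.exp_le_exp.2 hlog
  have h2 : (2 : ℝ) ≤ Real.exp 1 := by have := Real.add_one_le_exp (1 : ℝ); linarith
  have h3 : 2 ^ (r + 2) * (5 * ((r : ℝ) * k) ^ 2) ≤ Real.exp (3 * q) := by
    calc 2 ^ (r + 2) * (5 * ((r : ℝ) * k) ^ 2) ≤ 2 ^ (r + 2) * (2 ^ 3 * ((r : ℝ) * k) ^ 2) := by
          gcongr; norm_num
      _ ≤ Real.exp 1 ^ (r + 2) * (Real.exp 1 ^ 3 * Real.exp q ^ 2) := by gcongr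
      _ = Real.exp (r + 5 + 2 * q) := by
          rw [← Real.exp_nat_mul, ← Real.exp_nat_mul, ← Real.exp_nat_mul, ← Real.exp_add,
            ← Real.exp_add]
          congr 1
          push_cast
          ring
      _ ≤ Real.exp (3 * q) := Real.exp_le_exp.2 (by linarith)
  have h4 : (3 * q : ℝ) ≤ (d : ℝ) ^ 2 / (4 * (r * k)) := by
    rw [le_div_iff₀ (by positivity)]
    have h5 : (k : ℝ) ^ 2 ≤ 4 * ((d : ℝ) ^ 2 * (q : ℝ) ^ 168) := by
      calc (k : ℝ) ^ 2 ≤ (2 * (d * (q : ℝ) ^ 84)) ^ 2 := by gcongr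
        _ = _ := by ring
    have h6 : (q : ℝ) ^ 168 * (3 * q * (4 * (r * k))) ≤ (q : ℝ) ^ 168 * (d : ℝ) ^ 2 := by
      calc (q : ℝ) ^ 168 * (3 * q * (4 * (r * k))) = (q : ℝ) ^ 169 * (48 * r) * k / 4 := by ring
        _ ≤ (q : ℝ) ^ 169 * q * k / 4 := by gcongr; linarith
        _ = (q : ℝ) ^ 170 * k / 4 := by ring
        _ ≤ (q : ℝ) ^ 320 * k / 4 := by gcongr; norm_num
        _ ≤ k * k / 4 := by gcongr
        _ = (k : ℝ) ^ 2 / 4 := by ring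
        _ ≤ (q : ℝ) ^ 168 * (d : ℝ) ^ 2 := by linarith
    exact le_of_mul_le_mul_left h6 (by positivity)
  calc _ ≤ Real.exp (3 * q) * Real.exp (-(3 * q)) := by
        gcongr
    _ = 1 := by rw [← Real.exp_add]; simp

end Scale

section ScaleBounds
variable {r k D q : ℕ}

theorem twelve_mul_div_lt (hq : 100 ≤ q) (hqk : q ^ 320 ≤ k) (hD : D * q ^ 80 ≤ k) :
    12 * (k / q ^ 4) + 12 * (k / q ^ 84) + 2 * D + 10 < k / q ^ 2 := by
  have h0 : 0 < q := by omega
  have h1 : k / q ^ 4 ≤ k / q ^ 2 / 100 := by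
    rw [Nat.div_div_eq_div_mul]
    refine Nat.div_le_div_left ?_ (by positivity)
    calc q ^ 2 * 100 ≤ q ^ 2 * (q * 1) := by gcongr; omega
      _ ≤ q ^ 2 * (q * q) := by gcongr; omega
      _ = q ^ 4 := by ring
  have h2 : k / q ^ 84 ≤ k / q ^ 4 := Nat.div_le_div_left (Nat.pow_le_pow_right h0 (by norm_num))
    (by positivity)
  have h3 : D ≤ k / q ^ 4 := by
    rw [Nat.le_div_iff_mul_le (by positivity)]
    exact le_trans (by gcongr; omega) hD
  have h4 : 100 ≤ k / q ^ 2 := by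
    rw [Nat.le_div_iff_mul_le (by positivity)]
    calc 100 * q ^ 2 ≤ q * q ^ 2 := by gcongr
      _ = q ^ 3 := by ring
      _ ≤ q ^ 320 := Nat.pow_le_pow_right h0 (show 3 ≤ 320 by norm_num)
      _ ≤ k := hqk
  omega

theorem three_mul_surplus_le (hq : 100 ≤ q) (hrq : r ≤ q) (hD : D * q ^ 80 ≤ k) :
    3 * ((D / 2 + 2 * (k / q ^ 84)) * (q ^ 4) ^ 16) ≤ k ∧
      3 * (r * (D / 2 + 2 * (k / q ^ 84)) * q ^ 4) ≤ k := by
  have h0 : 0 < q := by omega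
  have hd : k / q ^ 84 * q ^ 84 ≤ k := Nat.div_mul_le_self _ _
  have h1 : 3 * ((D / 2 + 2 * (k / q ^ 84)) * (q ^ 4) ^ 16) ≤ k := by
    refine Nat.le_of_mul_le_mul_right (c := q ^ 16) ?_ (by positivity)
    have h2 : k / q ^ 84 * q ^ 80 ≤ k := le_trans (by gcongr <;> omega) hd
    have h3 : D / 2 * q ^ 80 ≤ k := le_trans (by gcongr; omega) hD
    have h4 : k * 9 ≤ k * q ^ 16 := by
      gcongr
      exact le_trans (by omega) (Nat.le_self_pow (by norm_num) q)
    calc 3 * ((D / 2 + 2 * (k / q ^ 84)) * (q ^ 4) ^ 16) * q ^ 16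
        = 3 * (D / 2 * q ^ 80) + 6 * (k / q ^ 84 * q ^ 80) := by ring
      _ ≤ k * q ^ 16 := by omega
  refine ⟨h1, le_trans ?_ h1⟩
  calc 3 * (r * (D / 2 + 2 * (k / q ^ 84)) * q ^ 4)
      = 3 * ((D / 2 + 2 * (k / q ^ 84)) * (q ^ 4 * r)) := by ring
    _ ≤ 3 * ((D / 2 + 2 * (k / q ^ 84)) * (q ^ 4 * q ^ 60)) := by
        gcongr
        exact hrq.trans (Nat.le_self_pow (by norm_num) q)
    _ = _ := by ring

theorem mul_le_sq_of_scale (hq : 1 ≤ q) (hD : D * q ^ 80 ≤ k) :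
    D ≤ k / q ∧ k / q ^ 2 ≤ k / q ∧
      k * (D + 3 * (k / q ^ 2)) ≤ (k / q + 1) * (4 * (k / q + 1)) := by
  have hM : k / q ^ 2 * q ^ 2 ≤ k := Nat.div_mul_le_self _ _
  have hD2 : D * q ^ 2 ≤ k := le_trans (by gcongr <;> omega) hD
  refine ⟨?_, Nat.div_le_div_left (Nat.le_self_pow (by norm_num) q) (by omega), ?_⟩
  · rw [Nat.le_div_iff_mul_le (by omega)]
    exact le_trans (Nat.mul_le_mul_left _ (Nat.le_self_pow (by norm_num) q)) hD
  · have hu : k ≤ (k / q + 1) * q := ((Nat.div_lt_iff_lt_mul (by omega)).1 (Nat.lt_succ_self _)).le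
    have h4 : D * q ^ 2 + 3 * (k / q ^ 2 * q ^ 2) ≤ 4 * k := by omega
    refine Nat.le_of_mul_le_mul_right (c := q ^ 2) ?_ (by positivity)
    calc k * (D + 3 * (k / q ^ 2)) * q ^ 2 = k * (D * q ^ 2 + 3 * (k / q ^ 2 * q ^ 2)) := by ring
      _ ≤ k * (4 * k) := by gcongr
      _ = 4 * (k * k) := by ring
      _ ≤ 4 * (((k / q + 1) * q) * ((k / q + 1) * q)) := by gcongr
      _ = _ := by ring

theorem mul_div_add_one_mul_le {a x : ℝ} (hq : 1 ≤ q) (hqk : q ≤ k) (hx : 0 ≤ a * x)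
    (h : 2 * (a * x) ≤ q) : a * ((k / q + 1 : ℕ) : ℝ) * x ≤ k := by
  have hq0 : (0 : ℝ) < q := by exact_mod_cast hq
  have hu : ((k / q + 1 : ℕ) : ℝ) * q ≤ 2 * k := by
    have : (k / q + 1) * q ≤ 2 * k := by
      have := Nat.div_mul_le_self k q
      rw [add_mul]
      omega
    exact_mod_cast this
  refine le_of_mul_le_mul_right ?_ hq0
  calc a * ((k / q + 1 : ℕ) : ℝ) * x * q = (a * x) * (((k / q + 1 : ℕ) : ℝ) * q) := by ring
    _ ≤ (a * x) * (2 * k) := by gcongr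
    _ = 2 * (a * x) * k := by ring
    _ ≤ q * k := by gcongr
    _ = k * q := by ring

theorem div_add_one_le_rpow {c : ℝ} (hc : 0 < c) (hq : 1 ≤ q) (hqk : q ≤ k)
    (h : 32 * (k : ℝ) ^ c ≤ q) : 8 * ((k / q + 1 : ℕ) : ℝ) ≤ ((k : ℝ) / 2) ^ (1 - c) := by
  have hk0 : (0 : ℝ) < k := by exact_mod_cast (show 0 < k by omega)
  have hp : 0 < (k : ℝ) ^ c := Real.rpow_pos_of_pos hk0 c
  have h1 := mul_div_add_one_mul_le (a := 16) (x := (k : ℝ) ^ c) hq hqk (by positivity)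
    (by linarith)
  have h2 : (k : ℝ) / (2 * (k : ℝ) ^ c) ≤ ((k : ℝ) / 2) ^ (1 - c) := by
    rw [Real.div_rpow hk0.le (by norm_num), Real.rpow_sub hk0, Real.rpow_one]
    have h3 : (2 : ℝ) ^ (1 - c) ≤ 2 := by
      calc (2 : ℝ) ^ (1 - c) ≤ 2 ^ (1 : ℝ) :=
            Real.rpow_le_rpow_of_exponent_le (by norm_num) (by linarith)
        _ = 2 := Real.rpow_one _
    rw [div_div, mul_comm]
    gcongr
  refine le_trans ?_ h2
  rw [le_div_iff₀ (by positivity)]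
  linarith

theorem div_pow_le_div_pow {m : ℕ} {C : ℝ} (hC : 1 ≤ C) (hmk : m ≤ k) (hkm : k ≤ 2 * m)
    (hm : ((k : ℝ) - m) * Real.log k ≤ k) : ((k : ℝ) / (100 * C)) ^ k ≤ ((m : ℝ) / C) ^ m := by
  rcases Nat.eq_zero_or_pos k with rfl | hk
  · obtain rfl : m = 0 := by omega
    simp
  have hk' : (0 : ℝ) < k := by exact_mod_cast hk
  have hC0 : 0 < C := by linarith
  have h1 : (k : ℝ) ^ (k - m) ≤ 3 ^ k := by
    calc (k : ℝ) ^ (k - m) = Real.exp (((k - m : ℕ) : ℝ) * Real.log k) := by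
          rw [Real.exp_nat_mul, Real.exp_log hk']
      _ ≤ Real.exp k := Real.exp_le_exp.2 (by rw [Nat.cast_sub hmk]; exact hm)
      _ = Real.exp 1 ^ k := by rw [← Real.exp_nat_mul, mul_one]
      _ ≤ 3 ^ k := by
          gcongr
          have := Real.exp_one_lt_d9
          linarith
  have h2 : (k : ℝ) ^ m ≤ 2 ^ k * (m : ℝ) ^ m := by
    calc (k : ℝ) ^ m ≤ (2 * m) ^ m := by gcongr; exact_mod_cast hkm
      _ = 2 ^ m * (m : ℝ) ^ m := mul_pow _ _ _
      _ ≤ 2 ^ k * (m : ℝ) ^ m := by gcongr; norm_num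
  have h3 : C ^ m ≤ C ^ k := pow_le_pow_right₀ hC hmk
  rw [div_pow, div_pow, div_le_div_iff₀ (by positivity) (by positivity)]
  calc (k : ℝ) ^ k * C ^ m = (k : ℝ) ^ m * (k : ℝ) ^ (k - m) * C ^ m := by
        rw [← pow_add, Nat.add_sub_cancel' hmk]
    _ ≤ (2 ^ k * (m : ℝ) ^ m) * 3 ^ k * C ^ k := by gcongr
    _ = (m : ℝ) ^ m * (2 * 3 * C) ^ k := by rw [mul_pow, mul_pow]; ring
    _ ≤ (m : ℝ) ^ m * (100 * C) ^ k := by gcongr; linarith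

end ScaleBounds

section Independent
variable {V : Type*} {G : SimpleGraph V} {r : ℕ} {A I : Finset V}

theorem div_pow_le_card_factors_of_independent {k D M u : ℕ} {c C : ℝ} (hr : 1 ≤ r) (hc1 : c ≤ 1)
    (hC : 1 ≤ C)
    (ih : ∀ (R : Finset V) (m : ℕ), 1 ≤ m → #R = r * m →
      (∀ v ∈ R, (codeg G R v : ℝ) ≤ m + (m : ℝ) ^ (1 - c)) → HasFactor G r R →
      ((m : ℝ) / C) ^ ((r - 1) * m) ≤ #(factors G r R))
    (hA : #A = (r + 1) * k) (hIA : I ⊆ A) (hI : ∀ u ∈ I, ∀ v ∈ I, ¬ G.Adj u v)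
    (hIk : k ≤ #I + 3 * M) (hcod : ∀ v ∈ A, codeg G A v ≤ k + D) (hF : HasFactor G (r + 1) A)
    (hu : 1 ≤ u) (hM : M ≤ u) (hD : D ≤ u) (hkDM : k * (D + 3 * M) ≤ u * (4 * u))
    (huk : (2 * r + 15) * u ≤ k) (hlog : (2 * r + 8) * (u : ℝ) * Real.log k ≤ k)
    (hrpow : 8 * (u : ℝ) ≤ ((k : ℝ) / 2) ^ (1 - c)) :
    ((k : ℝ) / (100 * C)) ^ (r * k) ≤ #(factors G (r + 1) A) := by
  have hk17 : 17 * u ≤ k := le_trans (by gcongr; omega) huk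
  have hk1 : 1 ≤ k := by omega
  have hl0 : 0 ≤ Real.log k := Real.log_natCast_nonneg k
  have hru : u ≤ r * u := Nat.le_mul_of_pos_left _ hr
  have huk' : 2 * (r * u) + 15 * u ≤ k := by linarith
  obtain ⟨m, R, hm1, hm2, hR, hRc, hRF, hcount⟩ :=
    exists_subset_card_factors_mul_factorial_le (η := 3 * M) (h := u) (b := 4 * u)
      (d := (r + 4) * u) hr hA hIA hI hIk hcod hF hu hkDM (by rw [add_mul]; omega)
      (by gcongr; omega) (by rw [add_mul]; omega)
  have hm0 : 1 ≤ m := by omega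
  have hkm : (k : ℝ) / 2 ≤ m := by
    rw [div_le_iff₀ (by norm_num)]
    exact_mod_cast (show k ≤ m * 2 by omega)
  have hRc' : ∀ v ∈ R, (codeg G R v : ℝ) ≤ m + (m : ℝ) ^ (1 - c) := by
    intro v hv
    have h1 : codeg G R v ≤ m + 8 * u := (hRc v hv).trans (by omega)
    have h2 : ((k : ℝ) / 2) ^ (1 - c) ≤ (m : ℝ) ^ (1 - c) :=
      Real.rpow_le_rpow (by positivity) hkm (by linarith)
    calc (codeg G R v : ℝ) ≤ ((m + 8 * u : ℕ) : ℝ) := by exact_mod_cast h1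
      _ = m + 8 * (u : ℝ) := by push_cast; ring
      _ ≤ _ := by linarith
  have hN := ih R m hm0 hR hRc' hRF
  have hlog' : ((k : ℝ) - m) * Real.log k ≤ k := by
    refine le_trans ?_ hlog
    gcongr
    have h1 : (k : ℝ) ≤ m + (3 * M + 4 * u) := by exact_mod_cast hm1
    have h2 : (M : ℝ) ≤ u := by exact_mod_cast hM
    have h3 : (0 : ℝ) ≤ r * u := by positivity
    linarith
  have hNpos : (0 : ℝ) < #(factors G r R) := by exact_mod_cast hRF.one_le
  have hcount' : (m.factorial : ℝ) ≤ 4 ^ m * (2 * ((r + 4) * u)).factorial *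
      (#(factors G (r + 1) A) / #(factors G r R)) := by
    rw [← mul_div_assoc, le_div_iff₀ hNpos, mul_comm]
    have h1 : (#(factors G r R) * m.factorial : ℝ) ≤
        2 ^ m * (2 * ((r + 4) * u)).factorial * #(factors G (r + 1) A) := by exact_mod_cast hcount
    refine h1.trans ?_
    gcongr
    norm_num
  have hfin := pow_le_of_factorial_le (by positivity) hm2 hlog'
    (by push_cast; linarith) (by rw [add_mul]; omega) hcount'
  rw [le_div_iff₀ hNpos] at hfin
  have h100 := div_pow_le_div_pow hC hm2 (by omega) hlog'
  have hC0 : 0 < C := by linarith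
  obtain ⟨p, rfl⟩ : ∃ p, r = p + 1 := ⟨r - 1, by omega⟩
  rw [Nat.add_sub_cancel] at hN
  calc ((k : ℝ) / (100 * C)) ^ ((p + 1) * k)
      = ((k : ℝ) / (100 * C)) ^ k * (((k : ℝ) / (100 * C)) ^ k) ^ p := by
        rw [← pow_mul, ← pow_add]; congr 1; ring
    _ ≤ ((k : ℝ) / 100) ^ k * (((m : ℝ) / C) ^ m) ^ p := by
        gcongr
        linarith
    _ = ((k : ℝ) / 100) ^ k * ((m : ℝ) / C) ^ (p * m) := by
        rw [← pow_mul, mul_comm m p]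
    _ ≤ ((k : ℝ) / 100) ^ k * #(factors G (p + 1) R) := by gcongr
    _ ≤ _ := hfin

end Independent

section Induction

theorem mul_div_pow_le_of_le {e : ℕ} {x a b c N : ℝ} (hx : 0 ≤ x) (ha : 1 ≤ a) (hb : 0 < b)
    (he : 1 ≤ e) (hc : a * b ≤ c) (h : (x / b) ^ e ≤ N) : a * (x / c) ^ e ≤ N := by
  have ha0 : 0 < a := by linarith
  have hc0 : 0 < c := lt_of_lt_of_le (by positivity) hc
  calc a * (x / c) ^ e ≤ a ^ e * (x / (a * b)) ^ e := by
        gcongr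
        exact le_self_pow₀ ha (Nat.one_le_iff_ne_zero.1 he)
    _ = (x / b) ^ e := by
        rw [← mul_pow]
        congr 1
        field_simp
    _ ≤ N := h

/-- The counting bound for partitions into `r`-cliques, uniform over all ground sets that can be
partitioned and whose codegrees exceed the extremal value only slightly. -/
def CountBound (r : ℕ) : Prop :=
  ∀ c : ℝ, 0 < c → c ≤ 1 / 4 → ∃ C : ℝ, 1 ≤ C ∧ ∀ (V : Type) (G : SimpleGraph V) (A : Finset V)
    (k : ℕ), 1 ≤ k → #A = r * k → (∀ v ∈ A, (codeg G A v : ℝ) ≤ k + (k : ℝ) ^ (1 - c)) →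
    HasFactor G r A → ((k : ℝ) / C) ^ ((r - 1) * k) ≤ #(factors G r A)

theorem countBound_one : CountBound 1 := fun _ _ _ =>
  ⟨1, le_rfl, fun _ _ _ _ _ _ _ hF => by simpa using hF.one_le⟩

variable {V : Type*} {G : SimpleGraph V} {A : Finset V}

theorem div_pow_le_or_exists_halves {p k D q : ℕ} {c C : ℝ} (hp : 1 ≤ p) (hc : 0 < c) (hc1 : c ≤ 1)
    (hC : 1 ≤ C)
    (ih : ∀ (R : Finset V) (m : ℕ), 1 ≤ m → #R = p * m →
      (∀ v ∈ R, (codeg G R v : ℝ) ≤ m + (m : ℝ) ^ (1 - c)) → HasFactor G p R →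
      ((m : ℝ) / C) ^ ((p - 1) * m) ≤ #(factors G p R))
    (hq : 100 * (p + 2) ^ (p + 4) + 60 * (p + 1) + 1000 ≤ q) (hqk : q ^ 320 ≤ k)
    (hD : D * q ^ 80 ≤ k) (hlog : 1000 * ((p : ℝ) + 1) * Real.log ((p + 1 : ℕ) * k) ≤ q)
    (hrpow : 32 * (k : ℝ) ^ c ≤ q) (hA : #A = (p + 1) * k)
    (hcod : ∀ v ∈ A, codeg G A v ≤ k + D) (hF : HasFactor G (p + 1) A) :
    ((k : ℝ) / (100 * C)) ^ (p * k) ≤ #(factors G (p + 1) A) ∨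
    ∃ 𝓑 ⊆ A.powerset, 2 ^ #A ≤ 2 ^ (p + 1 + 1) * #𝓑 ∧ ∀ B ∈ 𝓑, ∃ k₁ k₂, k₁ + k₂ = k ∧
      k < 2 * k₁ + 2 * (k / q ^ 84) ∧ k < 2 * k₂ + 2 * (k / q ^ 84) ∧
      #B = (p + 1) * k₁ ∧ #(A \ B) = (p + 1) * k₂ ∧
      (∀ v ∈ B, codeg G B v ≤ k₁ + (D / 2 + 2 * (k / q ^ 84))) ∧ HasFactor G (p + 1) B ∧
      (∀ v ∈ A \ B, codeg G (A \ B) v ≤ k₂ + (D / 2 + 2 * (k / q ^ 84))) ∧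
      HasFactor G (p + 1) (A \ B) := by
  have hq1000 : 1000 + 60 * (p + 1) ≤ q := le_trans (by omega) hq
  have hq1 : 0 < q := by omega
  have hqk1 : q ≤ k := (Nat.le_self_pow (by norm_num) q).trans hqk
  have hk1 : 1 ≤ k := by omega
  have hk0 : (1 : ℝ) ≤ k := by exact_mod_cast hk1
  have hp0 : (1 : ℝ) ≤ p := by exact_mod_cast hp
  have hq0 : (1000 : ℝ) + 60 * (p + 1) ≤ q := by exact_mod_cast hq1000
  have hl0 : 0 ≤ Real.log k := Real.log_natCast_nonneg k
  have hlk : Real.log k ≤ Real.log ((p + 1 : ℕ) * k) := by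
    refine Real.log_le_log (by linarith) ?_
    push_cast
    nlinarith
  have hlog' : 1000 * ((p : ℝ) + 1) * Real.log k ≤ q := le_trans (by gcongr) hlog
  have hpl : 0 ≤ p * Real.log k := by positivity
  have hpl1 : Real.log k ≤ p * Real.log k := le_mul_of_one_le_left hl0 hp0
  obtain ⟨hDu, hMu, hkDM⟩ := mul_le_sq_of_scale (by omega) hD
  have hu1000 : 1000 * (k / q) ≤ k :=
    le_trans (by rw [mul_comm]; exact Nat.mul_le_mul_left _ (by omega)) (Nat.div_mul_le_self k q)
  have hu1 : 1 ≤ k / q := (Nat.one_le_div_iff (by omega)).2 hqk1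
  set M := k / q ^ 2 with hM
  set u := k / q + 1 with hu
  by_cases hind : ∃ v ∈ A, k < codeg G A v + M ∧
      ∀ P, IsMatchingIn G {u ∈ A | ¬ G.Adj v u} P → #P < M
  · obtain ⟨v, hv, hkv, hP⟩ := hind
    obtain ⟨I, hIJ, hI, hcard⟩ := exists_independent_of_forall_isMatchingIn _ hP
    left
    refine div_pow_le_card_factors_of_independent (D := D) (M := M) (u := u) hp hc1 hC ih hA
      (hIJ.trans (filter_subset _ _)) hI ?_ hcod hF (by omega) (by omega) (by omega) hkDM ?_ ?_ ?_
    · unfold codeg at hkv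
      omega
    · have := mul_div_add_one_mul_le (q := q) (k := k) (a := 2 * p + 15) (x := 1) (by omega) hqk1
        (by positivity) (by linarith)
      rw [mul_one] at this
      exact_mod_cast this
    · exact mul_div_add_one_mul_le (by omega) hqk1 (by positivity) (by linarith)
    · exact div_add_one_le_rpow hc (by omega) hqk1 hrpow
  by_cases hlink : p + 1 = 2 → ∀ x ∈ A, ∀ y ∈ A, x ≠ y → M ≤ conbrs G A x y ∨
      M ≤ #{z ∈ A | M ≤ conbrs G A x z ∧ M ≤ conbrs G A z y}
  · right
    have hdq : k < (k / q ^ 84 + 1) * q ^ 84 :=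
      (Nat.div_lt_iff_lt_mul (by positivity)).1 (Nat.lt_succ_self _)
    have hd1 : 1 ≤ k / q ^ 84 := (Nat.one_le_div_iff (by positivity)).2
      ((Nat.pow_le_pow_right (by omega) (show 84 ≤ 320 by norm_num)).trans hqk)
    have hdu : k / q ^ 84 ≤ k / q :=
      Nat.div_le_div_left (Nat.le_self_pow (by norm_num) q) (by omega)
    have hqq : q ≤ q ^ 4 := Nat.le_self_pow (by norm_num) q
    obtain ⟨h16, hr3⟩ := three_mul_surplus_le (r := p + 1) (by omega) (by omega) hD
    have hlogq : Real.log ((p + 1 : ℕ) * k) ≤ q := by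
      refine le_trans (le_mul_of_one_le_left (hl0.trans hlk) ?_) hlog
      linarith
    refine exists_halves (M := M) (t := q ^ 4) (by omega) hk1 hA hcod ?_ hlink hd1
      (Nat.div_le_self _ _) ?_ ?_ ?_ (by omega) ?_ (twelve_mul_div_lt (by omega) hqk hD) h16 hr3
    · intro v hv
      by_contra! h
      exact hind ⟨v, hv, h.1, h.2⟩
    · refine two_pow_mul_exp_le_one (by omega) (by omega) hqk hlogq ?_
      have h2 : k ≤ 2 * (k / q ^ 84 * q ^ 84) := by
        have := Nat.mul_le_mul_right (q ^ 84) hd1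
        rw [add_mul] at hdq
        omega
      exact_mod_cast h2
    · refine le_trans ?_ hqq
      change 100 * (p + 2) ^ (p + 4) ≤ q
      omega
    · calc 3 * (q ^ 4) ^ 40 ≤ q ^ 160 * (q ^ 4) ^ 40 := by
            gcongr
            exact le_trans (by omega) (Nat.le_self_pow (by norm_num) q)
        _ = q ^ 320 := by rw [← pow_mul, ← pow_add]
        _ ≤ k := hqk
    · exact hlogq.trans (by exact_mod_cast hqq)
  · left
    push Not at hlink
    obtain ⟨hp2, x, hx, y, hy, -, hxy, hZ⟩ := hlink
    obtain rfl : p = 1 := by omega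
    obtain ⟨m, hm1, hm2, hm⟩ := factorial_le_of_conbrs_lt (k := k) (D := D) (M := M)
      (E := 4 * D + 4 * M) hA hF hcod le_rfl (by omega) hx hy hxy hZ
    have h89 : (89 : ℝ) * (u : ℝ) * Real.log k ≤ k :=
      mul_div_add_one_mul_le (by omega) hqk1 (by positivity) (by push_cast at hlog'; linarith)
    have hE1 : (k : ℝ) ≤ m + 89 * (u : ℝ) := by
      exact_mod_cast (show k ≤ m + 89 * u by omega)
    have hE2 : (2 : ℝ) * ((2 * (4 * D + 4 * M) : ℕ) : ℝ) ≤ 89 * u := by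
      exact_mod_cast (show 2 * (2 * (4 * D + 4 * M)) ≤ 89 * u by omega)
    have hfin := pow_le_of_factorial_le (m := m) (k := k) (d := 2 * (4 * D + 4 * M))
      (N := #(factors G 2 A)) (by positivity) hm2
      (le_trans (by gcongr; linarith) h89) (le_trans (by gcongr) h89) (by omega) (by
        rw [← mul_assoc 2 2]
        exact_mod_cast hm)
    rw [one_mul]
    refine le_trans ?_ hfin
    gcongr
    linarith

theorem CountBound.succ {p : ℕ} (hp : 1 ≤ p) (h : CountBound p) : CountBound (p + 1) := by
  intro c hc hc4
  obtain ⟨C, hC, ih⟩ := h (c / 160) (by positivity) (by linarith)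
  have hp0 : (1 : ℝ) ≤ p := by exact_mod_cast hp
  have hK : 0 ≤ 1000 * ((p : ℝ) + 1) + 16 / c := by positivity
  obtain ⟨k₀, hk₀⟩ := exists_scale hc hc4 (p + 1) (100 * (p + 2) ^ (p + 4) + 60 * (p + 1) + 1000)
    (by omega) (1000 * ((p : ℝ) + 1) + 16 / c) hK
  have h2 : (1 : ℝ) ≤ 2 ^ (p + 1 + 1) := one_le_pow₀ (by norm_num)
  set C' : ℝ := 2 ^ (p + 1 + 1) * (100 * C + k₀) with hC'
  have hk₀0 : (0 : ℝ) ≤ k₀ := Nat.cast_nonneg _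
  have hC'1 : 1 ≤ C' := one_le_mul_of_one_le_of_one_le h2 (by linarith)
  refine ⟨C', hC'1, fun V G A k hk hA hcod hF => ?_⟩
  suffices hs : 2 ^ (p + 1 + 1) * ((k : ℝ) / C') ^ (p * k) ≤ #(factors G (p + 1) A) from
    le_trans (le_mul_of_one_le_left (by positivity) h2) hs
  induction k using Nat.strong_induction_on generalizing A with
  | _ k ihk =>
  have hpk : 1 ≤ p * k := Nat.mul_pos hp hk
  rcases lt_or_ge k k₀ with hlt | hge
  · refine mul_div_pow_le_of_le (b := 100 * C + k₀) (by positivity) h2 (by positivity) hpk le_rfl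
      (le_trans (pow_le_one₀ (by positivity) ?_) (by exact_mod_cast hF.one_le))
    rw [div_le_one (by positivity)]
    have : (k : ℝ) ≤ k₀ := by exact_mod_cast hlt.le
    linarith
  obtain ⟨q, hq, hqk, hqD, hqlog, hqpow, hq84⟩ := hk₀ k hge
  have hk1 : (1 : ℝ) ≤ k := by exact_mod_cast hk
  set D := ⌊(k : ℝ) ^ (1 - c)⌋₊ with hD
  have hDk : (D : ℝ) ≤ (k : ℝ) ^ (1 - c) := Nat.floor_le (by positivity)
  have hcodD : ∀ v ∈ A, codeg G A v ≤ k + D := by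
    intro v hv
    have h1 : ((codeg G A v - k : ℕ) : ℝ) ≤ (k : ℝ) ^ (1 - c) := by
      rcases le_total (codeg G A v) k with h | h
      · rw [Nat.sub_eq_zero_of_le h, Nat.cast_zero]
        positivity
      · rw [Nat.cast_sub h]
        linarith [hcod v hv]
    have h3 := Nat.le_floor h1
    omega
  have hl0 : 0 ≤ Real.log ((p + 1 : ℕ) * k) := by
    rw [← Nat.cast_mul]
    exact Real.log_natCast_nonneg _
  have hpw1 : 0 ≤ (k : ℝ) ^ (c / 160) := by positivity
  have hpw2 : 0 ≤ (k : ℝ) ^ c := by positivity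
  have hc16 : 0 ≤ 16 / c := by positivity
  rcases div_pow_le_or_exists_halves hp (by positivity : 0 < c / 160) (by linarith) hC
    (fun R m => ih V G R m) hq hqk (hqD D hDk)
    (le_trans (mul_le_mul_of_nonneg_right (by linarith) hl0) hqlog)
    (le_trans (mul_le_mul_of_nonneg_right (by linarith) hpw1) hqpow) hA hcodD hF with h1 | h1
  · refine mul_div_pow_le_of_le (by positivity) h2 (by positivity) hpk ?_ h1
    rw [hC']
    gcongr
    linarith
  · obtain ⟨𝓑, h𝓑A, h𝓑, h𝓑h⟩ := h1
    have hq1000 : 1000 ≤ q := by omega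
    have hd : k / q ^ 84 * q ^ 84 ≤ k := Nat.div_mul_le_self _ _
    have hd6 : 6 * (k / q ^ 84) ≤ k := by
      refine le_trans ?_ hd
      rw [mul_comm]
      gcongr
      exact le_trans (by omega) (Nat.le_self_pow (by norm_num) q)
    have hdc : 16 * ((k / q ^ 84 : ℕ) : ℝ) * (k : ℝ) ^ c ≤ c * k := by
      have h3 : 16 / c * (k : ℝ) ^ c ≤ (q : ℝ) ^ 84 :=
        le_trans (mul_le_mul_of_nonneg_right (by linarith) hpw2) hq84
      have h4 : ((k / q ^ 84 : ℕ) : ℝ) * (q : ℝ) ^ 84 ≤ k := by exact_mod_cast hd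
      calc 16 * ((k / q ^ 84 : ℕ) : ℝ) * (k : ℝ) ^ c
          = c * (((k / q ^ 84 : ℕ) : ℝ) * (16 / c * (k : ℝ) ^ c)) := by field_simp
        _ ≤ c * (((k / q ^ 84 : ℕ) : ℝ) * (q : ℝ) ^ 84) := by gcongr
        _ ≤ c * k := by gcongr
    have hrec : ∀ (B : Finset V) (k₁ : ℕ), k < 2 * k₁ + 2 * (k / q ^ 84) → k₁ < k →
        #B = (p + 1) * k₁ → (∀ v ∈ B, codeg G B v ≤ k₁ + (D / 2 + 2 * (k / q ^ 84))) →
        HasFactor G (p + 1) B →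
        2 ^ (p + 1 + 1) * ((k₁ : ℝ) / C') ^ (p * k₁) ≤ #(factors G (p + 1) B) := by
      intro B k₁ hk₁ hk₁k hB hBc hBF
      refine ihk k₁ hk₁k B (by omega) hB (fun v hv => ?_) hBF
      have h3 := surplus_half_le hc hc4 hk hk₁ hd6 hdc hDk
      have h4 : (codeg G B v : ℝ) ≤ k₁ + ((D / 2 + 2 * (k / q ^ 84) : ℕ) : ℝ) := by
        exact_mod_cast hBc v hv
      linarith
    refine le_card_factors_of_halves (r := p + 1) (by omega) hA (by positivity) h𝓑A h𝓑
      fun B hB => ?_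
    obtain ⟨k₁, k₂, hk12, hk₁, hk₂, hB₁, hB₂, hc₁, hF₁, hc₂, hF₂⟩ := h𝓑h B hB
    exact ⟨k₁, k₂, by omega, by omega, hk12, hrec B k₁ hk₁ (by omega) hB₁ hc₁ hF₁,
      hrec _ k₂ hk₂ (by omega) hB₂ hc₂ hF₂⟩

theorem countBound {r : ℕ} (hr : 1 ≤ r) : CountBound r :=
  Nat.le_induction countBound_one (fun _ hp h => h.succ hp) r hr

end Induction

theorem exists_const_div_pow_le_card_factors {r : ℕ} (hr : 1 ≤ r) :
    ∃ C : ℝ, 1 ≤ C ∧ ∀ (V : Type) (G : SimpleGraph V) (A : Finset V) (k : ℕ), 1 ≤ k →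
      #A = r * k → (∀ v ∈ A, codeg G A v ≤ k) →
      ((k : ℝ) / C) ^ ((r - 1) * k) ≤ #(factors G r A) := by
  obtain ⟨C, hC, h⟩ := countBound hr (1 / 4) (by norm_num) le_rfl
  refine ⟨C, hC, fun V G A k hk hA hcod => h V G A k hk hA (fun v hv => ?_)
    (hasFactor_of_codeg_le hA hcod)⟩
  have h1 : (codeg G A v : ℝ) ≤ k := by exact_mod_cast hcod v hv
  have h2 : (0 : ℝ) ≤ (k : ℝ) ^ (1 - (1 / 4 : ℝ)) := by positivity
  linarith

theorem ncard_setOf_isKrFactor {V : Type*} [Fintype V] [DecidableEq V] (G : SimpleGraph V) (r : ℕ) :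
    Set.ncard {F : Finset (Finset V) | IsKrFactor G r F} = #(factors G r univ) := by
  rw [← Set.ncard_coe_finset]
  congr 1
  ext F
  simp only [Set.mem_ofPred_eq, mem_coe, mem_factors, IsFactor, IsKrFactor]
  convert Iff.rfl

theorem codeg_univ_le {n k r : ℕ} (hr : 1 ≤ r) (hn : n = r * k) (G : SimpleGraph (Fin n))
    [DecidableRel G.Adj] (v : Fin n) (h : (1 - 1 / (r : ℝ)) * n ≤ (G.degree v : ℝ)) :
    codeg G univ v ≤ k := by
  have h1 := card_adj_add_codeg (G := G) (A := univ) v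
  rw [card_univ, Fintype.card_fin] at h1
  have h2 : G.degree v + codeg G univ v = n := by
    rw [← G.card_neighborFinset_eq_degree, G.neighborFinset_eq_filter]
    convert h1
  have hr0 : (0 : ℝ) < r := by exact_mod_cast hr
  have h3 : (1 - 1 / (r : ℝ)) * n = n - k := by
    rw [hn]
    push_cast
    field_simp
  have h4 : (n : ℝ) ≤ G.degree v + k := by linarith
  have h5 : n ≤ G.degree v + k := by exact_mod_cast h4
  omega

end CliqueFactor

/-- Hajnal–Szemerédi counting: for every `r ≥ 2` there is `C > 0` such that every graph `G` on
`n` vertices with `r ∣ n` and minimum degree at least `(1 - 1/r)n` contains at least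
`(n/C)^{(r-1)n/r}` distinct `K_r`-factors. -/
theorem statement1 :
    ∀ r : ℕ, 2 ≤ r → ∃ C : ℝ, 0 < C ∧
    ∀ n : ℕ, r ∣ n →
    ∀ (G : SimpleGraph (Fin n)) (_ : DecidableRel G.Adj),
    (∀ v, (1 - 1 / (r : ℝ)) * n ≤ (G.degree v : ℝ)) →
    ((n : ℝ) / C) ^ ((r - 1) * n / r) ≤
      (Set.ncard {F : Finset (Finset (Fin n)) | IsKrFactor G r F} : ℝ) := by
  intro r hr
  obtain ⟨C, hC, h⟩ := CliqueFactor.exists_const_div_pow_le_card_factors (r := r) (by omega)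
  have hr0 : (0 : ℝ) < r := by exact_mod_cast (show 0 < r by omega)
  refine ⟨r * C, by positivity, ?_⟩
  intro n hrn G _ hdeg
  obtain ⟨k, hk⟩ := hrn
  have hcod : ∀ v ∈ (univ : Finset (Fin n)), CliqueFactor.codeg G univ v ≤ k :=
    fun v _ => CliqueFactor.codeg_univ_le (by omega) hk G v (hdeg v)
  have hcard : #(univ : Finset (Fin n)) = r * k := by rw [card_univ, Fintype.card_fin, hk]
  rw [CliqueFactor.ncard_setOf_isKrFactor]
  have hexp : (r - 1) * n / r = (r - 1) * k := by
    rw [hk, mul_left_comm, Nat.mul_div_cancel_left _ (by omega)]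
  have hbase : (n : ℝ) / (r * C) = k / C := by
    rw [hk]
    push_cast
    field_simp
  rw [hexp, hbase]
  rcases Nat.eq_zero_or_pos k with rfl | hk0
  · simpa using (CliqueFactor.hasFactor_of_codeg_le hcard hcod).one_le
  · exact h (Fin n) G univ k hk0 hcard hcod
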